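/- Let n ≥ 2 be an integer. There exists a smooth closed curve γ(u) = (r(u), x(u)), u ∈ ℝ, periodic of period 1, with r(u) > 0 and (r'(u), x'(u)) ≠ (0,0) for all u, which is injective on [0,1) (simple), satisfies the geodesic equation (x'r'' − x''r')/((x')² + (r')²) = ((n−1)/r − r/2)·x' + (1/2)·x·r' at every u, and whose length satisfies ∫₀¹ r(u)^{n−1} e^{−(x(u)² + r(u)²)/4} √(r'(u)² + x'(u)²) du < 2 ∫₀^∞ s^{n−1} e^{−s²/4} ds. -/

import Mathlib

open Real MeasureTheory

namespace ShrinkingDoughnut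

open Set Filter Topology

section

/-! ### A comparison principle -/

/-- A function whose right limit at `a` is nonnegative and which satisfies `f' ≥ L f`
wherever it is negative stays nonnegative. -/
theorem nonneg_of_mul_le_deriv {f f' : ℝ → ℝ} {a b l L : ℝ} (hl : 0 ≤ l)
    (hlim : Tendsto f (𝓝[>] a) (𝓝 l)) (hf : ∀ t ∈ Ioo a b, HasDerivAt f (f' t) t)
    (hneg : ∀ t ∈ Ioo a b, f t < 0 → L * f t ≤ f' t) : ∀ t ∈ Ioo a b, 0 ≤ f t := by
  intro t ht
  by_contra! hlt
  set C : ℝ := |L| + 1 with hC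
  have hLC : L < C := by rw [hC]; linarith [le_abs_self L]
  have hC0 : 0 ≤ C := by rw [hC]; positivity
  set ε : ℝ := -f t / 2 * exp (-(C * (t - a))) with hε
  have hεpos : 0 < ε := by
    rw [hε]; exact mul_pos (by linarith) (exp_pos _)
  have h1 : ∀ᶠ u in 𝓝[>] a, -ε < f u := hlim.eventually (lt_mem_nhds (by linarith))
  have h2 : ∀ᶠ u in 𝓝[>] a, u ∈ Ioo a t := Ioo_mem_nhdsGT ht.1
  obtain ⟨u, hu1, hu2⟩ := (h1.and h2).exists
  have key := image_le_of_deriv_right_lt_deriv_boundary' (f := fun s => -f s)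
    (f' := fun s => -f' s) (a := u) (b := t) (B := fun s => ε * exp (C * (s - a)))
    (B' := fun s => ε * (exp (C * (s - a)) * (C * 1)))
    (fun s hs =>
      (hf s ⟨hu2.1.trans_le hs.1, hs.2.trans_lt ht.2⟩).continuousAt.neg.continuousWithinAt)
    (fun s hs => ((hf s ⟨hu2.1.trans_le hs.1, hs.2.trans ht.2⟩).neg).hasDerivWithinAt)
    (by
      have : (1:ℝ) ≤ exp (C * (u - a)) := one_le_exp (mul_nonneg hC0 (by linarith [hu2.1]))
      nlinarith)
    (by fun_prop)
    (fun s hs => by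
      have h := ((((hasDerivAt_id s).sub_const a).const_mul C).exp).const_mul ε
      exact h.hasDerivWithinAt)
    (fun s hs he => by
      have hB : 0 < ε * exp (C * (s - a)) := mul_pos hεpos (exp_pos _)
      have hs' : s ∈ Ioo a b := ⟨hu2.1.trans_le hs.1, hs.2.trans ht.2⟩
      have := hneg s hs' (by linarith)
      nlinarith)
    (right_mem_Icc.2 hu2.2.le)
  simp only [hε] at key
  rw [mul_assoc, ← exp_add] at key
  simp at key
  linarith

/-- Version of `nonneg_of_mul_le_deriv` for a function continuous at the left end point. -/
theorem nonneg_of_mul_le_deriv_of_continuousWithinAt {f f' : ℝ → ℝ} {a b L : ℝ} (h0 : 0 ≤ f a)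
    (hc : ContinuousWithinAt f (Ioi a) a) (hf : ∀ t ∈ Ioo a b, HasDerivAt f (f' t) t)
    (hneg : ∀ t ∈ Ioo a b, f t < 0 → L * f t ≤ f' t) : ∀ t ∈ Ioo a b, 0 ≤ f t :=
  nonneg_of_mul_le_deriv h0 hc hf hneg

/-! ### Arcs parametrised by their tangent angle -/

/-- The coefficient of `cos θ` in the speed of the tangent angle. -/
noncomputable def mc (N q : ℝ) : ℝ := N / q - q / 2

/-- The geodesic curvature, as a function of the tangent angle and the position. -/
noncomputable def curv (N θ x q : ℝ) : ℝ := mc N q * cos θ + x * sin θ / 2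

/-- A geodesic arc leaving the axis `x = 0` orthogonally at `q = a`, parametrised by its tangent
angle in `[0, b]`. Negative `q` encode arcs traversed backwards, with `r = -q`. -/
structure IsArc (N a b : ℝ) (x q : ℝ → ℝ) : Prop where
  N_pos : 1 ≤ N
  b_pos : 0 < b
  b_le : b ≤ π / 2
  psi_pos : 0 < mc N a + 1 / a
  x_zero : x 0 = 0
  q_zero : q 0 = a
  same_sign : ∀ θ ∈ Icc 0 b, 0 < a * q θ
  curv_pos : ∀ θ ∈ Icc 0 b, 0 < curv N θ (x θ) (q θ)
  hasDerivAt_x : ∀ θ ∈ Icc 0 b, HasDerivAt x (cos θ / curv N θ (x θ) (q θ)) θ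
  hasDerivAt_q : ∀ θ ∈ Icc 0 b, HasDerivAt q (sin θ / curv N θ (x θ) (q θ)) θ
  bound : ∀ θ ∈ Icc 0 b, x θ ^ 2 ≤ 2 ∨ 0 ≤ mc N (q θ)

/-- `x tan θ / 2`. -/
noncomputable def pif (θ x : ℝ) : ℝ := x * sin θ / (2 * cos θ)

/-- The curvature divided by `cos θ`. -/
noncomputable def pf (N θ x q : ℝ) : ℝ := mc N q + pif θ x

/-- The defect of `x / sin θ` from being stationary. -/
noncomputable def zf (N θ x q : ℝ) : ℝ := 1 - curv N θ x q * x / sin θ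

/-- The function whose sign yields the growth estimate. -/
noncomputable def gf (N θ x q : ℝ) : ℝ :=
  pif θ x * (pf N θ x q + 1 / q) / 3 - zf N θ x q / 2

theorem curv_eq_pf_mul_cos {N θ x q : ℝ} (hc : cos θ ≠ 0) :
    curv N θ x q = pf N θ x q * cos θ := by
  unfold curv pf pif; field_simp

namespace IsArc

variable {N a b : ℝ} {x q : ℝ → ℝ}

theorem a_ne (h : IsArc N a b x q) : a ≠ 0 := by
  have := h.same_sign 0 ⟨le_rfl, h.b_pos.le⟩
  rintro rfl; simp at this

theorem q_ne (h : IsArc N a b x q) {θ : ℝ} (hθ : θ ∈ Icc 0 b) : q θ ≠ 0 := by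
  have := h.same_sign θ hθ
  intro h0; simp [h0] at this

theorem mono (h : IsArc N a b x q) {b' : ℝ} (h0 : 0 < b') (hb : b' ≤ b) : IsArc N a b' x q where
  N_pos := h.N_pos
  b_pos := h0
  b_le := hb.trans h.b_le
  psi_pos := h.psi_pos
  x_zero := h.x_zero
  q_zero := h.q_zero
  same_sign θ hθ := h.same_sign θ ⟨hθ.1, hθ.2.trans hb⟩
  curv_pos θ hθ := h.curv_pos θ ⟨hθ.1, hθ.2.trans hb⟩
  hasDerivAt_x θ hθ := h.hasDerivAt_x θ ⟨hθ.1, hθ.2.trans hb⟩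
  hasDerivAt_q θ hθ := h.hasDerivAt_q θ ⟨hθ.1, hθ.2.trans hb⟩
  bound θ hθ := h.bound θ ⟨hθ.1, hθ.2.trans hb⟩

theorem sin_pos' (h : IsArc N a b x q) {θ : ℝ} (hθ : θ ∈ Ioc 0 b) : 0 < sin θ :=
  sin_pos_of_pos_of_lt_pi hθ.1 (by linarith [hθ.2, h.b_le, pi_pos])

theorem cos_pos' (h : IsArc N a b x q) {θ : ℝ} (hθ : θ ∈ Ico 0 b) : 0 < cos θ :=
  cos_pos_of_mem_Ioo ⟨by linarith [hθ.1, pi_pos], by linarith [hθ.2, h.b_le]⟩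

theorem sin_nonneg' (h : IsArc N a b x q) {θ : ℝ} (hθ : θ ∈ Icc 0 b) : 0 ≤ sin θ :=
  sin_nonneg_of_nonneg_of_le_pi hθ.1 (by linarith [hθ.2, h.b_le, pi_pos])

theorem cos_nonneg' (h : IsArc N a b x q) {θ : ℝ} (hθ : θ ∈ Icc 0 b) : 0 ≤ cos θ :=
  cos_nonneg_of_mem_Icc ⟨by linarith [hθ.1, pi_pos], by linarith [hθ.2, h.b_le]⟩

theorem continuousOn_x (h : IsArc N a b x q) : ContinuousOn x (Icc 0 b) :=
  fun θ hθ => (h.hasDerivAt_x θ hθ).continuousAt.continuousWithinAt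

theorem continuousOn_q (h : IsArc N a b x q) : ContinuousOn q (Icc 0 b) :=
  fun θ hθ => (h.hasDerivAt_q θ hθ).continuousAt.continuousWithinAt

theorem monotoneOn_x (h : IsArc N a b x q) : MonotoneOn x (Icc 0 b) := by
  refine monotoneOn_of_deriv_nonneg (convex_Icc 0 b) h.continuousOn_x ?_ ?_
  · intro θ hθ
    rw [interior_Icc] at hθ
    exact (h.hasDerivAt_x θ (Ioo_subset_Icc_self hθ)).differentiableAt.differentiableWithinAt
  · intro θ hθ
    rw [interior_Icc] at hθ
    have hθ' := Ioo_subset_Icc_self hθ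
    rw [(h.hasDerivAt_x θ hθ').deriv]
    exact div_nonneg (h.cos_nonneg' hθ') (h.curv_pos θ hθ').le

theorem strictMonoOn_x (h : IsArc N a b x q) : StrictMonoOn x (Icc 0 b) := by
  refine strictMonoOn_of_deriv_pos (convex_Icc 0 b) h.continuousOn_x ?_
  intro θ hθ
  rw [interior_Icc] at hθ
  have hθ' := Ioo_subset_Icc_self hθ
  rw [(h.hasDerivAt_x θ hθ').deriv]
  exact div_pos (h.cos_pos' ⟨hθ.1.le, hθ.2⟩) (h.curv_pos θ hθ')

theorem strictMonoOn_q (h : IsArc N a b x q) : StrictMonoOn q (Icc 0 b) := by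
  refine strictMonoOn_of_deriv_pos (convex_Icc 0 b) h.continuousOn_q ?_
  intro θ hθ
  rw [interior_Icc] at hθ
  have hθ' := Ioo_subset_Icc_self hθ
  rw [(h.hasDerivAt_q θ hθ').deriv]
  exact div_pos (h.sin_pos' ⟨hθ.1, hθ.2.le⟩) (h.curv_pos θ hθ')

theorem x_pos (h : IsArc N a b x q) {θ : ℝ} (hθ : θ ∈ Ioc 0 b) : 0 < x θ := by
  rw [← h.x_zero]
  exact h.strictMonoOn_x ⟨le_rfl, h.b_pos.le⟩ ⟨hθ.1.le, hθ.2⟩ hθ.1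

theorem x_nonneg (h : IsArc N a b x q) {θ : ℝ} (hθ : θ ∈ Icc 0 b) : 0 ≤ x θ := by
  rw [← h.x_zero]
  exact h.monotoneOn_x ⟨le_rfl, h.b_pos.le⟩ hθ hθ.1

theorem mc_a_pos (h : IsArc N a b x q) : 0 < mc N a := by
  have := h.curv_pos 0 ⟨le_rfl, h.b_pos.le⟩
  simpa [curv, h.x_zero, h.q_zero] using this

theorem hasDerivAt_mc (h : IsArc N a b x q) {θ : ℝ} (hθ : θ ∈ Icc 0 b) :
    HasDerivAt (fun θ => mc N (q θ))
      (-(1 / 2 + N / q θ ^ 2) * (sin θ / curv N θ (x θ) (q θ))) θ := by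
  have hq := h.q_ne hθ
  have h1 := h.hasDerivAt_q θ hθ
  have := ((hasDerivAt_const θ N).div h1 hq).sub (h1.div_const 2)
  refine this.congr_deriv ?_
  have := (h.curv_pos θ hθ).ne'
  field_simp
  ring

theorem hasDerivAt_curv (h : IsArc N a b x q) {θ : ℝ} (hθ : θ ∈ Icc 0 b) :
    HasDerivAt (fun θ => curv N θ (x θ) (q θ))
      (-(N / q θ ^ 2) * (sin θ * cos θ / curv N θ (x θ) (q θ)) - mc N (q θ) * sin θ
        + x θ * cos θ / 2) θ := by
  have h1 := h.hasDerivAt_mc hθ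
  have h2 := h.hasDerivAt_x θ hθ
  have := (h1.mul (hasDerivAt_cos θ)).add ((h2.mul (hasDerivAt_sin θ)).div_const 2)
  refine this.congr_deriv ?_
  ring

theorem pf_pos (h : IsArc N a b x q) {θ : ℝ} (hθ : θ ∈ Ico 0 b) :
    0 < pf N θ (x θ) (q θ) := by
  have hc := h.cos_pos' hθ
  have := h.curv_pos θ ⟨hθ.1, hθ.2.le⟩
  rw [curv_eq_pf_mul_cos hc.ne'] at this
  exact pos_of_mul_pos_left this hc.le

theorem pif_pos (h : IsArc N a b x q) {θ : ℝ} (hθ : θ ∈ Ioo 0 b) : 0 < pif θ (x θ) := by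
  have hc := h.cos_pos' ⟨hθ.1.le, hθ.2⟩
  have hs := h.sin_pos' ⟨hθ.1, hθ.2.le⟩
  have hx := h.x_pos ⟨hθ.1, hθ.2.le⟩
  unfold pif; positivity

theorem zf_lt_one (h : IsArc N a b x q) {θ : ℝ} (hθ : θ ∈ Ioo 0 b) :
    zf N θ (x θ) (q θ) < 1 := by
  have hs := h.sin_pos' ⟨hθ.1, hθ.2.le⟩
  have hx := h.x_pos ⟨hθ.1, hθ.2.le⟩
  have := h.curv_pos θ ⟨hθ.1.le, hθ.2.le⟩
  have : 0 < curv N θ (x θ) (q θ) * x θ / sin θ := by positivity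
  unfold zf; linarith

theorem hasDerivAt_pif (h : IsArc N a b x q) {θ : ℝ} (hθ : θ ∈ Ioo 0 b) :
    HasDerivAt (fun θ => pif θ (x θ))
      (sin θ / curv N θ (x θ) (q θ) *
        (pf N θ (x θ) (q θ) * pif θ (x θ) + (2 - zf N θ (x θ) (q θ)) / 2)) θ := by
  have hc := h.cos_pos' ⟨hθ.1.le, hθ.2⟩
  have hs := h.sin_pos' ⟨hθ.1, hθ.2.le⟩
  have hk := h.curv_pos θ ⟨hθ.1.le, hθ.2.le⟩
  have h2 := h.hasDerivAt_x θ ⟨hθ.1.le, hθ.2.le⟩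
  have := (h2.mul (hasDerivAt_sin θ)).div ((hasDerivAt_cos θ).const_mul 2) (by positivity)
  refine this.congr_deriv ?_
  have e : pf N θ (x θ) (q θ) = curv N θ (x θ) (q θ) / cos θ := by
    rw [curv_eq_pf_mul_cos hc.ne']; field_simp
  rw [e]
  unfold zf pif
  set k := curv N θ (x θ) (q θ)
  have hsc := sin_sq_add_cos_sq θ
  simp only [Pi.mul_apply]
  field_simp
  ring

theorem hasDerivAt_pf (h : IsArc N a b x q) {θ : ℝ} (hθ : θ ∈ Ioo 0 b) :
    HasDerivAt (fun θ => pf N θ (x θ) (q θ))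
      (sin θ / curv N θ (x θ) (q θ) *
        (pf N θ (x θ) (q θ) * pif θ (x θ) + (1 - zf N θ (x θ) (q θ)) / 2 - N / q θ ^ 2)) θ := by
  refine ((h.hasDerivAt_mc ⟨hθ.1.le, hθ.2.le⟩).add (h.hasDerivAt_pif hθ)).congr_deriv ?_
  ring

theorem hasDerivAt_inv_q (h : IsArc N a b x q) {θ : ℝ} (hθ : θ ∈ Icc 0 b) :
    HasDerivAt (fun θ => 1 / q θ) (sin θ / curv N θ (x θ) (q θ) * (-1 / q θ ^ 2)) θ := by
  have hq := h.q_ne hθ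
  refine ((hasDerivAt_const θ (1:ℝ)).div (h.hasDerivAt_q θ hθ) hq).congr_deriv ?_
  ring

theorem hasDerivAt_zf (h : IsArc N a b x q) {θ : ℝ} (hθ : θ ∈ Ioo 0 b) :
    HasDerivAt (fun θ => zf N θ (x θ) (q θ))
      (sin θ / curv N θ (x θ) (q θ) *
        (mc N (q θ) * (1 - zf N θ (x θ) (q θ)) / (pf N θ (x θ) (q θ) * pif θ (x θ)) *
          (pif θ (x θ) * (pf N θ (x θ) (q θ) + 1 / q θ) - zf N θ (x θ) (q θ) / 2))) θ := by
  have hc := h.cos_pos' ⟨hθ.1.le, hθ.2⟩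
  have hs := h.sin_pos' ⟨hθ.1, hθ.2.le⟩
  have hx := h.x_pos ⟨hθ.1, hθ.2.le⟩
  have hk := h.curv_pos θ ⟨hθ.1.le, hθ.2.le⟩
  have hq := h.q_ne ⟨hθ.1.le, hθ.2.le⟩
  have h2 := h.hasDerivAt_x θ ⟨hθ.1.le, hθ.2.le⟩
  have h3 := h.hasDerivAt_curv ⟨hθ.1.le, hθ.2.le⟩
  refine (((h3.mul h2).div (hasDerivAt_sin θ) hs.ne').const_sub 1).congr_deriv ?_
  have e : pf N θ (x θ) (q θ) = curv N θ (x θ) (q θ) / cos θ := by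
    rw [curv_eq_pf_mul_cos hc.ne']; field_simp
  have hsc := sin_sq_add_cos_sq θ
  rw [e]
  unfold zf pif
  have em : mc N (q θ) = (curv N θ (x θ) (q θ) - x θ * sin θ / 2) / cos θ := by
    unfold curv; field_simp; ring
  have eN : N = q θ * (mc N (q θ) + q θ / 2) := by
    unfold mc; field_simp; ring
  have eN2 : N / q θ ^ 2 = mc N (q θ) / q θ + 1 / 2 := by
    unfold mc; field_simp; ring
  rw [eN2, em]
  set k := curv N θ (x θ) (q θ)
  simp only [Pi.mul_apply]
  rw [show curv N θ (x θ) (q θ) = k from rfl]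
  field_simp
  ring

end IsArc

end

section

namespace IsArc

variable {N a b : ℝ} {x q : ℝ → ℝ}

theorem continuousOn_curv (h : IsArc N a b x q) :
    ContinuousOn (fun θ => curv N θ (x θ) (q θ)) (Icc 0 b) :=
  fun _ hθ => (h.hasDerivAt_curv hθ).continuousAt.continuousWithinAt

theorem continuousOn_mc (h : IsArc N a b x q) :
    ContinuousOn (fun θ => mc N (q θ)) (Icc 0 b) :=
  fun _ hθ => (h.hasDerivAt_mc hθ).continuousAt.continuousWithinAt

theorem continuousOn_inv_q (h : IsArc N a b x q) :
    ContinuousOn (fun θ => 1 / q θ) (Icc 0 b) :=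
  fun _ hθ => (h.hasDerivAt_inv_q hθ).continuousAt.continuousWithinAt

theorem continuousOn_pif (h : IsArc N a b x q) :
    ContinuousOn (fun θ => pif θ (x θ)) (Ico 0 b) := by
  unfold pif
  refine ContinuousOn.div ((h.continuousOn_x.mono Ico_subset_Icc_self).mul
    continuous_sin.continuousOn) (by fun_prop) ?_
  intro θ hθ
  have := h.cos_pos' hθ
  positivity

theorem continuousOn_pf (h : IsArc N a b x q) :
    ContinuousOn (fun θ => pf N θ (x θ) (q θ)) (Ico 0 b) :=
  (h.continuousOn_mc.mono Ico_subset_Icc_self).add h.continuousOn_pif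

theorem tendsto_x_div_sin (h : IsArc N a b x q) :
    Tendsto (fun θ => x θ / sin θ) (𝓝[>] 0) (𝓝 (1 / mc N a)) := by
  have h0 : (0:ℝ) ∈ Icc 0 b := ⟨le_rfl, h.b_pos.le⟩
  have e1 := (h.hasDerivAt_x 0 h0).tendsto_slope_zero_right
  have e2 := (hasDerivAt_sin 0).tendsto_slope_zero_right
  have := e1.div e2 (by simp)
  simp only [zero_add, h.x_zero, sub_zero, sin_zero, cos_zero, div_one, smul_eq_mul, curv,
    h.q_zero, mul_one, mul_zero, zero_div, add_zero] at this
  refine this.congr' ?_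
  filter_upwards [self_mem_nhdsWithin] with t ht
  have : t ≠ 0 := ne_of_gt ht
  simp only [Pi.div_apply]
  field_simp

theorem tendsto_zero {f : ℝ → ℝ} (h : IsArc N a b x q) (hf : ContinuousOn f (Ico 0 b)) :
    Tendsto f (𝓝[>] 0) (𝓝 (f 0)) :=
  ((hf 0 ⟨le_rfl, h.b_pos⟩).mono_of_mem_nhdsWithin
    (mem_of_superset (Ioo_mem_nhdsGT h.b_pos) Ioo_subset_Ico_self))

theorem tendsto_zf (h : IsArc N a b x q) :
    Tendsto (fun θ => zf N θ (x θ) (q θ)) (𝓝[>] 0) (𝓝 0) := by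
  have h1 := h.tendsto_zero (h.continuousOn_curv.mono Ico_subset_Icc_self)
  have h2 := (h1.mul h.tendsto_x_div_sin).const_sub 1
  have hm := h.mc_a_pos.ne'
  simp only [curv, h.x_zero, h.q_zero, cos_zero, sin_zero, mul_one, mul_zero, zero_div, add_zero,
    mul_one_div, div_self hm, sub_self] at h2
  refine h2.congr fun θ => ?_
  unfold zf curv; ring

theorem pif_zero : pif 0 (x 0) = 0 := by simp [pif]

theorem pf_zero (h : IsArc N a b x q) : pf N 0 (x 0) (q 0) = mc N a := by
  simp [pf, pif, h.q_zero]

theorem tendsto_gf (h : IsArc N a b x q) :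
    Tendsto (fun θ => gf N θ (x θ) (q θ)) (𝓝[>] 0) (𝓝 0) := by
  have h1 := h.tendsto_zero h.continuousOn_pif
  have h2 := h.tendsto_zero h.continuousOn_pf
  have h3 := h.tendsto_zero (h.continuousOn_inv_q.mono Ico_subset_Icc_self)
  have := ((h1.mul (h2.add h3)).div_const 3).sub (h.tendsto_zf.div_const 2)
  rw [pif_zero, zero_mul, zero_div, zero_div, sub_zero] at this
  exact this

theorem hasDerivAt_psi (h : IsArc N a b x q) {θ : ℝ} (hθ : θ ∈ Ioo 0 b) :
    HasDerivAt (fun θ => pf N θ (x θ) (q θ) + 1 / q θ)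
      (sin θ / curv N θ (x θ) (q θ) *
        (pif θ (x θ) * (pf N θ (x θ) (q θ) + 1 / q θ) - zf N θ (x θ) (q θ) / 2
          - (pf N θ (x θ) (q θ) + 1 / q θ) / q θ)) θ := by
  have hq := h.q_ne ⟨hθ.1.le, hθ.2.le⟩
  refine ((h.hasDerivAt_pf hθ).add (h.hasDerivAt_inv_q ⟨hθ.1.le, hθ.2.le⟩)).congr_deriv ?_
  have e : N / q θ ^ 2 = (pf N θ (x θ) (q θ) - pif θ (x θ)) / q θ + 1 / 2 := by
    unfold pf mc; field_simp; ring
  rw [e]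
  ring

theorem hasDerivAt_gf (h : IsArc N a b x q) {θ : ℝ} (hθ : θ ∈ Ioo 0 b) :
    HasDerivAt (fun θ => gf N θ (x θ) (q θ))
      (sin θ / curv N θ (x θ) (q θ) *
        ((pf N θ (x θ) (q θ) + 1 / q θ) * pif θ (x θ) / (9 * pf N θ (x θ) (q θ)) *
            ((2 * pf N θ (x θ) (q θ) - 1 / q θ) ^ 2 + (2 * N - 1) / q θ ^ 2 + 2) +
          ((pf N θ (x θ) (q θ) + pif θ (x θ) + 1 / q θ) / 3 +
            (1 / pf N θ (x θ) (q θ) - 1 / pif θ (x θ)) *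
              ((1 - zf N θ (x θ) (q θ)) / 2 +
                2 / 3 * (pif θ (x θ) * (pf N θ (x θ) (q θ) + 1 / q θ)))) *
            gf N θ (x θ) (q θ))) θ := by
  have hq := h.q_ne ⟨hθ.1.le, hθ.2.le⟩
  refine ((((h.hasDerivAt_pif hθ).mul (h.hasDerivAt_psi hθ)).div_const 3).sub
    ((h.hasDerivAt_zf hθ).div_const 2)).congr_deriv ?_
  have hP := h.pf_pos ⟨hθ.1.le, hθ.2⟩
  have hPi := h.pif_pos hθ
  have eN : N = q θ * (pf N θ (x θ) (q θ) - pif θ (x θ) + q θ / 2) := by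
    unfold pf mc; field_simp; ring
  have em : mc N (q θ) = pf N θ (x θ) (q θ) - pif θ (x θ) := by unfold pf; ring
  rw [em]
  unfold gf
  generalize pif θ (x θ) = Pi at *
  generalize pf N θ (x θ) (q θ) = P at *
  generalize zf N θ (x θ) (q θ) = z at *
  generalize curv N θ (x θ) (q θ) = k at *
  rw [eN]
  generalize q θ = Q at *
  have : k ≠ 0 ∨ k = 0 := ne_or_eq _ _
  generalize hr : sin θ / k = r
  field_simp
  ring

theorem gf_nonneg_of_psi_pos (h : IsArc N a b x q)
    (hpsi : ∀ θ ∈ Ioo 0 b, 0 < pf N θ (x θ) (q θ) + 1 / q θ) :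
    ∀ θ ∈ Ioo 0 b, 0 ≤ gf N θ (x θ) (q θ) := by
  intro θ₀ hθ₀
  obtain ⟨b', hb'⟩ := exists_between hθ₀.2
  have hsub : Icc 0 b' ⊆ Ico 0 b := fun t ht => ⟨ht.1, ht.2.trans_lt hb'.2⟩
  have hcont : ContinuousOn (fun θ => sin θ / curv N θ (x θ) (q θ) *
      |(pf N θ (x θ) (q θ) + pif θ (x θ) + 1 / q θ) / 3 +
        1 / pf N θ (x θ) (q θ) * (1 / 2 +
          2 / 3 * (pif θ (x θ) * (pf N θ (x θ) (q θ) + 1 / q θ)))|) (Icc 0 b') := by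
    have c1 := h.continuousOn_pf.mono hsub
    have c2 := h.continuousOn_pif.mono hsub
    have c3 := h.continuousOn_inv_q.mono (hsub.trans Ico_subset_Icc_self)
    have c4 := h.continuousOn_curv.mono (hsub.trans Ico_subset_Icc_self)
    refine (continuous_sin.continuousOn.div c4 fun t ht =>
      (h.curv_pos t (Ico_subset_Icc_self (hsub ht))).ne').mul (ContinuousOn.abs ?_)
    refine ((c1.add c2).add c3 |>.div_const 3).add ((continuousOn_const.div c1 fun t ht =>
      (h.pf_pos (hsub ht)).ne').mul (continuousOn_const.add
        (continuousOn_const.mul (c2.mul (c1.add c3)))))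
  obtain ⟨L, hL⟩ := (isCompact_Icc.bddAbove_image hcont)
  refine nonneg_of_mul_le_deriv (b := b') (L := L) le_rfl h.tendsto_gf
    (fun t ht => h.hasDerivAt_gf ⟨ht.1, ht.2.trans hb'.2⟩) ?_ θ₀ ⟨hθ₀.1, hb'.1⟩
  intro t ht hg
  have ht' : t ∈ Ioo 0 b := ⟨ht.1, ht.2.trans hb'.2⟩
  have hLt := hL (mem_image_of_mem _ (Ioo_subset_Icc_self ht))
  have hP := h.pf_pos ⟨ht'.1.le, ht'.2⟩
  have hPi := h.pif_pos ht'
  have hz := h.zf_lt_one ht'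
  have hpsi' := hpsi t ht'
  have hk := h.curv_pos t (Ioo_subset_Icc_self ht')
  have hs := h.sin_pos' ⟨ht'.1, ht'.2.le⟩
  have hN := h.N_pos
  have hz0 : 0 < zf N t (x t) (q t) := by
    have : 0 < pif t (x t) * (pf N t (x t) (q t) + 1 / q t) := mul_pos hPi hpsi'
    unfold gf at hg; linarith
  set Pi := pif t (x t)
  set P := pf N t (x t) (q t)
  set z := zf N t (x t) (q t)
  set r := sin t / curv N t (x t) (q t) with hr
  have hr0 : 0 < r := div_pos hs hk
  have hPP : 0 < Pi * (P + 1 / q t) := mul_pos hPi hpsi'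
  have hle : (P + Pi + 1 / q t) / 3 + (1 / P - 1 / Pi) * ((1 - z) / 2 +
      2 / 3 * (Pi * (P + 1 / q t))) ≤
      |(P + Pi + 1 / q t) / 3 + 1 / P * (1 / 2 + 2 / 3 * (Pi * (P + 1 / q t)))| := by
    refine le_trans ?_ (le_abs_self _)
    have i1 : 0 < 1 / P := by positivity
    have i2 : 0 < 1 / Pi := by positivity
    have i3 : 0 < (1 - z) / 2 + 2 / 3 * (Pi * (P + 1 / q t)) := by nlinarith
    nlinarith
  have hfirst : 0 ≤ (P + 1 / q t) * Pi / (9 * P) *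
      ((2 * P - 1 / q t) ^ 2 + (2 * N - 1) / q t ^ 2 + 2) := by
    have : 0 ≤ (2 * N - 1) / q t ^ 2 := div_nonneg (by linarith) (sq_nonneg _)
    positivity
  have h1 : r * ((P + Pi + 1 / q t) / 3 + (1 / P - 1 / Pi) * ((1 - z) / 2 +
      2 / 3 * (Pi * (P + 1 / q t)))) ≤ L := (mul_le_mul_of_nonneg_left hle hr0.le).trans hLt
  have h2 := mul_le_mul_of_nonpos_right h1 hg.le
  have h3 := mul_nonneg hr0.le hfirst
  linarith

theorem psi_pos' (h : IsArc N a b x q) :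
    ∀ θ ∈ Ico 0 b, 0 < pf N θ (x θ) (q θ) + 1 / q θ := by
  rcases lt_or_gt_of_ne h.a_ne with ha | ha
  swap
  · intro θ hθ
    have := h.pf_pos hθ
    have hq : 0 < q θ := pos_of_mul_pos_right (h.same_sign θ ⟨hθ.1, hθ.2.le⟩) ha.le
    positivity
  intro θ₀ hθ₀
  by_contra! hcon
  have hc : ContinuousOn (fun θ => pf N θ (x θ) (q θ) + 1 / q θ) (Ico 0 b) :=
    h.continuousOn_pf.add (h.continuousOn_inv_q.mono Ico_subset_Icc_self)
  have hsub : Icc 0 θ₀ ⊆ Ico 0 b := fun t ht => ⟨ht.1, ht.2.trans_lt hθ₀.2⟩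
  have hcomp : IsCompact (Icc 0 θ₀ ∩ (fun θ => pf N θ (x θ) (q θ) + 1 / q θ) ⁻¹' Iic 0) :=
    isCompact_Icc.of_isClosed_subset
      ((hc.mono hsub).preimage_isClosed_of_isClosed isClosed_Icc isClosed_Iic) inter_subset_left
  obtain ⟨θ₁, ⟨hθ₁, hle⟩, hleast⟩ := hcomp.exists_isLeast ⟨θ₀, ⟨hθ₀.1, le_rfl⟩, hcon⟩
  have hstart : 0 < pf N 0 (x 0) (q 0) + 1 / q 0 := by
    rw [h.pf_zero, h.q_zero]; exact h.psi_pos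
  have hpos : 0 < θ₁ := by
    rcases hθ₁.1.eq_or_lt with e | e
    · rw [← e] at hle; exact absurd hle (not_le.2 hstart)
    · exact e
  have hθ₁b : θ₁ < b := hθ₁.2.trans_lt hθ₀.2
  have h' := h.mono hpos hθ₁b.le
  have hψ : ∀ θ ∈ Ioo 0 θ₁, 0 < pf N θ (x θ) (q θ) + 1 / q θ := by
    intro θ hθ
    by_contra! hc'
    exact absurd (hleast ⟨⟨hθ.1.le, hθ.2.le.trans hθ₁.2⟩, hc'⟩) (not_le.2 hθ.2)
  have hg := h'.gf_nonneg_of_psi_pos hψ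
  have hmono : MonotoneOn (fun θ => pf N θ (x θ) (q θ) + 1 / q θ) (Icc 0 θ₁) := by
    refine monotoneOn_of_deriv_nonneg (convex_Icc _ _)
      (hc.mono fun t ht => ⟨ht.1, ht.2.trans_lt hθ₁b⟩) ?_ ?_
    · intro θ hθ
      rw [interior_Icc] at hθ
      exact (h'.hasDerivAt_psi hθ).differentiableAt.differentiableWithinAt
    · intro θ hθ
      rw [interior_Icc] at hθ
      rw [(h'.hasDerivAt_psi hθ).deriv]
      have hk := h'.curv_pos θ (Ioo_subset_Icc_self hθ)
      have hs := h'.sin_pos' ⟨hθ.1, hθ.2.le⟩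
      have hq : q θ < 0 := by
        have := h'.same_sign θ (Ioo_subset_Icc_self hθ)
        nlinarith
      have h1 := hg θ hθ
      unfold gf at h1
      have h2 := mul_pos (h'.pif_pos hθ) (hψ θ hθ)
      have h3 : (pf N θ (x θ) (q θ) + 1 / q θ) / q θ ≤ 0 :=
        div_nonpos_of_nonneg_of_nonpos (hψ θ hθ).le hq.le
      exact mul_nonneg (div_pos hs hk).le (by linarith)
  have := hmono ⟨le_rfl, hpos.le⟩ ⟨hpos.le, le_rfl⟩ hpos.le
  simp only [mem_preimage, mem_Iic] at this hle
  linarith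

theorem gf_nonneg (h : IsArc N a b x q) : ∀ θ ∈ Ioo 0 b, 0 ≤ gf N θ (x θ) (q θ) :=
  h.gf_nonneg_of_psi_pos fun θ hθ => h.psi_pos' θ ⟨hθ.1.le, hθ.2⟩

end IsArc

end

section

namespace IsArc

variable {N a b : ℝ} {x q : ℝ → ℝ}

/-- `x² / 2` in terms of the other quantities. -/
theorem one_sub_zf_mul_pif (h : IsArc N a b x q) {θ : ℝ} (hθ : θ ∈ Ioo 0 b) :
    (1 - zf N θ (x θ) (q θ)) * pif θ (x θ) = pf N θ (x θ) (q θ) * x θ ^ 2 / 2 := by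
  have hc := h.cos_pos' ⟨hθ.1.le, hθ.2⟩
  have hs := h.sin_pos' ⟨hθ.1, hθ.2.le⟩
  unfold zf
  rw [curv_eq_pf_mul_cos hc.ne']
  generalize pf N θ (x θ) (q θ) = P
  unfold pif
  field_simp
  ring

theorem sin_sq_mul (h : IsArc N a b x q) {θ : ℝ} (hθ : θ ∈ Ioo 0 b) :
    sin θ ^ 2 * (pf N θ (x θ) (q θ) * pif θ (x θ) + (1 - zf N θ (x θ) (q θ)) / 2) =
      pf N θ (x θ) (q θ) * pif θ (x θ) := by
  have hc := h.cos_pos' ⟨hθ.1.le, hθ.2⟩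
  have hs := h.sin_pos' ⟨hθ.1, hθ.2.le⟩
  have hsc := sin_sq_add_cos_sq θ
  unfold zf
  rw [curv_eq_pf_mul_cos hc.ne']
  generalize pf N θ (x θ) (q θ) = P
  unfold pif
  field_simp
  linear_combination (P * x θ) * hsc

theorem growth (h : IsArc N a b x q) {θ : ℝ} (hθ : θ ∈ Ioo 0 b) :
    2 / 3 * (pif θ (x θ) * (pf N θ (x θ) (q θ) + 1 / q θ)) ≤
      pif θ (x θ) * (pf N θ (x θ) (q θ) + 1 / q θ) - zf N θ (x θ) (q θ) / 2 := by
  have := h.gf_nonneg θ hθ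
  unfold gf at this
  linarith

theorem growth_pos (h : IsArc N a b x q) {θ : ℝ} (hθ : θ ∈ Ioo 0 b) :
    0 < pif θ (x θ) * (pf N θ (x θ) (q θ) + 1 / q θ) - zf N θ (x θ) (q θ) / 2 := by
  have h1 := h.growth hθ
  have h2 := mul_pos (h.pif_pos hθ) (h.psi_pos' θ ⟨hθ.1.le, hθ.2⟩)
  linarith

theorem zf_nonneg (h : IsArc N a b x q) : ∀ θ ∈ Ioo 0 b, 0 ≤ zf N θ (x θ) (q θ) := by
  refine nonneg_of_mul_le_deriv (L := 0) le_rfl h.tendsto_zf (fun t ht => h.hasDerivAt_zf ht) ?_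
  intro θ hθ hz
  rw [zero_mul]
  have hP := h.pf_pos ⟨hθ.1.le, hθ.2⟩
  have hPi := h.pif_pos hθ
  have hk := h.curv_pos θ (Ioo_subset_Icc_self hθ)
  have hs := h.sin_pos' ⟨hθ.1, hθ.2.le⟩
  have hB := h.growth_pos hθ
  have hm : 0 ≤ mc N (q θ) := by
    rcases h.bound θ (Ioo_subset_Icc_self hθ) with h1 | h1
    · have e := h.one_sub_zf_mul_pif hθ
      have : pif θ (x θ) < pf N θ (x θ) (q θ) := by nlinarith
      unfold pf at this
      linarith
    · exact h1
  have : 0 ≤ 1 - zf N θ (x θ) (q θ) := by linarith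
  positivity

theorem hasDerivAt_x_div_sin (h : IsArc N a b x q) {θ : ℝ} (hθ : θ ∈ Ioc 0 b) :
    HasDerivAt (fun θ => x θ / sin θ)
      (cos θ * zf N θ (x θ) (q θ) / (curv N θ (x θ) (q θ) * sin θ)) θ := by
  have hs := h.sin_pos' hθ
  have hk := h.curv_pos θ (Ioc_subset_Icc_self hθ)
  refine ((h.hasDerivAt_x θ (Ioc_subset_Icc_self hθ)).div (hasDerivAt_sin θ) hs.ne').congr_deriv ?_
  unfold zf
  field_simp

theorem monotoneOn_x_div_sin (h : IsArc N a b x q) :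
    MonotoneOn (fun θ => x θ / sin θ) (Ioc 0 b) := by
  refine monotoneOn_of_deriv_nonneg (convex_Ioc 0 b)
    (fun t ht => (h.hasDerivAt_x_div_sin ht).continuousAt.continuousWithinAt) ?_ ?_
  · intro θ hθ
    rw [interior_Ioc] at hθ
    exact (h.hasDerivAt_x_div_sin ⟨hθ.1, hθ.2.le⟩).differentiableAt.differentiableWithinAt
  · intro θ hθ
    rw [interior_Ioc] at hθ
    rw [(h.hasDerivAt_x_div_sin ⟨hθ.1, hθ.2.le⟩).deriv]
    have hz := h.zf_nonneg θ hθ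
    have hk := h.curv_pos θ (Ioo_subset_Icc_self hθ)
    have hs := h.sin_pos' ⟨hθ.1, hθ.2.le⟩
    have hc := h.cos_pos' ⟨hθ.1.le, hθ.2⟩
    positivity

/-- The lower bound on `x` coming from the monotonicity of `x / sin θ`. -/
theorem sin_le_mul_x (h : IsArc N a b x q) {θ : ℝ} (hθ : θ ∈ Ioc 0 b) :
    sin θ ≤ mc N a * x θ := by
  have hm := h.mc_a_pos
  have hs := h.sin_pos' hθ
  have : 1 / mc N a ≤ x θ / sin θ := by
    refine le_of_tendsto h.tendsto_x_div_sin ?_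
    filter_upwards [Ioo_mem_nhdsGT hθ.1] with t ht
    exact h.monotoneOn_x_div_sin ⟨ht.1, ht.2.le.trans hθ.2⟩ hθ ht.2.le
  rw [div_le_div_iff₀ hm hs] at this
  linarith

/-- The quantity `|q| P` does not decrease along an arc. -/
theorem hasDerivAt_mul_pf (h : IsArc N a b x q) {θ : ℝ} (hθ : θ ∈ Ioo 0 b) :
    HasDerivAt (fun θ => q θ * pf N θ (x θ) (q θ))
      (sin θ / curv N θ (x θ) (q θ) * (q θ *
        (pif θ (x θ) * (pf N θ (x θ) (q θ) + 1 / q θ) - zf N θ (x θ) (q θ) / 2))) θ := by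
  have hq := h.q_ne ⟨hθ.1.le, hθ.2.le⟩
  refine ((h.hasDerivAt_q θ (Ioo_subset_Icc_self hθ)).mul (h.hasDerivAt_pf hθ)).congr_deriv ?_
  have e : N / q θ ^ 2 = (pf N θ (x θ) (q θ) - pif θ (x θ)) / q θ + 1 / 2 := by
    unfold pf mc; field_simp; ring
  rw [e]
  generalize pif θ (x θ) = Pi at *
  generalize pf N θ (x θ) (q θ) = P at *
  generalize zf N θ (x θ) (q θ) = z at *
  generalize curv N θ (x θ) (q θ) = k at *
  generalize hr : sin θ / k = r
  field_simp
  ring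

theorem monotoneOn_mul_pf (h : IsArc N a b x q) :
    MonotoneOn (fun θ => a * (q θ * pf N θ (x θ) (q θ))) (Ico 0 b) := by
  have hd : ∀ θ ∈ Ioo 0 b, HasDerivAt (fun θ => a * (q θ * pf N θ (x θ) (q θ))) _ θ :=
    fun θ hθ => (h.hasDerivAt_mul_pf hθ).const_mul a
  refine monotoneOn_of_deriv_nonneg (convex_Ico 0 b)
    (continuousOn_const.mul ((h.continuousOn_q.mono Ico_subset_Icc_self).mul h.continuousOn_pf))
    ?_ ?_
  · intro θ hθ
    rw [interior_Ico] at hθ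
    exact (hd θ hθ).differentiableAt.differentiableWithinAt
  · intro θ hθ
    rw [interior_Ico] at hθ
    rw [(hd θ hθ).deriv]
    have hk := h.curv_pos θ (Ioo_subset_Icc_self hθ)
    have hs := h.sin_pos' ⟨hθ.1, hθ.2.le⟩
    have hB := h.growth_pos hθ
    have hq := h.same_sign θ (Ioo_subset_Icc_self hθ)
    have := div_pos hs hk
    have e : a * (sin θ / curv N θ (x θ) (q θ) * (q θ *
        (pif θ (x θ) * (pf N θ (x θ) (q θ) + 1 / q θ) - zf N θ (x θ) (q θ) / 2))) =
      (a * q θ) * (sin θ / curv N θ (x θ) (q θ)) *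
        (pif θ (x θ) * (pf N θ (x θ) (q θ) + 1 / q θ) - zf N θ (x θ) (q θ) / 2) := by ring
    rw [e]
    positivity

/-- Consequence of `x ≤ √2 sin θ` at a point. -/
theorem sq_bound (h : IsArc N a (π / 2) x q) (hx : x (π / 2) ^ 2 ≤ 2) {θ : ℝ}
    (hθ : θ ∈ Ioo 0 (π / 2)) :
    (1 - zf N θ (x θ) (q θ)) *
      (pf N θ (x θ) (q θ) * pif θ (x θ) + (1 - zf N θ (x θ) (q θ)) / 2) ≤
        pf N θ (x θ) (q θ) ^ 2 := by
  have hs := h.sin_pos' ⟨hθ.1, hθ.2.le⟩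
  have h1 := h.monotoneOn_x_div_sin ⟨hθ.1, hθ.2.le⟩ ⟨by positivity, le_rfl⟩ hθ.2.le
  simp only [sin_pi_div_two, div_one] at h1
  rw [div_le_iff₀ hs] at h1
  have hx0 := h.x_nonneg (Ioo_subset_Icc_self hθ)
  have hxs : x θ ^ 2 ≤ 2 * sin θ ^ 2 := by
    calc x θ ^ 2 ≤ (x (π / 2) * sin θ) ^ 2 := by gcongr
      _ = x (π / 2) ^ 2 * sin θ ^ 2 := by ring
      _ ≤ 2 * sin θ ^ 2 := by gcongr
  have e1 := h.one_sub_zf_mul_pif hθ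
  have e2 := h.sin_sq_mul hθ
  have hP := h.pf_pos ⟨hθ.1.le, hθ.2⟩
  have hPi := h.pif_pos hθ
  have hz := h.zf_lt_one hθ
  generalize pif θ (x θ) = Pi at *
  generalize pf N θ (x θ) (q θ) = P at *
  generalize zf N θ (x θ) (q θ) = z at *
  have h3 : (1 - z) * Pi ≤ P * sin θ ^ 2 := by nlinarith
  have hA : 0 < P * Pi + (1 - z) / 2 := by
    have : 0 < P * Pi := mul_pos hP hPi
    linarith
  have h4 := mul_le_mul_of_nonneg_right h3 hA.le
  have h5 : ((1 - z) * (P * Pi + (1 - z) / 2)) * Pi ≤ P ^ 2 * Pi := by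
    calc _ = (1 - z) * Pi * (P * Pi + (1 - z) / 2) := by ring
      _ ≤ P * (sin θ ^ 2 * (P * Pi + (1 - z) / 2)) := by linarith
      _ = _ := by rw [e2]; ring
  exact le_of_mul_le_mul_right h5 hPi

end IsArc

end

section

theorem sq_eq_of_mc_eq_zero {N q : ℝ} (hq : q ≠ 0) (h : mc N q = 0) : q ^ 2 = 2 * N := by
  unfold mc at h
  field_simp at h
  linarith

namespace IsArc

variable {N a b : ℝ} {x q : ℝ → ℝ}

theorem exists_mc_eq_zero (h : IsArc N a b x q) {θ : ℝ} (hθ : θ ∈ Ioo 0 b)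
    (hm : mc N (q θ) < 0) : ∃ θ₀ ∈ Ioo 0 θ, mc N (q θ₀) = 0 := by
  have hc := h.continuousOn_mc.mono (Icc_subset_Icc_right hθ.2.le)
  have := intermediate_value_Ioo' hθ.1.le hc
  have h0 : (0:ℝ) ∈ Ioo (mc N (q θ)) (mc N (q 0)) := ⟨hm, by rw [h.q_zero]; exact h.mc_a_pos⟩
  obtain ⟨t, ht, ht'⟩ := this h0
  exact ⟨t, ht, ht'⟩

/-- The estimates available where `mc` vanishes. -/
theorem crossing_bounds (h : IsArc N a (π / 2) x q) (hx : x (π / 2) ^ 2 ≤ 2) {θ : ℝ}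
    (hθ : θ ∈ Ioo 0 (π / 2)) (hm : mc N (q θ) = 0) :
    (1 - zf N θ (x θ) (q θ)) ^ 2 ≤ 2 * pf N θ (x θ) (q θ) ^ 2 * zf N θ (x θ) (q θ) ∧
      3 * zf N θ (x θ) (q θ) ≤
        2 * pf N θ (x θ) (q θ) ^ 2 + 2 * pf N θ (x θ) (q θ) * (1 / q θ) := by
  have e : pif θ (x θ) = pf N θ (x θ) (q θ) := by unfold pf; rw [hm]; ring
  have h1 := h.sq_bound hx hθ
  have h2 := h.gf_nonneg θ hθ
  unfold gf at h2
  rw [e] at h1 h2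
  constructor <;> nlinarith

end IsArc

/-- The condition under which the Sturm comparison function is monotone. -/
def Cond (N κ P z q : ℝ) : Prop :=
  0 < ((κ - q) * (1 / 2 + N / q ^ 2) - mc N q) * (P ^ 2 + mc N q * (P + 1 / q) + z / 2)
    + 4 * P ^ 3 - 2 * (κ - q) * N * P / q ^ 3

/-! ### Upper arcs -/

theorem upper_poly {N U U₀ v : ℝ} (hN : 1 ≤ N) (hU₀ : 1 < U₀) (hU0N : N ≤ U₀ ^ 2) (hv : 0 ≤ v)
    (hvN : v ≤ N) (hU : U₀ + (U₀ - 1) * (U₀ * v + v ^ 2 / 2) / (3 * N) ≤ U) :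
    0 < N * (U ^ 2 - v * (U - 1)) + 2 * U ^ 3 + N * U := by
  obtain ⟨u, hu0, huN⟩ : ∃ u : ℝ, 1 ≤ u ∧ u ^ 2 = N :=
    ⟨√N, one_le_sqrt.2 hN, sq_sqrt (by linarith)⟩
  have huU : u ≤ U₀ := by
    apply le_of_sq_le_sq _ (by linarith)
    rw [huN]; exact hU0N
  have hU' : u + (u - 1) * (u * v + v ^ 2 / 2) / (3 * N) ≤ U := by
    refine le_trans ?_ hU
    have : (u - 1) * (u * v + v ^ 2 / 2) ≤ (U₀ - 1) * (U₀ * v + v ^ 2 / 2) := by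
      have : 0 ≤ v ^ 2 / 2 := by positivity
      gcongr
    gcongr
  have key : v < U + 3 := by
    rcases le_total v 3 with h3 | h3
    · have : 0 ≤ (u - 1) * (u * v + v ^ 2 / 2) / (3 * N) := by
        have : 0 ≤ u - 1 := by linarith
        positivity
      linarith
    · have : v < u + (u - 1) * (u * v + v ^ 2 / 2) / (3 * N) + 3 := by
        rw [← huN, ← sub_pos]
        have e : u + (u - 1) * (u * v + v ^ 2 / 2) / (3 * u ^ 2) + 3 - v =
            (6 * u ^ 2 * (u + 3) + 2 * (u - 1) * u * v + (u - 1) * v ^ 2 - 6 * u ^ 2 * v) /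
              (6 * u ^ 2) := by
          field_simp; ring
        rw [e]
        apply div_pos _ (by positivity)
        rcases lt_or_ge u 2 with h2 | h2
        · have h1 : v < u + 3 := by nlinarith
          have h5 : 0 < u ^ 2 * (u + 3 - v) := by
            have : 0 < u + 3 - v := by linarith
            positivity
          have h6 : 0 ≤ (u - 1) * (2 * u * v + v ^ 2) := by
            have : 0 ≤ u - 1 := by linarith
            positivity
          nlinarith
        · have hd : 0 < (u - 1) * (6 * u ^ 2 * (u + 3) + 2 * (u - 1) * u * v + (u - 1) * v ^ 2
              - 6 * u ^ 2 * v) := by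
            have : 0 < u ^ 2 * (6 * (u - 1) * (u + 3) - (2 * u + 1) ^ 2) := by
              have : 0 < 6 * (u - 1) * (u + 3) - (2 * u + 1) ^ 2 := by nlinarith
              positivity
            nlinarith [sq_nonneg ((u - 1) * v - u * (2 * u + 1))]
          exact pos_of_mul_pos_right hd (by linarith)
      linarith
  have hUU : U₀ ≤ U := by
    have : 0 ≤ (U₀ - 1) * (U₀ * v + v ^ 2 / 2) / (3 * N) := by
      have : 0 ≤ U₀ - 1 := by linarith
      positivity
    linarith
  have hU2 : N ≤ U ^ 2 := hU0N.trans (by gcongr)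
  have h3 : 2 * U * N ≤ 2 * U * U ^ 2 := by gcongr; linarith
  have h4 : 0 < N * U * (U + 3 - v) := by
    have : 0 < U := by linarith
    have : 0 < U + 3 - v := by linarith
    positivity
  have h5 : 0 ≤ N * v := by positivity
  nlinarith

namespace IsArc

variable {N a b : ℝ} {x q : ℝ → ℝ}

theorem crossing_upper (h : IsArc N a (π / 2) x q) (hx : x (π / 2) ^ 2 ≤ 2) (ha : a < 0) {θ : ℝ}
    (hθ : θ ∈ Ioo 0 (π / 2)) (hm : mc N (q θ) = 0) :
    N ≤ (-q θ * pf N θ (x θ) (q θ)) ^ 2 := by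
  obtain ⟨h1, h2⟩ := h.crossing_bounds hx hθ hm
  have hq2 := sq_eq_of_mc_eq_zero (h.q_ne (Ioo_subset_Icc_self hθ)) hm
  have hP := h.pf_pos ⟨hθ.1.le, hθ.2⟩
  have hq : q θ < 0 := by nlinarith [h.same_sign θ (Ioo_subset_Icc_self hθ)]
  have hi : 1 / q θ < 0 := one_div_neg.2 hq
  have hN := h.N_pos
  by_contra! hcon
  have hP2 : pf N θ (x θ) (q θ) ^ 2 < 1 / 2 := by
    have : (-q θ * pf N θ (x θ) (q θ)) ^ 2 = 2 * N * pf N θ (x θ) (q θ) ^ 2 := by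
      rw [mul_pow, neg_sq, hq2]
    nlinarith
  have hz := h.zf_nonneg θ hθ
  have := mul_neg_of_pos_of_neg hP hi
  nlinarith

theorem upper_lower_bound (h : IsArc N a (π / 2) x q) (ha : a < 0) {θ₀ θ : ℝ}
    (hθ₀ : θ₀ ∈ Ioo 0 θ) (hθ : θ ∈ Ioo 0 (π / 2)) (hm : mc N (q θ₀) = 0) :
    let U := fun t => -q t * pf N t (x t) (q t)
    let v := fun t => N - q t ^ 2 / 2
    U θ₀ + (U θ₀ - 1) * (U θ₀ * v θ + v θ ^ 2 / 2) / (3 * N) ≤ U θ := by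
  intro U v
  have hq2 := sq_eq_of_mc_eq_zero (h.q_ne ⟨hθ₀.1.le, (hθ₀.2.trans hθ.2).le⟩) hm
  have hv0 : v θ₀ = 0 := by simp only [v]; linarith
  have hN := h.N_pos
  have hsub : Icc θ₀ θ ⊆ Ioo 0 (π / 2) := fun t ht => ⟨hθ₀.1.trans_le ht.1, ht.2.trans_lt hθ.2⟩
  have hUd : ∀ t ∈ Ioo 0 (π / 2), HasDerivAt U _ t := fun t ht => by
    have := (h.hasDerivAt_mul_pf ht).neg
    refine HasDerivAt.congr_of_eventuallyEq this (Eventually.of_forall fun s => ?_)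
    simp [U]
  have hvd : ∀ t ∈ Ioo 0 (π / 2), HasDerivAt v _ t := fun t ht =>
    (((h.hasDerivAt_q t (Ioo_subset_Icc_self ht)).pow 2).div_const 2).const_sub N
  have hfd : ∀ t ∈ Ioo 0 (π / 2), HasDerivAt
      (fun t => U t - (U θ₀ - 1) * (U θ₀ * v t + v t ^ 2 / 2) / (3 * N)) _ t := fun t ht =>
    (hUd t ht).sub (((((hvd t ht).const_mul (U θ₀)).add
      (((hvd t ht).pow 2).div_const 2)).const_mul (U θ₀ - 1)).div_const (3 * N))
  have hqneg : ∀ t ∈ Ioo 0 (π / 2), q t < 0 := fun t ht => by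
    nlinarith [h.same_sign t (Ioo_subset_Icc_self ht)]
  have hUmono : ∀ t ∈ Icc θ₀ θ, U θ₀ ≤ U t := fun t ht => by
    have := h.monotoneOn_mul_pf ⟨(hsub ⟨le_rfl, hθ₀.2.le⟩).1.le, (hsub ⟨le_rfl, hθ₀.2.le⟩).2⟩
      ⟨(hsub ht).1.le, (hsub ht).2⟩ ht.1
    simp only at this
    simp only [U]
    nlinarith
  have hU1 : ∀ t ∈ Ioo 0 (π / 2), 1 < U t := fun t ht => by
    have h1 := h.psi_pos' t ⟨ht.1.le, ht.2⟩
    have h2 := hqneg t ht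
    have h3 : (pf N t (x t) (q t) + 1 / q t) * q t = pf N t (x t) (q t) * q t + 1 := by
      field_simp [h2.ne]
    simp only [U]
    nlinarith
  have hmono : MonotoneOn
      (fun t => U t - (U θ₀ - 1) * (U θ₀ * v t + v t ^ 2 / 2) / (3 * N)) (Icc θ₀ θ) := by
    refine monotoneOn_of_deriv_nonneg (convex_Icc _ _)
      (fun t ht => (hfd t (hsub ht)).continuousAt.continuousWithinAt) ?_ ?_
    · intro t ht
      exact (hfd t (hsub (interior_subset ht))).differentiableAt.differentiableWithinAt
    · intro t ht
      have ht1 := interior_subset ht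
      have ht' := hsub ht1
      rw [(hfd t ht').deriv]
      have hk := h.curv_pos t (Ioo_subset_Icc_self ht')
      have hs := h.sin_pos' ⟨ht'.1, ht'.2.le⟩
      have hr : 0 < sin t / curv N t (x t) (q t) := div_pos hs hk
      have hg := h.growth ht'
      have hqt := hqneg t ht'
      have hvt : 0 ≤ v t := by
        have hqq : q θ₀ ≤ q t := h.strictMonoOn_q.monotoneOn
          (Ioo_subset_Icc_self (hsub ⟨le_rfl, hθ₀.2.le⟩)) (Ioo_subset_Icc_self ht') ht1.1
        have : q t ^ 2 ≤ q θ₀ ^ 2 := by nlinarith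
        simp only [v]; linarith
      have hU0 := hUmono t ht1
      have hU1' := hU1 t ht'
      have hU10 := hU1 θ₀ (hsub ⟨le_rfl, hθ₀.2.le⟩)
      set ρ := - q t with hρ
      have hρ0 : 0 < ρ := by rw [hρ]; linarith
      have eq : q t = -ρ := by rw [hρ]; ring
      have eP : pf N t (x t) (q t) + 1 / q t = (U t - 1) / ρ := by
        simp only [U]; rw [← hρ, eq]; field_simp; ring
      have ePi : pif t (x t) = (U t + v t) / ρ := by
        have : pif t (x t) = pf N t (x t) (q t) - mc N (q t) := by unfold pf; ring
        rw [this]; simp only [U, v, mc]; rw [← hρ, eq]; field_simp; ring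
      rw [eP, ePi] at hg
      rw [eP, ePi]
      set r := sin t / curv N t (x t) (q t) with hrdef
      set B := (U t + v t) / ρ * ((U t - 1) / ρ) - zf N t (x t) (q t) / 2
      rw [eq]
      have hρN : ρ ^ 2 ≤ 2 * N := by
        simp only [v] at hvt
        rw [hρ]; nlinarith
      have h1 : (U θ₀ - 1) * (U θ₀ + v t) * ρ ^ 2 ≤ 2 * N * ((U t - 1) * (U t + v t)) := by
        have : (U θ₀ - 1) * (U θ₀ + v t) ≤ (U t - 1) * (U t + v t) := by
          gcongr
        have h0 : 0 ≤ (U θ₀ - 1) * (U θ₀ + v t) :=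
          mul_nonneg (by linarith) (by linarith)
        calc _ ≤ (U θ₀ - 1) * (U θ₀ + v t) * (2 * N) := by gcongr
          _ ≤ _ := by nlinarith
      have h2 : (U θ₀ - 1) * (U θ₀ + v t) * ρ / (3 * N) ≤ ρ * B := by
        have : ρ * (2 / 3 * ((U t + v t) / ρ * ((U t - 1) / ρ))) ≤ ρ * B := by gcongr
        refine le_trans ?_ this
        have e : ρ * (2 / 3 * ((U t + v t) / ρ * ((U t - 1) / ρ))) =
          2 * N * ((U t - 1) * (U t + v t)) / (3 * N * ρ) := by field_simp
        rw [e, div_le_div_iff₀ (by positivity) (by positivity)]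
        nlinarith
      have h3 := mul_le_mul_of_nonneg_left h2 hr.le
      have e2 : r * ((U θ₀ - 1) * (U θ₀ + v t) * ρ / (3 * N)) =
        (U θ₀ - 1) * (U θ₀ * (ρ * r) + v t * (ρ * r)) / (3 * N) := by ring
      rw [e2] at h3
      push_cast
      ring_nf at h3 ⊢
      linarith
  have := hmono ⟨le_rfl, hθ₀.2.le⟩ ⟨hθ₀.2.le, le_rfl⟩ hθ₀.2.le
  simp only [hv0] at this
  ring_nf at this ⊢
  linarith

theorem cond_upper (h : IsArc N a (π / 2) x q) (hx : x (π / 2) ^ 2 ≤ 2) (ha : a < 0) {θ : ℝ}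
    (hθ : θ ∈ Ioo 0 (π / 2)) : Cond N 0 (pf N θ (x θ) (q θ)) (zf N θ (x θ) (q θ)) (q θ) := by
  have hq : q θ < 0 := by nlinarith [h.same_sign θ (Ioo_subset_Icc_self hθ)]
  have hψ := h.psi_pos' θ ⟨hθ.1.le, hθ.2⟩
  have hz := h.zf_nonneg θ hθ
  have hN := h.N_pos
  have main : 0 < N * ((-q θ * pf N θ (x θ) (q θ)) ^ 2 -
      (N - q θ ^ 2 / 2) * (-q θ * pf N θ (x θ) (q θ) - 1)) +
      2 * (-q θ * pf N θ (x θ) (q θ)) ^ 3 + N * (-q θ * pf N θ (x θ) (q θ)) := by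
    have hU1 : 1 < -q θ * pf N θ (x θ) (q θ) := by
      have h3 : (pf N θ (x θ) (q θ) + 1 / q θ) * q θ = pf N θ (x θ) (q θ) * q θ + 1 := by
        field_simp [hq.ne]
      nlinarith
    rcases le_or_gt (N - q θ ^ 2 / 2) 0 with hv | hv
    · set U := -q θ * pf N θ (x θ) (q θ)
      have : 0 ≤ -(N - q θ ^ 2 / 2) * (U - 1) := mul_nonneg (by linarith) (by linarith)
      have : 0 < U := by linarith
      have : 0 < N * (U ^ 2 + -(N - q θ ^ 2 / 2) * (U - 1)) := by positivity
      have : 0 < 2 * U ^ 3 + N * U := by positivity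
      nlinarith
    · have hm : mc N (q θ) < 0 := by
        have : mc N (q θ) = (N - q θ ^ 2 / 2) / q θ := by unfold mc; field_simp [hq.ne]
        rw [this]; exact div_neg_of_pos_of_neg hv hq
      obtain ⟨θ₀, hθ₀, hm0⟩ := h.exists_mc_eq_zero hθ hm
      have hθ₀' : θ₀ ∈ Ioo 0 (π / 2) := ⟨hθ₀.1, hθ₀.2.trans hθ.2⟩
      have hb := h.upper_lower_bound ha hθ₀ hθ hm0
      have hc := h.crossing_upper hx ha hθ₀' hm0
      have hq0 : q θ₀ < 0 := by nlinarith [h.same_sign θ₀ (Ioo_subset_Icc_self hθ₀')]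
      have hU10 : 1 < -q θ₀ * pf N θ₀ (x θ₀) (q θ₀) := by
        have hψ := h.psi_pos' θ₀ ⟨hθ₀'.1.le, hθ₀'.2⟩
        have h3 : (pf N θ₀ (x θ₀) (q θ₀) + 1 / q θ₀) * q θ₀ =
            pf N θ₀ (x θ₀) (q θ₀) * q θ₀ + 1 := by
          field_simp [hq0.ne]
        nlinarith
      exact upper_poly hN hU10 hc hv.le (by nlinarith [sq_nonneg (q θ)]) hb
  unfold Cond mc
  generalize pf N θ (x θ) (q θ) = P at *
  generalize zf N θ (x θ) (q θ) = z at *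
  obtain ⟨ρ, hρ⟩ : ∃ ρ, ρ = -q θ := ⟨_, rfl⟩
  have hρ0 : 0 < ρ := by linarith
  have e : q θ = -ρ := by linarith
  rw [e] at main ⊢
  have e2 : ((0 - -ρ) * (1 / 2 + N / (-ρ) ^ 2) - (N / -ρ - -ρ / 2)) *
      (P ^ 2 + (N / -ρ - -ρ / 2) * (P + 1 / -ρ) + z / 2) + 4 * P ^ 3
      - 2 * (0 - -ρ) * N * P / (-ρ) ^ 3 =
      2 * (N * ((- -ρ * P) ^ 2 - (N - (-ρ) ^ 2 / 2) * (- -ρ * P - 1)) +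
      2 * (- -ρ * P) ^ 3 + N * (- -ρ * P) + N * (ρ ^ 2 / 2) * z) / ρ ^ 3 := by
    field_simp
    ring
  rw [e2]
  have : 0 ≤ N * (ρ ^ 2 / 2) * z := by positivity
  apply div_pos _ (by positivity)
  linarith

end IsArc

end

section

/-! ### Lower arcs before the crossing -/

theorem lower_start_aux {n h R z : ℝ} (hn : 0 ≤ n) (hh : 0 ≤ h) (hN : 1 ≤ n + h) (hR : 0 < R)
    (hnR : n < R) (hz : 0 ≤ z) (hz1 : z < 1)
    (hC : (1 - z) * (R * (R - n) + h * (1 - z)) ≤ R ^ 2) :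
    n * R ≤ 89 / 100 * (R ^ 2 - R + n * R + n + h * z) := by
  have hhz : 0 ≤ h * z := by positivity
  rcases le_or_gt 1 R with h1 | h1
  · rcases le_or_gt R 8 with h8 | h8
    · nlinarith [mul_nonneg hn (by linarith : 0 ≤ 8 - R)]
    · nlinarith [mul_nonneg (by linarith : 0 ≤ R - n) hR.le]
  · suffices 0 ≤ R ^ 2 - R + 876 / 1000 * n + h * z by nlinarith
    by_contra! hc
    have c1 : h * z < 1 / 4 - 876 / 1000 * n := by nlinarith [sq_nonneg (R - 1 / 2)]
    have hn1 : n < 286 / 1000 := by nlinarith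
    have c2 : (1 - n) * z < 1 / 4 - 876 / 1000 * n := by nlinarith
    have c3 : h * (1 - z) ^ 2 ≤ z + (1 - z) * n := by
      have : z * R ^ 2 + (1 - z) * R * n ≤ z + (1 - z) * n := by
        have i1 : z * R ^ 2 ≤ z * 1 := by gcongr; nlinarith
        have i2 : (1 - z) * R * n ≤ (1 - z) * 1 * n := by
          have : 0 ≤ 1 - z := by linarith
          gcongr
        linarith
      nlinarith
    have c4 : (1 - n) * (1 - z) ^ 2 ≤ z + (1 - z) * n := by
      have : (1 - n) * (1 - z) ^ 2 ≤ h * (1 - z) ^ 2 := by gcongr; linarith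
      linarith
    have hz4 : z < 1 / 4 := by nlinarith
    have hn2 : 238 / 1000 ≤ n := by
      by_contra! hlt
      nlinarith
    have hz5 : z < 59 / 1000 := by nlinarith
    nlinarith

theorem lower_start_poly {N r₀ q P z : ℝ} (hN : 1 ≤ N) (hr0 : 0 < r₀) (hr : r₀ ^ 2 = 2 * N)
    (hq : 0 < q) (hm : 0 ≤ mc N q) (hP : 0 < P) (hPm : mc N q < P) (hz : 0 ≤ z) (hz1 : z < 1)
    (hC : (1 - z) * (P * (P - mc N q) + (1 - z) / 2) ≤ P ^ 2) : Cond N (r₀ + 3) P z q := by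
  unfold Cond
  obtain ⟨R, hR⟩ : ∃ R, R = q * P := ⟨_, rfl⟩
  obtain ⟨n, hn⟩ : ∃ n, n = q * mc N q := ⟨_, rfl⟩
  have eP : P = R / q := by rw [hR]; field_simp
  have em : mc N q = n / q := by rw [hn]; field_simp
  have hnN : n + q ^ 2 / 2 = N := by rw [hn]; unfold mc; field_simp; ring
  have hR0 : 0 < R := by rw [hR]; positivity
  have hn0 : 0 ≤ n := by rw [hn]; positivity
  have hnR : n < R := by rw [hn, hR]; gcongr
  rw [eP, em] at hC ⊢
  have hC' : (1 - z) * (R * (R - n) + q ^ 2 / 2 * (1 - z)) ≤ R ^ 2 := by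
    have := mul_le_mul_of_nonneg_left hC (by positivity : 0 ≤ q ^ 2)
    field_simp at this
    linarith
  have key := lower_start_aux hn0 (by positivity : 0 ≤ q ^ 2 / 2) (by linarith) hR0 hnR hz hz1 hC'
  have hr2 : 14142 / 10000 ≤ r₀ := by nlinarith
  set A := (3 + r₀) * (q ^ 2 + r₀ ^ 2) / 2 - r₀ ^ 2 * q with hA
  have hA0 : 89 / 100 * (3 + r₀) ≤ A := by
    have : 0 ≤ (3 + r₀) * (A - 89 / 100 * (3 + r₀)) := by
      have i1 : 0 ≤ 6 * r₀ ^ 3 + 722 / 100 * r₀ ^ 2 - 1068 / 100 * r₀ - 1602 / 100 := by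
        have e : 6 * r₀ ^ 3 + 722 / 100 * r₀ ^ 2 - 1068 / 100 * r₀ - 1602 / 100 =
          6 * r₀ ^ 2 * (r₀ - 14142 / 10000) + (722 / 100 + 6 * (14142 / 10000)) * r₀ ^ 2
            - 1068 / 100 * r₀ - 1602 / 100 := by ring
        rw [e]
        have : 0 ≤ 6 * r₀ ^ 2 * (r₀ - 14142 / 10000) :=
          mul_nonneg (by positivity) (by linarith)
        nlinarith
      rw [hA]
      nlinarith [sq_nonneg ((3 + r₀) * q - r₀ ^ 2)]
    have := nonneg_of_mul_nonneg_right this (by linarith : 0 < 3 + r₀)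
    linarith
  have hX : (3 + r₀) * (n * R) ≤ A * (R ^ 2 - R + n * R + n + q ^ 2 / 2 * z) := by
    have h0 : 0 ≤ n * R := by positivity
    have : 0 ≤ R ^ 2 - R + n * R + n + q ^ 2 / 2 * z := by linarith
    calc (3 + r₀) * (n * R) ≤
        (3 + r₀) * (89 / 100 * (R ^ 2 - R + n * R + n + q ^ 2 / 2 * z)) := by gcongr
      _ = 89 / 100 * (3 + r₀) * (R ^ 2 - R + n * R + n + q ^ 2 / 2 * z) := by ring
      _ ≤ _ := by gcongr
  have hNr : N = r₀ ^ 2 / 2 := by linarith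
  have hnr : n = (r₀ ^ 2 - q ^ 2) / 2 := by linarith
  have e : (((r₀ + 3 - q) * (1 / 2 + N / q ^ 2) - n / q) *
      ((R / q) ^ 2 + n / q * (R / q + 1 / q) + z / 2) + 4 * (R / q) ^ 3
      - 2 * (r₀ + 3 - q) * N * (R / q) / q ^ 3) =
      (A * (R ^ 2 - R + n * R + n + q ^ 2 / 2 * z) - (3 + r₀) * (n * R) + 4 * q * R ^ 3) /
        q ^ 4 := by
    rw [hA, hNr, hnr]
    field_simp
    ring
  rw [e]
  have : 0 < 4 * q * R ^ 3 := by positivity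
  apply div_pos _ (by positivity)
  linarith

namespace IsArc

variable {N a b : ℝ} {x q : ℝ → ℝ}

theorem q_pos (h : IsArc N a b x q) (ha : 0 < a) {θ : ℝ} (hθ : θ ∈ Icc 0 b) : 0 < q θ :=
  pos_of_mul_pos_right (h.same_sign θ hθ) ha.le

theorem cond_lower_of_mc_nonneg (h : IsArc N a (π / 2) x q) (hx : x (π / 2) ^ 2 ≤ 2) (ha : 0 < a)
    {θ : ℝ} (hθ : θ ∈ Ioo 0 (π / 2)) (hm : 0 ≤ mc N (q θ)) :
    Cond N (√(2 * N) + 3) (pf N θ (x θ) (q θ)) (zf N θ (x θ) (q θ)) (q θ) := by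
  have hN := h.N_pos
  have hPi := h.pif_pos hθ
  have e : pif θ (x θ) = pf N θ (x θ) (q θ) - mc N (q θ) := by unfold pf; ring
  have hC := h.sq_bound hx hθ
  rw [e] at hC hPi
  exact lower_start_poly hN (sqrt_pos.2 (by linarith)) (sq_sqrt (by linarith))
    (h.q_pos ha (Ioo_subset_Icc_self hθ)) hm (h.pf_pos ⟨hθ.1.le, hθ.2⟩) (by linarith)
    (h.zf_nonneg θ hθ) (h.zf_lt_one hθ) hC

end IsArc

end

section

/-! ### Lower arcs beyond the crossing -/

/-- A lower barrier for the quotient of the curvature by `cos θ` on lower arcs. -/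
noncomputable def bar (t : ℝ) : ℝ := 11 / 20 + t / 20 + 23 / 50 * t ^ 2

theorem bar_slope {t i : ℝ} (ht : 0 ≤ t) (ht' : t ≤ 121 / 50) (hi : 0 ≤ i)
    (hi' : i * (707 / 500 + t) ≤ 1) :
    1 / 20 + 23 / 25 * t ≤ 2 / 3 * (bar t + (t - t ^ 2 * i / 2)) * (bar t + i) - bar t * i := by
  set b := bar t with hb
  set c := 707 / 500 + t with hc
  have hc0 : 0 < c := by rw [hc]; linarith
  set A := 2 / 3 * b ^ 2 + 2 / 3 * t * b - (1 / 20 + 23 / 25 * t) with hA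
  set B := 2 / 3 * t - b / 3 - t ^ 2 * b / 3 with hB
  have hs : 0 ≤ 121 / 50 - t := by linarith
  have hA0 : 0 ≤ A := by
    rw [hA, hb]; unfold bar
    have p1 := pow_nonneg ht 4
    have p2 := mul_nonneg (pow_nonneg ht 3) hs
    have p3 := mul_nonneg (pow_nonneg ht 2) (pow_nonneg hs 2)
    have p4 := mul_nonneg ht (pow_nonneg hs 3)
    have p5 := pow_nonneg hs 4
    nlinarith [sq_nonneg (t - 1), mul_nonneg ht (sq_nonneg (t - 1)), sq_nonneg (t ^ 2 - 1)]
  have hM : 0 ≤ c ^ 2 * A + c * B - t ^ 2 / 3 := by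
    rw [hA, hB, hb, hc]; unfold bar
    rcases le_total t (3 / 5) with h1 | h1
    · have hs : 0 ≤ 3 / 5 - t := by linarith
      have p0 := pow_nonneg ht 6
      have p1 := mul_nonneg (pow_nonneg ht 5) (pow_nonneg hs 1)
      have p2 := mul_nonneg (pow_nonneg ht 4) (pow_nonneg hs 2)
      have p3 := mul_nonneg (pow_nonneg ht 3) (pow_nonneg hs 3)
      have p4 := mul_nonneg (pow_nonneg ht 2) (pow_nonneg hs 4)
      have p5 := mul_nonneg (pow_nonneg ht 1) (pow_nonneg hs 5)
      have p6 := pow_nonneg hs 6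
      nlinarith only [p0, p1, p2, p3, p4, p5, p6]
    · rcases le_total t (6 / 5) with h2 | h2
      · have ht : 0 ≤ t - 3 / 5 := by linarith
        have hs : 0 ≤ 6 / 5 - t := by linarith
        have p0 := pow_nonneg ht 6
        have p1 := mul_nonneg (pow_nonneg ht 5) (pow_nonneg hs 1)
        have p2 := mul_nonneg (pow_nonneg ht 4) (pow_nonneg hs 2)
        have p3 := mul_nonneg (pow_nonneg ht 3) (pow_nonneg hs 3)
        have p4 := mul_nonneg (pow_nonneg ht 2) (pow_nonneg hs 4)
        have p5 := mul_nonneg (pow_nonneg ht 1) (pow_nonneg hs 5)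
        have p6 := pow_nonneg hs 6
        nlinarith only [p0, p1, p2, p3, p4, p5, p6]
      · have ht : 0 ≤ t - 6 / 5 := by linarith
        have hs : 0 ≤ 121 / 50 - t := by linarith
        have p0 := pow_nonneg ht 6
        have p1 := mul_nonneg (pow_nonneg ht 5) (pow_nonneg hs 1)
        have p2 := mul_nonneg (pow_nonneg ht 4) (pow_nonneg hs 2)
        have p3 := mul_nonneg (pow_nonneg ht 3) (pow_nonneg hs 3)
        have p4 := mul_nonneg (pow_nonneg ht 2) (pow_nonneg hs 4)
        have p5 := mul_nonneg (pow_nonneg ht 1) (pow_nonneg hs 5)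
        have p6 := pow_nonneg hs 6
        nlinarith only [p0, p1, p2, p3, p4, p5, p6]
  set w := 1 - i * c with hw
  have hw0 : 0 ≤ w := by rw [hw]; linarith
  have hw1 : 0 ≤ 1 - w := by rw [hw]; nlinarith
  have key : 0 ≤ c ^ 2 * (A + i * B - t ^ 2 * i ^ 2 / 3) := by
    have e : c ^ 2 * (A + i * B - t ^ 2 * i ^ 2 / 3) =
        w * (c ^ 2 * A) + (1 - w) * (c ^ 2 * A + c * B - t ^ 2 / 3) +
          t ^ 2 / 3 * (w * (1 - w)) := by
      rw [hw]; ring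
    rw [e]
    positivity
  have := nonneg_of_mul_nonneg_right key (by positivity)
  rw [hA, hB] at this
  linarith

theorem bar_cond {t i : ℝ} (ht : 0 ≤ t) (ht' : t ≤ 121 / 50) (hi : 0 ≤ i)
    (hi' : i * (707 / 500 + t) ≤ 1) :
    0 < bar t * (3 * bar t + 4 * bar t ^ 2 - 3 * t + i * (3 / 2 * t ^ 2 - 3 + t)) - 3 * t * i := by
  set b := bar t with hb
  set c := 707 / 500 + t with hc
  have hc0 : 0 < c := by rw [hc]; linarith
  set A := b * (3 * b + 4 * b ^ 2 - 3 * t) with hA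
  set B := b * (3 / 2 * t ^ 2 - 3 + t) - 3 * t with hB
  have hA0 : 0 < 3 * b + 4 * b ^ 2 - 3 * t := by
    rw [hb]; unfold bar
    nlinarith [sq_nonneg (t - 1), mul_nonneg ht (sq_nonneg (t - 1)), sq_nonneg (t ^ 2 - 1),
      pow_nonneg ht 3]
  have hb0 : 0 < b := by rw [hb]; unfold bar; positivity
  have hA0' : 0 < A := mul_pos hb0 hA0
  have hM : 0 < c * A + B := by
    rw [hA, hB, hb, hc]; unfold bar
    rcases le_total t (3 / 5) with h1 | h1
    · have hs : 0 ≤ 3 / 5 - t := by linarith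
      have p0 := pow_nonneg ht 7
      have p1 := mul_nonneg (pow_nonneg ht 6) (pow_nonneg hs 1)
      have p2 := mul_nonneg (pow_nonneg ht 5) (pow_nonneg hs 2)
      have p3 := mul_nonneg (pow_nonneg ht 4) (pow_nonneg hs 3)
      have p4 := mul_nonneg (pow_nonneg ht 3) (pow_nonneg hs 4)
      have p5 := mul_nonneg (pow_nonneg ht 2) (pow_nonneg hs 5)
      have p6 := mul_nonneg (pow_nonneg ht 1) (pow_nonneg hs 6)
      have p7 := pow_nonneg hs 7
      nlinarith only [p0, p1, p2, p3, p4, p5, p6, p7]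
    · rcases le_total t (6 / 5) with h2 | h2
      · have ht : 0 ≤ t - 3 / 5 := by linarith
        have hs : 0 ≤ 6 / 5 - t := by linarith
        have p0 := pow_nonneg ht 7
        have p1 := mul_nonneg (pow_nonneg ht 6) (pow_nonneg hs 1)
        have p2 := mul_nonneg (pow_nonneg ht 5) (pow_nonneg hs 2)
        have p3 := mul_nonneg (pow_nonneg ht 4) (pow_nonneg hs 3)
        have p4 := mul_nonneg (pow_nonneg ht 3) (pow_nonneg hs 4)
        have p5 := mul_nonneg (pow_nonneg ht 2) (pow_nonneg hs 5)
        have p6 := mul_nonneg (pow_nonneg ht 1) (pow_nonneg hs 6)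
        have p7 := pow_nonneg hs 7
        nlinarith only [p0, p1, p2, p3, p4, p5, p6, p7]
      · have ht : 0 ≤ t - 6 / 5 := by linarith
        have hs : 0 ≤ 121 / 50 - t := by linarith
        have p0 := pow_nonneg ht 7
        have p1 := mul_nonneg (pow_nonneg ht 6) (pow_nonneg hs 1)
        have p2 := mul_nonneg (pow_nonneg ht 5) (pow_nonneg hs 2)
        have p3 := mul_nonneg (pow_nonneg ht 4) (pow_nonneg hs 3)
        have p4 := mul_nonneg (pow_nonneg ht 3) (pow_nonneg hs 4)
        have p5 := mul_nonneg (pow_nonneg ht 2) (pow_nonneg hs 5)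
        have p6 := mul_nonneg (pow_nonneg ht 1) (pow_nonneg hs 6)
        have p7 := pow_nonneg hs 7
        nlinarith only [p0, p1, p2, p3, p4, p5, p6, p7]
  have e : c * (A + i * B) = (1 - i * c) * (c * A) + i * c * (c * A + B) := by ring
  have h1 : 0 ≤ i * c := by positivity
  have key : 0 < c * (A + i * B) := by
    rw [e]
    rcases h1.eq_or_lt with h0 | h0
    · rw [← h0]; simp; positivity
    · have : 0 ≤ 1 - i * c := by linarith
      positivity
  have := pos_of_mul_pos_right key hc0.le
  rw [hA, hB] at this
  linarith

/-- The barrier inequality extends upwards. -/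
theorem cond_of_bar_le {t i P : ℝ} (ht : 0 ≤ t) (ht' : t ≤ 121 / 50) (hi : 0 ≤ i)
    (hi' : i * (707 / 500 + t) ≤ 1) (hP : bar t ≤ P) :
    0 < 3 * (P ^ 2 - (t - t ^ 2 * i / 2) * (P + i)) + 4 * P ^ 3
      - (3 - t) * i * (1 - t * i) * P := by
  have h := bar_cond ht ht' hi hi'
  have hb0 : 0 < bar t := by unfold bar; positivity
  have hti : 0 ≤ t * i := by positivity
  have hP0 : 0 ≤ P := hb0.le.trans hP
  have h1 : 0 < 3 * bar t + 4 * bar t ^ 2 - 3 * t + i * (3 / 2 * t ^ 2 - 3 + t) := by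
    by_contra! hc
    have := mul_nonpos_of_nonneg_of_nonpos hb0.le hc
    linarith
  have h2 : bar t * (3 * bar t + 4 * bar t ^ 2 - 3 * t + i * (3 / 2 * t ^ 2 - 3 + t)) ≤
      P * (3 * P + 4 * P ^ 2 - 3 * t + i * (3 / 2 * t ^ 2 - 3 + t)) := by
    gcongr
  have h3 : 0 ≤ 3 / 2 * t ^ 2 * i ^ 2 + (3 - t) * t * i ^ 2 * P := by
    have : 0 ≤ 3 - t := by linarith
    positivity
  nlinarith only [h, h2, h3]

end

section

namespace IsArc

variable {N a b : ℝ} {x q : ℝ → ℝ}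

theorem pf_deriv_lower_bound (h : IsArc N a b x q) {θ : ℝ} (hθ : θ ∈ Ioo 0 b) :
    2 / 3 * ((pf N θ (x θ) (q θ) - mc N (q θ)) * (pf N θ (x θ) (q θ) + 1 / q θ))
        - pf N θ (x θ) (q θ) * (1 / q θ) ≤
      pf N θ (x θ) (q θ) * pif θ (x θ) + (1 - zf N θ (x θ) (q θ)) / 2 - N / q θ ^ 2 := by
  have hq := h.q_ne (Ioo_subset_Icc_self hθ)
  have hg := h.growth hθ
  have e : pif θ (x θ) = pf N θ (x θ) (q θ) - mc N (q θ) := by unfold pf; ring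
  have e2 : N / q θ ^ 2 = mc N (q θ) * (1 / q θ) + 1 / 2 := by
    unfold mc; field_simp; ring
  rw [e] at hg ⊢
  rw [e2]
  nlinarith only [hg]

end IsArc

theorem neg_mc_eq {N r₀ q : ℝ} (hr : r₀ ^ 2 = 2 * N) (hq : q ≠ 0) :
    mc N q = -((q - r₀) - (q - r₀) ^ 2 * (1 / q) / 2) := by
  unfold mc
  have : N = r₀ ^ 2 / 2 := by linarith
  rw [this]
  field_simp
  ring

theorem inv_mul_le {r₀ q : ℝ} (hr : 707 / 500 ≤ r₀) (hq : r₀ ≤ q) :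
    1 / q * (707 / 500 + (q - r₀)) ≤ 1 := by
  have : 0 < q := by linarith
  rw [one_div, inv_mul_le_iff₀ this]
  linarith

namespace IsArc

variable {N a b : ℝ} {x q : ℝ → ℝ}

theorem crossing_lower (h : IsArc N a (π / 2) x q) (hx : x (π / 2) ^ 2 ≤ 2) (ha : 0 < a) {θ : ℝ}
    (hθ : θ ∈ Ioo 0 (π / 2)) (hm : mc N (q θ) = 0) : 11 / 20 ≤ pf N θ (x θ) (q θ) := by
  obtain ⟨h1, h2⟩ := h.crossing_bounds hx hθ hm
  have hq2 := sq_eq_of_mc_eq_zero (h.q_ne (Ioo_subset_Icc_self hθ)) hm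
  have hP := h.pf_pos ⟨hθ.1.le, hθ.2⟩
  have hq := h.q_pos ha (Ioo_subset_Icc_self hθ)
  have hN := h.N_pos
  have hz := h.zf_nonneg θ hθ
  have hq1 : 1414 / 1000 ≤ q θ := by nlinarith
  have hi : 1 / q θ ≤ 1000 / 1414 := by
    rw [div_le_div_iff₀ hq (by norm_num)]; linarith
  by_contra! hcon
  have i1 : pf N θ (x θ) (q θ) * (1 / q θ) ≤ 11 / 20 * (1000 / 1414) := by
    have : 0 < 1 / q θ := by positivity
    gcongr
  have i2 : pf N θ (x θ) (q θ) ^ 2 ≤ 121 / 400 := by nlinarith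
  have hz' : zf N θ (x θ) (q θ) ≤ 461 / 1000 := by linarith
  nlinarith

theorem bar_le (h : IsArc N a (π / 2) x q) (hx : x (π / 2) ^ 2 ≤ 2) (ha : 0 < a) {θ₀ θ₁ : ℝ}
    (hθ₀ : θ₀ ∈ Ioo 0 (π / 2)) (hm : mc N (q θ₀) = 0) (hθ₁ : θ₁ ∈ Ioo 0 (π / 2))
    (hq1 : q θ₁ ≤ √(2 * N) + 121 / 50) :
    ∀ θ ∈ Ioo θ₀ θ₁, bar (q θ - √(2 * N)) ≤ pf N θ (x θ) (q θ) := by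
  have hN := h.N_pos
  obtain ⟨r₀, hr₀⟩ : ∃ r, r = √(2 * N) := ⟨_, rfl⟩
  have hr2 : r₀ ^ 2 = 2 * N := by rw [hr₀]; exact sq_sqrt (by linarith)
  have hrpos : 0 < r₀ := by rw [hr₀]; exact sqrt_pos.2 (by linarith)
  have hr1 : 707 / 500 ≤ r₀ := by nlinarith
  rw [← hr₀] at hq1 ⊢
  have hq0 : q θ₀ = r₀ := by
    have := sq_eq_of_mc_eq_zero (h.q_ne (Ioo_subset_Icc_self hθ₀)) hm
    have hq := h.q_pos ha (Ioo_subset_Icc_self hθ₀)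
    rw [← hr2] at this
    exact (pow_left_inj₀ hq.le hrpos.le two_ne_zero).1 this
  have hsub : Icc θ₀ θ₁ ⊆ Ioo 0 (π / 2) := fun t ht =>
    ⟨hθ₀.1.trans_le ht.1, ht.2.trans_lt hθ₁.2⟩
  obtain ⟨M, hM⟩ := isCompact_Icc.bddAbove_image (f := fun t => sin t / curv N t (x t) (q t))
    (K := Icc θ₀ θ₁) (continuous_sin.continuousOn.div
      (h.continuousOn_curv.mono (hsub.trans Ioo_subset_Icc_self))
      fun t ht => (h.curv_pos t (Ioo_subset_Icc_self (hsub ht))).ne')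
  have hd : ∀ t ∈ Ioo θ₀ θ₁, HasDerivAt (fun t => pf N t (x t) (q t) - bar (q t - r₀))
      (sin t / curv N t (x t) (q t) * (pf N t (x t) (q t) * pif t (x t)
        + (1 - zf N t (x t) (q t)) / 2 - N / q t ^ 2 - (1 / 20 + 23 / 25 * (q t - r₀)))) t := by
    intro t ht
    have ht' := hsub (Ioo_subset_Icc_self ht)
    have hqd := (h.hasDerivAt_q t (Ioo_subset_Icc_self ht')).sub_const r₀
    have hb := ((hqd.div_const 20).const_add (11 / 20)).add ((hqd.pow 2).const_mul (23 / 50))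
    refine ((h.hasDerivAt_pf ht').sub hb).congr_deriv ?_
    push_cast
    ring
  have main := nonneg_of_mul_le_deriv_of_continuousWithinAt (L := M * 10)
    (f := fun t => pf N t (x t) (q t) - bar (q t - r₀)) (a := θ₀) (b := θ₁)
    (by
      have := h.crossing_lower hx ha hθ₀ hm
      simp only [hq0, sub_self, bar]
      rw [hq0] at this
      linarith) ?_ hd ?_
  · intro t ht
    exact sub_nonneg.1 (main t ht)
  · have hqd := (h.hasDerivAt_q θ₀ (Ioo_subset_Icc_self hθ₀)).continuousAt
    have hb : Continuous bar := by unfold bar; fun_prop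
    exact ((h.hasDerivAt_pf hθ₀).continuousAt.sub
      (hb.continuousAt.comp (hqd.sub continuousAt_const))).continuousWithinAt
  · intro t ht hneg
    have ht' := hsub (Ioo_subset_Icc_self ht)
    have hMt := hM (mem_image_of_mem _ (Ioo_subset_Icc_self ht))
    have hP := h.pf_pos ⟨ht'.1.le, ht'.2⟩
    have hk := h.curv_pos t (Ioo_subset_Icc_self ht')
    have hs := h.sin_pos' ⟨ht'.1, ht'.2.le⟩
    have hr : 0 < sin t / curv N t (x t) (q t) := div_pos hs hk
    have hlow := h.pf_deriv_lower_bound ht'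
    have hqt : r₀ ≤ q t := by
      rw [← hq0]
      exact h.strictMonoOn_q.monotoneOn (Ioo_subset_Icc_self hθ₀) (Ioo_subset_Icc_self ht') ht.1.le
    have hqt2 : q t ≤ r₀ + 121 / 50 := le_trans
      (h.strictMonoOn_q.monotoneOn (Ioo_subset_Icc_self ht') (Ioo_subset_Icc_self hθ₁) ht.2.le) hq1
    have hqp : 0 < q t := by linarith
    have hi : 0 ≤ 1 / q t := by positivity
    have hi1 := inv_mul_le hr1 hqt
    rw [neg_mc_eq hr2 hqp.ne'] at hlow
    have hsl := bar_slope (by linarith : 0 ≤ q t - r₀) (by linarith) hi hi1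
    have hbp : 0 < bar (q t - r₀) := by
      have : 0 ≤ q t - r₀ := by linarith
      unfold bar; positivity
    have hb5 : bar (q t - r₀) ≤ 5 := by unfold bar; nlinarith
    set r := sin t / curv N t (x t) (q t)
    set P := pf N t (x t) (q t)
    set i := 1 / q t
    set T := q t - r₀ with hT
    set b := bar T
    set μ := T - T ^ 2 * i / 2 with hμ
    have hT0 : 0 ≤ T := by rw [hT]; linarith
    have hTi0 : 0 ≤ T * i := mul_nonneg hT0 hi
    have hTi : T * i ≤ 1 := by linarith only [hi1, hi]
    have hi0 : i ≤ 1 := by linarith only [hi1, hi, hTi0]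
    have hμ3 : μ ≤ 3 := by rw [hμ]; linarith only [mul_nonneg (sq_nonneg T) hi, hT, hqt2]
    have hμ0 : 0 ≤ μ := by
      have e : μ = T * (1 - T * i / 2) := by rw [hμ]; ring
      rw [e]
      exact mul_nonneg hT0 (by linarith only [hTi])
    have hbr : (P - b) * 10 ≤ 2 / 3 * ((P - -μ) * (P + i)) - P * i - (1 / 20 + 23 / 25 * T) := by
      have : 2 / 3 * ((P - -μ) * (P + i)) - P * i - (2 / 3 * (b + μ) * (b + i) - b * i) =
        (P - b) * (2 / 3 * (P + b + μ + i) - i) := by ring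
      have : (P - b) * 10 ≤ (P - b) * (2 / 3 * (P + b + μ + i) - i) := by
        apply mul_le_mul_of_nonpos_left _ hneg.le
        linarith only [hneg, hb5, hμ3, hi0, hi]
      linarith only [this, hsl, ‹2 / 3 * ((P - -μ) * (P + i)) - P * i - _ = _›]
    have h1 : r * ((P - b) * 10) ≤ r * (P * pif t (x t)
        + (1 - zf N t (x t) (q t)) / 2 - N / q t ^ 2 - (1 / 20 + 23 / 25 * T)) := by
      gcongr
      linarith
    have h2 : M * (P - b) ≤ r * (P - b) := mul_le_mul_of_nonpos_right hMt hneg.le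
    linarith

/-- Lower arcs of moderate width stay in a bounded region. -/
theorem q_lt (h : IsArc N a (π / 2) x q) (hx : x (π / 2) ^ 2 ≤ 2) (ha : 0 < a) {θ : ℝ}
    (hθ : θ ∈ Ioo 0 (π / 2)) : q θ < √(2 * N) + 121 / 50 := by
  by_contra! hcon
  have hN := h.N_pos
  obtain ⟨r₀, hr₀⟩ : ∃ r, r = √(2 * N) := ⟨_, rfl⟩
  have hr2 : r₀ ^ 2 = 2 * N := by rw [hr₀]; exact sq_sqrt (by linarith)
  have hrpos : 0 < r₀ := by rw [hr₀]; exact sqrt_pos.2 (by linarith)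
  have hr1 : 707 / 500 ≤ r₀ := by nlinarith
  rw [← hr₀] at hcon
  have hm : mc N (q θ) < 0 := by
    have hqp : 0 < q θ := by linarith
    rw [neg_mc_eq hr2 hqp.ne']
    have : (q θ - r₀) * (1 / q θ) ≤ 1 := by
      rw [mul_one_div, div_le_one hqp]; linarith
    nlinarith
  obtain ⟨θ₀, hθ₀, hm0⟩ := h.exists_mc_eq_zero hθ hm
  have hθ₀' : θ₀ ∈ Ioo 0 (π / 2) := ⟨hθ₀.1, hθ₀.2.trans hθ.2⟩
  have hq0 : q θ₀ = r₀ := by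
    have := sq_eq_of_mc_eq_zero (h.q_ne (Ioo_subset_Icc_self hθ₀')) hm0
    have hq := h.q_pos ha (Ioo_subset_Icc_self hθ₀')
    rw [← hr2] at this
    exact (pow_left_inj₀ hq.le hrpos.le two_ne_zero).1 this
  have hc : ContinuousOn q (Icc θ₀ θ) := h.continuousOn_q.mono fun t ht =>
    ⟨hθ₀'.1.le.trans ht.1, ht.2.trans hθ.2.le⟩
  obtain ⟨θ₂, hθ₂, hq2⟩ := intermediate_value_Ioc hθ₀.2.le hc
    (show r₀ + 121 / 50 ∈ Ioc (q θ₀) (q θ) from ⟨by rw [hq0]; linarith, hcon⟩)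
  obtain ⟨θ₁, hθ₁, hq1⟩ := intermediate_value_Ioo hθ₂.1.le
    (hc.mono (Icc_subset_Icc_right hθ₂.2))
    (show r₀ + 1 ∈ Ioo (q θ₀) (q θ₂) from ⟨by rw [hq0]; linarith, by rw [hq2]; linarith⟩)
  have hθ₂' : θ₂ ∈ Ioo 0 (π / 2) := ⟨hθ₀.1.trans hθ₂.1, hθ₂.2.trans_lt hθ.2⟩
  have hb := h.bar_le hx ha hθ₀' hm0 hθ₂' (by rw [hq2, hr₀]) θ₁ hθ₁
  rw [← hr₀, hq1] at hb
  have hb1 : 106 / 100 ≤ pf N θ₁ (x θ₁) (r₀ + 1) := by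
    refine le_trans ?_ hb
    unfold bar; norm_num
  have hsub : Icc θ₁ θ₂ ⊆ Ioo 0 (π / 2) := fun t ht =>
    ⟨(hθ₀'.1.trans hθ₁.1).trans_le ht.1, ht.2.trans_lt hθ₂'.2⟩
  have hVd : ∀ t ∈ Ioo 0 (π / 2), HasDerivAt
      (fun t => (pf N t (x t) (q t))⁻¹ + 2 / 3 * q t) _ t := fun t ht =>
    ((h.hasDerivAt_pf ht).inv (h.pf_pos ⟨ht.1.le, ht.2⟩).ne').add
      ((h.hasDerivAt_q t (Ioo_subset_Icc_self ht)).const_mul (2 / 3))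
  have hanti : AntitoneOn (fun t => (pf N t (x t) (q t))⁻¹ + 2 / 3 * q t) (Icc θ₁ θ₂) := by
    refine antitoneOn_of_deriv_nonpos (convex_Icc _ _)
      (fun t ht => (hVd t (hsub ht)).continuousAt.continuousWithinAt) ?_ ?_
    · intro t ht
      exact (hVd t (hsub (interior_subset ht))).differentiableAt.differentiableWithinAt
    · intro t ht
      have ht1 := interior_subset ht
      have ht' := hsub ht1
      rw [(hVd t ht').deriv]
      have hP := h.pf_pos ⟨ht'.1.le, ht'.2⟩
      have hk := h.curv_pos t (Ioo_subset_Icc_self ht')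
      have hs := h.sin_pos' ⟨ht'.1, ht'.2.le⟩
      have hr : 0 < sin t / curv N t (x t) (q t) := div_pos hs hk
      have hlow := h.pf_deriv_lower_bound ht'
      have hqt : r₀ + 1 ≤ q t := by
        rw [← hq1]
        exact h.strictMonoOn_q.monotoneOn
          (Ioo_subset_Icc_self (hsub ⟨le_rfl, hθ₁.2.le⟩)) (Ioo_subset_Icc_self ht') ht1.1
      have hqp : 0 < q t := by linarith
      have hi : 0 ≤ 1 / q t := by positivity
      have hi1 : 1 / q t ≤ 1 := by rw [div_le_one hqp]; linarith
      have hTi : (q t - r₀) * (1 / q t) ≤ 1 := by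
        rw [mul_one_div, div_le_one hqp]; linarith
      have hmc := neg_mc_eq hr2 hqp.ne'
      have hmc2 : mc N (q t) ≤ -(1 / 2) := by rw [hmc]; nlinarith
      set r := sin t / curv N t (x t) (q t)
      set P := pf N t (x t) (q t)
      set i := 1 / q t
      set E := P * pif t (x t) + (1 - zf N t (x t) (q t)) / 2 - N / q t ^ 2
      have hE : 2 / 3 * P ^ 2 ≤ E := by nlinarith
      have : -(r * E) / P ^ 2 + 2 / 3 * r = r * (2 / 3 * P ^ 2 - E) / P ^ 2 := by
        field_simp; ring
      rw [this]
      apply div_nonpos_of_nonpos_of_nonneg _ (by positivity)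
      exact mul_nonpos_of_nonneg_of_nonpos hr.le (by linarith)
  have := hanti ⟨le_rfl, hθ₁.2.le⟩ ⟨hθ₁.2.le, le_rfl⟩ hθ₁.2.le
  simp only [hq1, hq2] at this
  have hP2 := h.pf_pos ⟨hθ₂'.1.le, hθ₂'.2⟩
  rw [hq2] at hP2
  have i1 : 0 < (pf N θ₂ (x θ₂) (r₀ + 121 / 50))⁻¹ := by positivity
  have i2 : (pf N θ₁ (x θ₁) (r₀ + 1))⁻¹ ≤ (106 / 100)⁻¹ := by gcongr
  norm_num at i2
  linarith

theorem cond_lower (h : IsArc N a (π / 2) x q) (hx : x (π / 2) ^ 2 ≤ 2) (ha : 0 < a) {θ : ℝ}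
    (hθ : θ ∈ Ioo 0 (π / 2)) :
    Cond N (√(2 * N) + 3) (pf N θ (x θ) (q θ)) (zf N θ (x θ) (q θ)) (q θ) := by
  rcases le_or_gt 0 (mc N (q θ)) with hm | hm
  · exact h.cond_lower_of_mc_nonneg hx ha hθ hm
  obtain ⟨θ₀, hθ₀, hm0⟩ := h.exists_mc_eq_zero hθ hm
  have hθ₀' : θ₀ ∈ Ioo 0 (π / 2) := ⟨hθ₀.1, hθ₀.2.trans hθ.2⟩
  obtain ⟨θ₂, hθ₂⟩ := exists_between hθ.2
  have hθ₂' : θ₂ ∈ Ioo 0 (π / 2) := ⟨hθ.1.trans hθ₂.1, hθ₂.2⟩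
  have hb := h.bar_le hx ha hθ₀' hm0 hθ₂' (h.q_lt hx ha hθ₂').le θ ⟨hθ₀.2, hθ₂.1⟩
  have hlt := h.q_lt hx ha hθ
  have hN := h.N_pos
  obtain ⟨r₀, hr₀⟩ : ∃ r, r = √(2 * N) := ⟨_, rfl⟩
  have hr2 : r₀ ^ 2 = 2 * N := by rw [hr₀]; exact sq_sqrt (by linarith)
  have hrpos : 0 < r₀ := by rw [hr₀]; exact sqrt_pos.2 (by linarith)
  have hr1 : 707 / 500 ≤ r₀ := by nlinarith
  rw [← hr₀] at hb hlt ⊢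
  have hq := h.q_pos ha (Ioo_subset_Icc_self hθ)
  have hqr : r₀ ≤ q θ := by
    by_contra! hc
    have : 0 ≤ mc N (q θ) := by
      unfold mc
      rw [sub_nonneg, div_le_div_iff₀ (by norm_num) hq]
      nlinarith
    linarith
  have hP := h.pf_pos ⟨hθ.1.le, hθ.2⟩
  have hz := h.zf_nonneg θ hθ
  have hi : 0 ≤ 1 / q θ := by positivity
  have hg := cond_of_bar_le (by linarith : 0 ≤ q θ - r₀) (by linarith) hi
    (inv_mul_le hr1 hqr) hb
  unfold Cond
  rw [neg_mc_eq hr2 hq.ne']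
  have hNq : N / q θ ^ 2 = (1 - (q θ - r₀) * (1 / q θ)) ^ 2 / 2 := by
    have : N = r₀ ^ 2 / 2 := by linarith
    rw [this]; field_simp; ring
  have eP : 2 * (r₀ + 3 - q θ) * N * pf N θ (x θ) (q θ) / q θ ^ 3 =
      2 * (r₀ + 3 - q θ) * pf N θ (x θ) (q θ) * (N / q θ ^ 2) * (1 / q θ) := by
    field_simp
  rw [eP, hNq]
  have hqi : q θ * (1 / q θ) = 1 := by field_simp
  set P := pf N θ (x θ) (q θ)
  set z := zf N θ (x θ) (q θ)
  set i := 1 / q θ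
  obtain ⟨T, hT⟩ : ∃ T, T = q θ - r₀ := ⟨_, rfl⟩
  have eD : r₀ + 3 - q θ = 3 - T := by rw [hT]; ring
  rw [← hT] at hg ⊢
  rw [eD]
  have hT0 : 0 ≤ T := by rw [hT]; linarith
  have hT3 : T ≤ 121 / 50 := by rw [hT]; linarith
  have hTi : T * i < 1 := by
    have : T * i = 1 - r₀ * i := by rw [hT, sub_mul, hqi]
    have : 0 < i := by positivity
    nlinarith [mul_pos hrpos this]
  have hTi0 : 0 ≤ T * i := by positivity
  clear_value P z i
  set μ := T - T ^ 2 * i / 2 with hμ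
  set S := (3 - T) * (1 / 2 + (1 - T * i) ^ 2 / 2) - -μ with hS
  have hS3 : S ≤ 3 := by rw [hS, hμ]; nlinarith [mul_nonneg hT0 hTi0]
  have hS1 : 3 * (1 - T * i) ≤ S := by
    have e : S - 3 * (1 - T * i) = T * (T * i) / 2 * (1 - T * i) + 3 / 2 * (T * i) ^ 2 := by
      rw [hS, hμ]; ring
    have : 0 ≤ 1 - T * i := by linarith
    have : 0 ≤ T * (T * i) / 2 * (1 - T * i) + 3 / 2 * (T * i) ^ 2 := by positivity
    linarith
  have hSz : 0 ≤ S * (z / 2) := by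
    have : 0 ≤ S := le_trans (by linarith) hS1
    positivity
  have hw0 : 0 < 1 - T * i := by linarith
  have hlast : 0 ≤ (3 - T) * i * (1 - T * i) * P := by
    have : 0 ≤ 3 - T := by linarith
    positivity
  have e3 : S * (P ^ 2 + -μ * (P + i) + z / 2) + 4 * P ^ 3 -
      2 * (3 - T) * P * ((1 - T * i) ^ 2 / 2) * i =
      S * (P ^ 2 - μ * (P + i)) + S * (z / 2) + 4 * P ^ 3 -
        (3 - T) * i * (1 - T * i) * P * (1 - T * i) := by ring
  rw [e3]
  rcases le_or_gt 0 (P ^ 2 - μ * (P + i)) with hA | hA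
  · have h1 := mul_le_mul_of_nonneg_right hS1 hA
    have h2 := mul_pos hw0 hg
    have h3 : (1 - T * i) * P ^ 3 ≤ P ^ 3 := mul_le_of_le_one_left (by positivity) (by linarith)
    linarith only [h1, h2, h3, hSz]
  · have h1 := mul_le_mul_of_nonpos_right hS3 hA.le
    have h2 : (3 - T) * i * (1 - T * i) * P * (1 - T * i) ≤ (3 - T) * i * (1 - T * i) * P :=
      mul_le_of_le_one_right hlast (by linarith)
    linarith

end IsArc

end

section

/-- The conformal factor. -/
noncomputable def wt (N x q : ℝ) : ℝ := exp (N * log q - (x ^ 2 + q ^ 2) / 4)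

theorem wt_pos (N x q : ℝ) : 0 < wt N x q := exp_pos _

/-- The linearised curvature. -/
noncomputable def curvLin (N θ q ξ η : ℝ) : ℝ :=
  -(1 / 2 + N / q ^ 2) * cos θ * η + sin θ / 2 * ξ

/-- The variation field of an arc with respect to its starting point. -/
structure IsJacobi (N : ℝ) (x q ξ η : ℝ → ℝ) : Prop where
  ξ_zero : ξ 0 = 0
  η_zero : η 0 = 1
  hasDerivAt_ξ : ∀ θ ∈ Icc 0 (π / 2), HasDerivAt ξ
    (-(cos θ * curvLin N θ (q θ) (ξ θ) (η θ)) / curv N θ (x θ) (q θ) ^ 2) θ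
  hasDerivAt_η : ∀ θ ∈ Icc 0 (π / 2), HasDerivAt η
    (-(sin θ * curvLin N θ (q θ) (ξ θ) (η θ)) / curv N θ (x θ) (q θ) ^ 2) θ

namespace IsArc

variable {N a b : ℝ} {x q : ℝ → ℝ}

theorem hasDerivAt_wt (h : IsArc N a b x q) {θ : ℝ} (hθ : θ ∈ Icc 0 b) :
    HasDerivAt (fun t => wt N (x t) (q t)) (wt N (x θ) (q θ) *
      ((mc N (q θ) * sin θ - x θ * cos θ / 2) / curv N θ (x θ) (q θ))) θ := by
  have hq := h.q_ne hθ
  have h1 := h.hasDerivAt_x θ hθ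
  have h2 := h.hasDerivAt_q θ hθ
  have := (((h2.log hq).const_mul N).sub (((h1.pow 2).add (h2.pow 2)).div_const 4)).exp
  refine this.congr_deriv ?_
  unfold wt mc
  have hk := (h.curv_pos θ hθ).ne'
  congr 1
  push_cast
  generalize curv N θ (x θ) (q θ) = k at *
  field_simp
  ring

end IsArc

/-- The coefficient of the curvature in the Sturm comparison. -/
noncomputable def sf (N κ q : ℝ) : ℝ := (κ - q) * (1 / 2 + N / q ^ 2) - mc N q

/-- The monotone quantity driving the Sturm comparison. -/
noncomputable def lf (N κ θ x q : ℝ) : ℝ :=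
  (sf N κ q * cos θ + 2 * curv N θ x q * sin θ ^ 2) / (curv N θ x q * cos θ ^ 2)

/-- The Wronskian with the comparison function. -/
noncomputable def wf (N κ α θ x q ξ η : ℝ) : ℝ :=
  -(wt N x q * (curv N θ x q * (x * sin θ - α * (κ - q) * cos θ) * (cos θ * ξ + sin θ * η) +
    (sin θ * cos θ + curv N θ x q * x * cos θ + α * sin θ * cos θ
      + α * (κ - q) * curv N θ x q * sin θ) * (-sin θ * ξ + cos θ * η)))

namespace IsArc

variable {N a b κ : ℝ} {x q ξ η : ℝ → ℝ}

theorem hasDerivAt_sf (h : IsArc N a b x q) {θ : ℝ} (hθ : θ ∈ Icc 0 b) :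
    HasDerivAt (fun t => sf N κ (q t))
      (-2 * N * (κ - q θ) / q θ ^ 3 * (sin θ / curv N θ (x θ) (q θ))) θ := by
  have hq := h.q_ne hθ
  have h2 := h.hasDerivAt_q θ hθ
  have := ((h2.const_sub κ).mul (((hasDerivAt_const θ N).div (h2.pow 2)
    (pow_ne_zero 2 hq)).const_add (1 / 2))).sub (h.hasDerivAt_mc hθ)
  refine this.congr_deriv ?_
  simp only [Pi.div_apply, Pi.pow_apply]
  push_cast
  generalize hr : sin θ / curv N θ (x θ) (q θ) = r
  field_simp
  ring

theorem lf_eq (h : IsArc N a b x q) {θ : ℝ} (hθ : θ ∈ Ico 0 b) :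
    lf N κ θ (x θ) (q θ) = sf N κ (q θ) / (pf N θ (x θ) (q θ) * cos θ ^ 2) +
      2 * sin θ ^ 2 / cos θ ^ 2 := by
  have hc := h.cos_pos' hθ
  have hP := h.pf_pos hθ
  unfold lf
  rw [curv_eq_pf_mul_cos hc.ne']
  field_simp

theorem continuousOn_lf (h : IsArc N a b x q) :
    ContinuousOn (fun θ => lf N κ θ (x θ) (q θ)) (Ico 0 b) := by
  unfold lf
  have c1 : ContinuousOn (fun θ => sf N κ (q θ)) (Ico 0 b) := fun t ht =>
    (h.hasDerivAt_sf (Ico_subset_Icc_self ht)).continuousAt.continuousWithinAt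
  have c2 := h.continuousOn_curv.mono Ico_subset_Icc_self
  refine ContinuousOn.div ((c1.mul continuous_cos.continuousOn).add
    ((continuousOn_const.mul c2).mul (by fun_prop))) (c2.mul (by fun_prop)) ?_
  intro t ht
  have := h.curv_pos t (Ico_subset_Icc_self ht)
  have := h.cos_pos' ht
  positivity

theorem hasDerivAt_lf (h : IsArc N a b x q) {θ : ℝ} (hθ : θ ∈ Ioo 0 b) :
    HasDerivAt (fun θ => lf N κ θ (x θ) (q θ))
      (sin θ / (curv N θ (x θ) (q θ) * pf N θ (x θ) (q θ) ^ 2 * cos θ ^ 2) *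
        (sf N κ (q θ) * (pf N θ (x θ) (q θ) ^ 2 +
          mc N (q θ) * (pf N θ (x θ) (q θ) + 1 / q θ) + zf N θ (x θ) (q θ) / 2)
          + 4 * pf N θ (x θ) (q θ) ^ 3
          - 2 * (κ - q θ) * N * pf N θ (x θ) (q θ) / q θ ^ 3)) θ := by
  have hc := h.cos_pos' ⟨hθ.1.le, hθ.2⟩
  have hP := h.pf_pos ⟨hθ.1.le, hθ.2⟩
  have hq := h.q_ne (Ioo_subset_Icc_self hθ)
  have hk := h.curv_pos θ (Ioo_subset_Icc_self hθ)
  have d1 := (h.hasDerivAt_sf (κ := κ) (Ioo_subset_Icc_self hθ)).div ((h.hasDerivAt_pf hθ).mul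
    ((hasDerivAt_cos θ).pow 2)) (by simp only [Pi.mul_apply, Pi.pow_apply]; positivity)
  have d2 := (((hasDerivAt_sin θ).pow 2).const_mul 2).div ((hasDerivAt_cos θ).pow 2)
    (by simp only [Pi.pow_apply]; positivity)
  refine ((d1.add d2).congr_of_eventuallyEq ?_).congr_deriv ?_
  · filter_upwards [Ioo_mem_nhds hθ.1 hθ.2] with t ht
    rw [h.lf_eq ⟨ht.1.le, ht.2⟩]
    rfl
  · have e1 : curv N θ (x θ) (q θ) = pf N θ (x θ) (q θ) * cos θ := curv_eq_pf_mul_cos hc.ne'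
    have e : pif θ (x θ) = pf N θ (x θ) (q θ) - mc N (q θ) := by unfold pf; ring
    have e2 : mc N (q θ) * (1 / q θ) = N / q θ ^ 2 - 1 / 2 := by
      unfold mc; field_simp
    have e3 : mc N (q θ) * (pf N θ (x θ) (q θ) + 1 / q θ) =
      mc N (q θ) * pf N θ (x θ) (q θ) + (N / q θ ^ 2 - 1 / 2) := by rw [mul_add, e2]
    rw [e1, e, e3]
    simp only [Pi.mul_apply, Pi.pow_apply]
    have hsc := sin_sq_add_cos_sq θ
    generalize pf N θ (x θ) (q θ) = P at *
    generalize zf N θ (x θ) (q θ) = z at *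
    generalize sf N κ (q θ) = S at *
    generalize mc N (q θ) = m at *
    have hs2 : sin θ ^ 2 = 1 - cos θ ^ 2 := by linarith
    push_cast
    field_simp
    simp only [hs2]
    ring

theorem strictMonoOn_lf (h : IsArc N a (π / 2) x q)
    (hK : ∀ θ ∈ Ioo 0 (π / 2), Cond N κ (pf N θ (x θ) (q θ)) (zf N θ (x θ) (q θ)) (q θ)) :
    StrictMonoOn (fun θ => lf N κ θ (x θ) (q θ)) (Ico 0 (π / 2)) := by
  refine strictMonoOn_of_deriv_pos (convex_Ico _ _) h.continuousOn_lf ?_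
  intro θ hθ
  rw [interior_Ico] at hθ
  rw [(h.hasDerivAt_lf hθ).deriv]
  have hc := h.cos_pos' ⟨hθ.1.le, hθ.2⟩
  have hs := h.sin_pos' ⟨hθ.1, hθ.2.le⟩
  have hP := h.pf_pos ⟨hθ.1.le, hθ.2⟩
  have hk := h.curv_pos θ (Ioo_subset_Icc_self hθ)
  have := hK θ hθ
  unfold Cond at this
  unfold sf
  positivity

theorem hasDerivAt_wf (h : IsArc N a (π / 2) x q) (hJ : IsJacobi N x q ξ η) {α θ : ℝ}
    (hθ : θ ∈ Icc 0 (π / 2)) :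
    HasDerivAt (fun t => wf N κ α t (x t) (q t) (ξ t) (η t))
      (-(wt N (x θ) (q θ) / curv N θ (x θ) (q θ)) * (-sin θ * ξ θ + cos θ * η θ) *
        (2 * curv N θ (x θ) (q θ) * cos θ ^ 2 -
          α * (sf N κ (q θ) * cos θ + 2 * curv N θ (x θ) (q θ) * sin θ ^ 2))) θ := by
  have hw := h.hasDerivAt_wt hθ
  have hk := h.hasDerivAt_curv hθ
  have hx := h.hasDerivAt_x θ hθ
  have hq := h.hasDerivAt_q θ hθ
  have hξ := hJ.hasDerivAt_ξ θ hθ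
  have hη := hJ.hasDerivAt_η θ hθ
  have hs := hasDerivAt_sin θ
  have hc := hasDerivAt_cos θ
  have hD := hq.const_sub κ
  have d1 := ((hx.mul hs).sub ((hD.const_mul α).mul hc))
  have d2 := (hc.mul hξ).add (hs.mul hη)
  have d3 := (((hs.mul hc).add ((hk.mul hx).mul hc)).add ((hs.const_mul α).mul hc)).add
    (((hD.const_mul α).mul hk).mul hs)
  have d4 := (hs.neg.mul hξ).add (hc.mul hη)
  refine ((hw.mul (((hk.mul d1).mul d2).add (d3.mul d4))).neg).congr_deriv ?_
  have hq0 := h.q_ne hθ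
  have hkp := h.curv_pos θ hθ
  unfold curvLin sf
  simp only [Pi.mul_apply, Pi.add_apply, Pi.sub_apply, Pi.neg_apply]
  have hsc := sin_sq_add_cos_sq θ
  have em : curv N θ (x θ) (q θ) = mc N (q θ) * cos θ + x θ * sin θ / 2 := rfl
  have en : N / q θ ^ 2 = mc N (q θ) / q θ + 1 / 2 := by unfold mc; field_simp; ring
  have en' : N = mc N (q θ) * q θ + q θ ^ 2 / 2 := by unfold mc; field_simp; ring
  generalize mc N (q θ) = m at *
  generalize curv N θ (x θ) (q θ) = k at *
  generalize wt N (x θ) (q θ) = w at *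
  rw [en]
  generalize q θ = Q at *
  generalize x θ = X at *
  generalize ξ θ = U at *
  generalize η θ = V at *
  generalize sin θ = s at *
  generalize cos θ = c at *
  field_simp
  clear hw d1 hk d2 d3 d4 hs hx hξ hη hc hq hD hkp
  have hs2 : s ^ 2 = 1 - c ^ 2 := by linarith
  have hs3 : s ^ 3 = s * (1 - c ^ 2) := by rw [← hs2]; ring
  have hs4 : s ^ 4 = (1 - c ^ 2) ^ 2 := by rw [← hs2]; ring
  have hs5 : s ^ 5 = s * (1 - c ^ 2) ^ 2 := by rw [← hs2]; ring
  subst em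
  ring_nf
  simp only [hs2, hs3, hs4, hs5]
  ring

end IsArc

end

section

namespace IsArc

variable {N a b κ : ℝ} {x q ξ η : ℝ → ℝ}

theorem lf_pos (h : IsArc N a (π / 2) x q) {θ : ℝ} (hθ : θ ∈ Ico 0 (π / 2))
    (hS : 0 < sf N κ (q θ)) : 0 < lf N κ θ (x θ) (q θ) := by
  have := h.cos_pos' hθ
  have := h.curv_pos θ (Ico_subset_Icc_self hθ)
  unfold lf
  positivity

theorem wf_zero (h : IsArc N a (π / 2) x q) (hJ : IsJacobi N x q ξ η) (κ α : ℝ) :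
    wf N κ α 0 (x 0) (q 0) (ξ 0) (η 0) = 0 := by
  simp [wf, h.x_zero, hJ.ξ_zero, hJ.η_zero]

theorem wf_eq_of_η_eq_zero (N κ α θ X Q U : ℝ) :
    wf N κ α θ X Q U 0 = wt N X Q * U *
      (α * (κ - Q) * curv N θ X Q + (1 + α) * sin θ ^ 2 * cos θ) := by
  have hs2 : sin θ ^ 2 = 1 - cos θ ^ 2 := by linarith [sin_sq_add_cos_sq θ]
  unfold wf
  ring_nf
  simp only [hs2]
  ring

theorem continuousOn_wf (h : IsArc N a (π / 2) x q) (hJ : IsJacobi N x q ξ η) {α : ℝ} :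
    ContinuousOn (fun t => wf N κ α t (x t) (q t) (ξ t) (η t)) (Icc 0 (π / 2)) :=
  fun _ ht => (h.hasDerivAt_wf hJ ht).continuousAt.continuousWithinAt

/-- The normal component of the variation field. -/
theorem hasDerivAt_normal (hJ : IsJacobi N x q ξ η) {θ : ℝ} (hθ : θ ∈ Icc 0 (π / 2)) :
    HasDerivAt (fun t => -sin t * ξ t + cos t * η t) (-(cos θ * ξ θ + sin θ * η θ)) θ := by
  have := ((hasDerivAt_sin θ).neg.mul (hJ.hasDerivAt_ξ θ hθ)).add
    ((hasDerivAt_cos θ).mul (hJ.hasDerivAt_η θ hθ))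
  refine this.congr_deriv ?_
  simp only [Pi.neg_apply]
  ring

theorem strictAntiOn_normal_div_sin (hJ : IsJacobi N x q ξ η) {t : ℝ} (ht : t ≤ π / 2)
    (hη : ∀ θ ∈ Ioo 0 t, 0 < η θ) :
    StrictAntiOn (fun θ => (-sin θ * ξ θ + cos θ * η θ) / sin θ) (Ioc 0 t) := by
  have hd : ∀ θ ∈ Ioc 0 t, HasDerivAt (fun θ => (-sin θ * ξ θ + cos θ * η θ) / sin θ)
      (-η θ / sin θ ^ 2) θ := by
    intro θ hθ
    have hs : 0 < sin θ := sin_pos_of_pos_of_lt_pi hθ.1 (by linarith [hθ.2, pi_pos])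
    refine ((hasDerivAt_normal hJ ⟨hθ.1.le, hθ.2.trans ht⟩).div (hasDerivAt_sin θ)
      hs.ne').congr_deriv ?_
    congr 1
    linear_combination -η θ * sin_sq_add_cos_sq θ
  refine strictAntiOn_of_deriv_neg (convex_Ioc _ _)
    (fun θ hθ => (hd θ hθ).continuousAt.continuousWithinAt) fun θ hθ => ?_
  rw [interior_Ioc] at hθ
  rw [(hd θ (Ioo_subset_Ioc_self hθ)).deriv]
  have hs : 0 < sin θ := sin_pos_of_pos_of_lt_pi hθ.1 (by linarith [hθ.2, pi_pos])
  have := hη θ hθ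
  exact div_neg_of_neg_of_pos (by linarith) (by positivity)

/-- A Sturm comparison argument: the variation field never becomes horizontal. -/
theorem η_pos (h : IsArc N a (π / 2) x q) (hJ : IsJacobi N x q ξ η)
    (hK : ∀ θ ∈ Ioo 0 (π / 2), Cond N κ (pf N θ (x θ) (q θ)) (zf N θ (x θ) (q θ)) (q θ))
    (hD : ∀ θ ∈ Icc 0 (π / 2), q θ < κ) (hS : ∀ θ ∈ Ico 0 (π / 2), 0 < sf N κ (q θ)) :
    ∀ θ ∈ Icc 0 (π / 2), 0 < η θ := by
  have hcη : ContinuousOn η (Icc 0 (π / 2)) :=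
    fun t ht => (hJ.hasDerivAt_η t ht).continuousAt.continuousWithinAt
  by_contra! hcon
  obtain ⟨t₀, ht₀, hneg⟩ := hcon
  obtain ⟨θ₁, hθ₁, hz, hpos⟩ : ∃ θ₁ ∈ Ioc 0 (π / 2), η θ₁ = 0 ∧ ∀ θ ∈ Ioo 0 θ₁, 0 < η θ := by
    set Z : Set ℝ := Icc 0 (π / 2) ∩ η ⁻¹' Iic 0 with hZ
    have hZc : IsClosed Z := hcη.preimage_isClosed_of_isClosed isClosed_Icc isClosed_Iic
    have hZne : Z.Nonempty := ⟨t₀, ht₀, hneg⟩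
    have hZb : BddBelow Z := ⟨0, fun t ht => ht.1.1⟩
    have hm := hZc.csInf_mem hZne hZb
    set m := sInf Z
    have hm0 : m ≠ 0 := by
      intro h0
      have := hm.2
      rw [h0] at this
      simp only [mem_preimage, hJ.η_zero, mem_Iic] at this
      linarith
    have hmp : 0 < m := lt_of_le_of_ne hm.1.1 hm0.symm
    have hlt : ∀ θ ∈ Ico 0 m, 0 < η θ := by
      intro θ hθ
      by_contra! hc
      exact absurd (csInf_le hZb ⟨⟨hθ.1, hθ.2.le.trans hm.1.2⟩, hc⟩) (not_le.2 hθ.2)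
    refine ⟨m, ⟨hmp, hm.1.2⟩, le_antisymm hm.2 ?_, fun θ hθ => hlt θ ⟨hθ.1.le, hθ.2⟩⟩
    have hcw : Tendsto η (𝓝[<] m) (𝓝 (η m)) :=
      (hJ.hasDerivAt_η m hm.1).continuousAt.continuousWithinAt
    refine ge_of_tendsto hcw ?_
    filter_upwards [Ioo_mem_nhdsLT hmp] with θ hθ using (hlt θ ⟨hθ.1.le, hθ.2⟩).le
  have hsub : Icc 0 θ₁ ⊆ Icc 0 (π / 2) := Icc_subset_Icc le_rfl hθ₁.2
  have hs₁ := h.sin_pos' hθ₁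
  have hc₁ := h.cos_nonneg' (Ioc_subset_Icc_self hθ₁)
  have hk₁ := h.curv_pos θ₁ (Ioc_subset_Icc_self hθ₁)
  have hD₁ := hD θ₁ (Ioc_subset_Icc_self hθ₁)
  have hanti := strictAntiOn_normal_div_sin hJ hθ₁.2 hpos
  have hmono := h.strictMonoOn_lf hK
  have hlp : ∀ θ ∈ Ico 0 (π / 2), 0 < lf N κ θ (x θ) (q θ) := fun θ hθ => h.lf_pos hθ (hS θ hθ)
  have hdl : ∀ α, ∀ θ ∈ Ioo 0 θ₁, deriv (fun t => wf N κ α t (x t) (q t) (ξ t) (η t)) θ =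
      -(wt N (x θ) (q θ) * cos θ ^ 2) * (-sin θ * ξ θ + cos θ * η θ) *
        (2 - α * lf N κ θ (x θ) (q θ)) := by
    intro α θ hθ
    have hθ' : θ ∈ Icc 0 (π / 2) := ⟨hθ.1.le, hθ.2.le.trans hθ₁.2⟩
    have hk := h.curv_pos θ hθ'
    have hc := h.cos_pos' ⟨hθ.1.le, hθ.2.trans_le hθ₁.2⟩
    rw [(h.hasDerivAt_wf hJ hθ').deriv]
    unfold lf
    field_simp
  have hW₁ : ∀ α, wf N κ α θ₁ (x θ₁) (q θ₁) (ξ θ₁) (η θ₁) = wt N (x θ₁) (q θ₁) * ξ θ₁ *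
      (α * (κ - q θ₁) * curv N θ₁ (x θ₁) (q θ₁) + (1 + α) * sin θ₁ ^ 2 * cos θ₁) := by
    intro α
    rw [hz, wf_eq_of_η_eq_zero]
  have hWpos : ∀ α, 0 < α → 0 < wt N (x θ₁) (q θ₁) * (α * (κ - q θ₁) *
      curv N θ₁ (x θ₁) (q θ₁) + (1 + α) * sin θ₁ ^ 2 * cos θ₁) := by
    intro α hα
    have := wt_pos N (x θ₁) (q θ₁)
    have : 0 < κ - q θ₁ := by linarith
    positivity
  have hJ₁ : -sin θ₁ * ξ θ₁ + cos θ₁ * η θ₁ = -(sin θ₁ * ξ θ₁) := by rw [hz]; ring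
  have hsn : ∀ θ ∈ Ioc 0 θ₁, 0 < sin θ := fun θ hθ => h.sin_pos' ⟨hθ.1, hθ.2.trans hθ₁.2⟩
  rcases le_or_gt (ξ θ₁) 0 with hξ | hξ
  · -- the normal component is positive before `θ₁`
    have hJp : ∀ θ ∈ Ioo 0 θ₁, 0 < -sin θ * ξ θ + cos θ * η θ := by
      intro θ hθ
      have h1 := hanti (Ioo_subset_Ioc_self hθ) (right_mem_Ioc.2 hθ₁.1) hθ.2
      have h2 : 0 ≤ (-sin θ₁ * ξ θ₁ + cos θ₁ * η θ₁) / sin θ₁ := by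
        rw [hJ₁]; exact div_nonneg (by nlinarith) hs₁.le
      have h3 := h2.trans_lt h1
      have := mul_pos h3 (hsn θ (Ioo_subset_Ioc_self hθ))
      rwa [div_mul_cancel₀ _ (hsn θ (Ioo_subset_Ioc_self hθ)).ne'] at this
    have h00 : (0:ℝ) ∈ Ico 0 (π / 2) := ⟨le_rfl, by positivity⟩
    have hl0 := hlp 0 h00
    set l₀ := lf N κ 0 (x 0) (q 0) with hl₀
    have hinc : StrictMonoOn (fun t => wf N κ (2 / l₀) t (x t) (q t) (ξ t) (η t)) (Icc 0 θ₁) := by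
      refine strictMonoOn_of_deriv_pos (convex_Icc _ _) ((h.continuousOn_wf hJ).mono hsub) ?_
      intro θ hθ
      rw [interior_Icc] at hθ
      rw [hdl _ θ hθ]
      have hθ' : θ ∈ Ico 0 (π / 2) := ⟨hθ.1.le, hθ.2.trans_le hθ₁.2⟩
      have hl : l₀ < lf N κ θ (x θ) (q θ) := hmono h00 hθ' hθ.1
      have hc := h.cos_pos' hθ'
      have : 2 - 2 / l₀ * lf N κ θ (x θ) (q θ) < 0 := by
        have : 1 < lf N κ θ (x θ) (q θ) / l₀ := (one_lt_div hl0).2 hl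
        have e : 2 / l₀ * lf N κ θ (x θ) (q θ) = 2 * (lf N κ θ (x θ) (q θ) / l₀) := by ring
        linarith
      have hw := wt_pos N (x θ) (q θ)
      have := mul_pos (mul_pos (mul_pos hw (pow_pos hc 2)) (hJp θ hθ)) (neg_pos.2 this)
      linarith
    have := hinc (left_mem_Icc.2 hθ₁.1.le) (right_mem_Icc.2 hθ₁.1.le) hθ₁.1
    simp only [h.wf_zero hJ, hW₁] at this
    have h2 := hWpos (2 / l₀) (by positivity)
    have h3 := mul_nonneg h2.le (neg_nonneg.2 hξ)
    linarith
  · -- the normal component vanishes once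
    have hcJ : ContinuousOn (fun t => -sin t * ξ t + cos t * η t) (Icc 0 θ₁) := fun t ht =>
      (hasDerivAt_normal hJ (hsub ht)).continuousAt.continuousWithinAt
    obtain ⟨σ, hσ, hσz⟩ := intermediate_value_Ioo' hθ₁.1.le hcJ
      (show (0:ℝ) ∈ Ioo _ _ from ⟨by rw [hJ₁]; nlinarith, by simp [hJ.η_zero]⟩)
    simp only at hσz
    have hσm : σ ∈ Ioc 0 θ₁ := Ioo_subset_Ioc_self hσ
    have hσ' : σ ∈ Ico 0 (π / 2) := ⟨hσ.1.le, hσ.2.trans_le hθ₁.2⟩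
    have hl0 := hlp σ hσ'
    set l₀ := lf N κ σ (x σ) (q σ) with hl₀
    have hJs : ∀ θ ∈ Ioo 0 σ, 0 < -sin θ * ξ θ + cos θ * η θ := by
      intro θ hθ
      have hm : θ ∈ Ioc 0 θ₁ := ⟨hθ.1, hθ.2.le.trans hσ.2.le⟩
      have h1 := hanti hm hσm hθ.2
      simp only [hσz, zero_div] at h1
      have := mul_pos h1 (hsn θ hm)
      rwa [div_mul_cancel₀ _ (hsn θ hm).ne'] at this
    have hJl : ∀ θ ∈ Ioo σ θ₁, -sin θ * ξ θ + cos θ * η θ < 0 := by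
      intro θ hθ
      have hm : θ ∈ Ioc 0 θ₁ := ⟨hσ.1.trans hθ.1, hθ.2.le⟩
      have h1 := hanti hσm hm hθ.1
      simp only [hσz, zero_div] at h1
      have := mul_neg_of_neg_of_pos h1 (hsn θ hm)
      rwa [div_mul_cancel₀ _ (hsn θ hm).ne'] at this
    have e : ∀ θ, 2 / l₀ * lf N κ θ (x θ) (q θ) = 2 * (lf N κ θ (x θ) (q θ) / l₀) :=
      fun θ => by ring
    have hd1 : StrictAntiOn (fun t => wf N κ (2 / l₀) t (x t) (q t) (ξ t) (η t)) (Icc 0 σ) := by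
      refine strictAntiOn_of_deriv_neg (convex_Icc _ _)
        ((h.continuousOn_wf hJ).mono ((Icc_subset_Icc le_rfl hσ.2.le).trans hsub)) ?_
      intro θ hθ
      rw [interior_Icc] at hθ
      rw [hdl _ θ ⟨hθ.1, hθ.2.trans hσ.2⟩, e]
      have hθ' : θ ∈ Ico 0 (π / 2) := ⟨hθ.1.le, hθ.2.trans hσ'.2⟩
      have hl : lf N κ θ (x θ) (q θ) < l₀ := hmono hθ' hσ' hθ.2
      have hc := h.cos_pos' hθ'
      have h2 : lf N κ θ (x θ) (q θ) / l₀ < 1 := (div_lt_one hl0).2 hl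
      have h3 : 0 < 2 - 2 * (lf N κ θ (x θ) (q θ) / l₀) := by linarith
      have hw := wt_pos N (x θ) (q θ)
      have := mul_pos (mul_pos (mul_pos hw (pow_pos hc 2)) (hJs θ hθ)) h3
      linarith
    have hd2 : StrictAntiOn (fun t => wf N κ (2 / l₀) t (x t) (q t) (ξ t) (η t)) (Icc σ θ₁) := by
      refine strictAntiOn_of_deriv_neg (convex_Icc _ _)
        ((h.continuousOn_wf hJ).mono ((Icc_subset_Icc hσ.1.le le_rfl).trans hsub)) ?_
      intro θ hθ
      rw [interior_Icc] at hθ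
      rw [hdl _ θ ⟨hσ.1.trans hθ.1, hθ.2⟩, e]
      have hθ' : θ ∈ Ico 0 (π / 2) := ⟨(hσ.1.trans hθ.1).le, hθ.2.trans_le hθ₁.2⟩
      have hl : l₀ < lf N κ θ (x θ) (q θ) := hmono hσ' hθ' hθ.1
      have hc := h.cos_pos' hθ'
      have h2 : 1 < lf N κ θ (x θ) (q θ) / l₀ := (one_lt_div hl0).2 hl
      have h3 : 0 < -(2 - 2 * (lf N κ θ (x θ) (q θ) / l₀)) := by linarith
      have hw := wt_pos N (x θ) (q θ)
      have := mul_pos (mul_pos (mul_pos hw (pow_pos hc 2)) (neg_pos.2 (hJl θ hθ))) h3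
      linarith
    have h1 := hd1 (left_mem_Icc.2 hσ.1.le) (right_mem_Icc.2 hσ.1.le) hσ.1
    have h2 := hd2 (left_mem_Icc.2 hσ.2.le) (right_mem_Icc.2 hσ.2.le) hσ.2
    have h3 := h2.trans h1
    simp only [h.wf_zero hJ, hW₁] at h3
    have h4 := mul_pos (hWpos (2 / l₀) (by positivity)) hξ
    linarith

theorem η_pos_upper (h : IsArc N a (π / 2) x q) (hJ : IsJacobi N x q ξ η)
    (hx : x (π / 2) ^ 2 ≤ 2) (ha : a < 0) : ∀ θ ∈ Icc 0 (π / 2), 0 < η θ := by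
  have hq : ∀ θ ∈ Icc 0 (π / 2), q θ < 0 := fun θ hθ => by
    have := h.same_sign θ hθ
    nlinarith
  refine h.η_pos hJ (fun θ hθ => h.cond_upper hx ha hθ) hq fun θ hθ => ?_
  have h1 := hq θ (Ico_subset_Icc_self hθ)
  have hq0 := h1.ne
  have e : sf N 0 (q θ) = 2 * N / (-q θ) := by
    unfold sf mc
    field_simp
    ring
  rw [e]
  have := h.N_pos
  exact div_pos (by linarith) (by linarith)

theorem q_le (h : IsArc N a (π / 2) x q) (hx : x (π / 2) ^ 2 ≤ 2) (ha : 0 < a) {θ : ℝ}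
    (hθ : θ ∈ Icc 0 (π / 2)) : q θ ≤ √(2 * N) + 121 / 50 := by
  have hp : (0:ℝ) < π / 2 := by positivity
  have hm := right_mem_Icc.2 hp.le
  refine (h.strictMonoOn_q.monotoneOn hθ hm hθ.2).trans ?_
  have hcw : Tendsto q (𝓝[<] (π / 2)) (𝓝 (q (π / 2))) :=
    (h.hasDerivAt_q _ hm).continuousAt.continuousWithinAt
  refine le_of_tendsto hcw ?_
  filter_upwards [Ioo_mem_nhdsLT hp] with t ht using (h.q_lt hx ha ht).le

theorem η_pos_lower (h : IsArc N a (π / 2) x q) (hJ : IsJacobi N x q ξ η)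
    (hx : x (π / 2) ^ 2 ≤ 2) (ha : 0 < a) : ∀ θ ∈ Icc 0 (π / 2), 0 < η θ := by
  have hN := h.N_pos
  have hq' : ∀ θ ∈ Icc 0 (π / 2), q θ ≤ √(2 * N) + 121 / 50 := fun θ hθ => h.q_le hx ha hθ
  refine h.η_pos hJ (fun θ hθ => h.cond_lower hx ha hθ)
    (fun θ hθ => by linarith [hq' θ hθ]) fun θ hθ => ?_
  have hq0 := h.q_pos ha (Ico_subset_Icc_self hθ)
  have h1 := hq' θ (Ico_subset_Icc_self hθ)
  have hr : √(2 * N) ^ 2 = 2 * N := sq_sqrt (by linarith)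
  have hr0 := sqrt_nonneg (2 * N)
  have e : sf N (√(2 * N) + 3) (q θ) =
      ((√(2 * N) + 3) * (q θ ^ 2 + 2 * N) - 4 * N * q θ) / (2 * q θ ^ 2) := by
    unfold sf mc
    field_simp
    ring
  rw [e]
  refine div_pos ?_ (by positivity)
  set ρ := √(2 * N)
  set Q := q θ
  have : 0 < (ρ + 3) * (Q ^ 2 + ρ ^ 2) - 2 * ρ ^ 2 * Q := by
    nlinarith [sq_nonneg (Q - ρ)]
  nlinarith

end IsArc

end

section

/-! ### Ordinary differential equations -/

/-- Truncation of both coordinates at height `M`. -/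
noncomputable def truncate (M : ℝ) (y : ℝ × ℝ) : ℝ × ℝ :=
  (max (-M) (min M y.1), max (-M) (min M y.2))

theorem lipschitzWith_truncate (M : ℝ) : LipschitzWith 1 (truncate M) := by
  have h : LipschitzWith 1 (fun s : ℝ => max (-M) (min M s)) :=
    (LipschitzWith.id.const_min M).const_max (-M)
  have h1 := h.comp (LipschitzWith.prod_fst (α := ℝ) (β := ℝ))
  have h2 := h.comp (LipschitzWith.prod_snd (α := ℝ) (β := ℝ))
  exact (by simpa using h1.prodMk h2 : LipschitzWith 1 fun y : ℝ × ℝ =>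
    ((max (-M) (min M y.1), max (-M) (min M y.2)) : ℝ × ℝ))

theorem norm_truncate_le {M : ℝ} (hM : 0 ≤ M) (y : ℝ × ℝ) : ‖truncate M y‖ ≤ M := by
  have h (s : ℝ) : |max (-M) (min M s)| ≤ M :=
    abs_le.2 ⟨le_max_left _ _, max_le (by linarith) (min_le_left _ _)⟩
  exact max_le (h _) (h _)

theorem norm_truncate_le_norm {M : ℝ} (hM : 0 ≤ M) (y : ℝ × ℝ) : ‖truncate M y‖ ≤ ‖y‖ := by
  have h0 : truncate M 0 = 0 := by simp [truncate, hM]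
  simpa [h0, dist_eq_norm] using (lipschitzWith_truncate M).dist_le_mul y 0

theorem truncate_eq_self {M : ℝ} {y : ℝ × ℝ} (hy : ‖y‖ ≤ M) : truncate M y = y := by
  have h (s : ℝ) (hs : ‖s‖ ≤ M) : max (-M) (min M s) = s := by
    have := abs_le.1 hs
    rw [min_eq_right this.2, max_eq_right this.1]
  exact Prod.ext (h _ ((le_max_left _ _).trans hy)) (h _ ((le_max_right _ _).trans hy))

/-- Global existence for Lipschitz vector fields on the plane. -/
theorem exists_solution {f : ℝ → ℝ × ℝ → ℝ × ℝ} {K : NNReal} (hL : ∀ t, LipschitzWith K (f t))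
    (hc : ∀ y, Continuous (f · y)) (y₀ : ℝ × ℝ) :
    ∃ Y : ℝ → ℝ × ℝ, Y 0 = y₀ ∧ ∀ t ∈ Icc 0 (π / 2), HasDerivAt Y (f t (Y t)) t := by
  obtain ⟨L, hL0⟩ := isCompact_Icc.exists_bound_of_continuousOn
    (hc 0).continuousOn (s := Icc (-1 : ℝ) 2)
  have hLnn : 0 ≤ L := (norm_nonneg _).trans (hL0 0 (by norm_num))
  have hgr (t : ℝ) (ht : t ∈ Icc (-1 : ℝ) 2) (y : ℝ × ℝ) : ‖f t y‖ ≤ K * ‖y‖ + L := by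
    have h1 := (hL t).dist_le_mul y 0
    rw [dist_eq_norm, dist_zero_right] at h1
    have h2 : ‖f t y‖ ≤ ‖f t y - f t 0‖ + ‖f t 0‖ := by
      simpa using norm_add_le (f t y - f t 0) (f t 0)
    linarith [hL0 t ht]
  obtain ⟨M, hM⟩ := isCompact_Icc.exists_bound_of_continuousOn (s := Icc (0 : ℝ) 2)
    (f := gronwallBound ‖y₀‖ K L)
    (fun t _ => (hasDerivAt_gronwallBound ‖y₀‖ K L t).continuousAt.continuousWithinAt)
  have hM0 : 0 ≤ M := (norm_nonneg _).trans (hM 0 (by norm_num))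
  lift M to NNReal using hM0
  lift L to NNReal using hLnn
  have hPL : IsPicardLindelof (fun t y => f t (truncate M y)) (tmin := -1) (tmax := 2)
      ⟨0, by norm_num⟩ y₀ ((K * M + L) * 2) 0 (K * M + L) K :=
    { lipschitzOnWith := fun t _ => by
        have h1 := (hL t).comp (lipschitzWith_truncate M)
        rw [mul_one] at h1
        exact h1.lipschitzOnWith
      continuousOn := fun y _ => (hc _).continuousOn
      norm_le := fun t ht y _ => by
        have h1 := hgr t ht (truncate M y)
        have h2 := norm_truncate_le M.2 y
        push_cast
        have := mul_le_mul_of_nonneg_left h2 K.2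
        exact h1.trans (by simpa using this)
      mul_max_le := by norm_num }
  obtain ⟨Y, hY0, hY⟩ := hPL.exists_eq_forall_mem_Icc_hasDerivWithinAt₀
  have hYd (t : ℝ) (ht : t ∈ Ioo (-1 : ℝ) 2) : HasDerivAt Y (f t (truncate M (Y t))) t :=
    (hY t (Ioo_subset_Icc_self ht)).hasDerivAt (Icc_mem_nhds ht.1 ht.2)
  have hYM := norm_le_gronwallBound_of_norm_deriv_right_le (f := Y) (a := 0) (b := 2)
    (f' := fun t => f t (truncate M (Y t))) (δ := ‖y₀‖) (K := K) (ε := L)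
    (fun t ht => (hY t ⟨by linarith [ht.1], ht.2⟩).continuousWithinAt.mono
      (Icc_subset_Icc (by norm_num) le_rfl))
    (fun t ht => (hYd t ⟨by linarith [ht.1], ht.2⟩).hasDerivWithinAt) (by simp_all)
    (fun t ht => by
      refine (hgr t ⟨by linarith [ht.1], ht.2.le⟩ _).trans ?_
      gcongr
      exact norm_truncate_le_norm M.2 _)
  have hpi : π / 2 < 2 := by linarith [pi_lt_four]
  refine ⟨Y, hY0, fun t ht => ?_⟩
  have h2 : t ∈ Icc (0 : ℝ) 2 := ⟨ht.1, ht.2.trans hpi.le⟩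
  have h3 : ‖Y t‖ ≤ M := by
    have h4 := hYM t h2
    rw [sub_zero] at h4
    exact h4.trans ((le_abs_self _).trans (hM t h2))
  simpa [truncate_eq_self h3] using hYd t ⟨by linarith [ht.1], ht.2.trans_lt hpi⟩

variable {E G : Type*} [NormedAddCommGroup E] [NormedSpace ℝ E] [NormedAddCommGroup G]
  [NormedSpace ℝ G]

/-- A function which is `C¹` near a compact set is uniformly differentiable along it. -/
theorem uniform_diff {H : E → G} {S : Set E} (hS : IsCompact S)
    (hH : ∀ p ∈ S, ContDiffAt ℝ 1 H p) {ε : ℝ} (hε : 0 < ε) :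
    ∃ δ > 0, ∀ p ∈ S, ∀ w, dist w p < δ →
      ‖H w - H p - fderiv ℝ H p (w - p)‖ ≤ ε * ‖w - p‖ := by
  have key : ∀ p : S, ∃ U : Set E, IsOpen U ∧ (p : E) ∈ U ∧ ∀ u ∈ U, ∀ v ∈ U,
      ‖H v - H u - fderiv ℝ H u (v - u)‖ ≤ ε * ‖v - u‖ := by
    intro p
    have h1 := ((hH p p.2).hasStrictFDerivAt one_ne_zero).isLittleO.def (half_pos hε)
    have hfc : ContinuousAt (fderiv ℝ H) p := (hH p p.2).continuousAt_fderiv one_ne_zero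
    have h2 := hfc.eventually (Metric.ball_mem_nhds _ (half_pos hε))
    rw [nhds_prod_eq] at h1
    obtain ⟨V, hV, hV'⟩ := Filter.eventually_prod_self_iff
      (r := fun v u => ‖H v - H u - fderiv ℝ H p (v - u)‖ ≤ ε / 2 * ‖v - u‖) |>.1 h1
    obtain ⟨U, hUV, hUo, hpU⟩ := mem_nhds_iff.1 (inter_mem hV h2)
    refine ⟨U, hUo, hpU, fun u hu v hv => ?_⟩
    have h3 := hV' v (hUV hv).1 u (hUV hu).1
    have h4 : ‖fderiv ℝ H u - fderiv ℝ H p‖ < ε / 2 := by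
      have : dist (fderiv ℝ H u) (fderiv ℝ H p) < ε / 2 := (hUV hu).2
      rwa [dist_eq_norm] at this
    have h5 := (fderiv ℝ H u - fderiv ℝ H p).le_opNorm (v - u)
    have h6 : ‖(fderiv ℝ H u - fderiv ℝ H p) (v - u)‖ ≤ ε / 2 * ‖v - u‖ :=
      h5.trans (mul_le_mul_of_nonneg_right h4.le (norm_nonneg _))
    calc _ = ‖(H v - H u - fderiv ℝ H p (v - u)) -
          (fderiv ℝ H u - fderiv ℝ H p) (v - u)‖ := by
          congr 1
          rw [sub_apply]; abel
      _ ≤ _ := norm_sub_le _ _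
      _ ≤ _ := by linarith
  choose U hUo hpU hU using key
  obtain ⟨δ, hδ, h⟩ := lebesgue_number_lemma_of_metric hS hUo
    (fun p hp => mem_iUnion.2 ⟨⟨p, hp⟩, hpU _⟩)
  refine ⟨δ, hδ, fun p hp w hw => ?_⟩
  obtain ⟨i, hi⟩ := h p hp
  exact hU i p (hi (Metric.mem_ball_self hδ)) w (hi hw)

/-- A family of curves depending on a parameter in a Lipschitz way. -/
structure IsFamily (Y : ℝ → ℝ → E) (T C s₀ : ℝ) : Prop where
  C_pos : 0 < C
  continuousOn : ContinuousOn (Y s₀) (Icc 0 T)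
  lipschitz : ∀ᶠ s in 𝓝 s₀, ∀ t ∈ Icc 0 T, ‖Y s t - Y s₀ t‖ ≤ C * |s - s₀|

namespace IsFamily

variable {Y : ℝ → ℝ → E} {J : ℝ → E} {T C s₀ : ℝ}

theorem isCompact_graph {E : Type*} [NormedAddCommGroup E] {Y : ℝ → ℝ → E}
    (h : IsFamily Y T C s₀) :
    IsCompact ((fun t => (t, Y s₀ t)) '' Icc 0 T) :=
  isCompact_Icc.image_of_continuousOn (continuousOn_id.prodMk h.continuousOn)

theorem eventually_diff (h : IsFamily Y T C s₀) {H : ℝ × E → G}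
    (hH : ∀ t ∈ Icc 0 T, ContDiffAt ℝ 1 H (t, Y s₀ t)) {ε : ℝ} (hε : 0 < ε) :
    ∀ᶠ s in 𝓝 s₀, ∀ t ∈ Icc 0 T,
      ‖H (t, Y s t) - H (t, Y s₀ t) - fderiv ℝ H (t, Y s₀ t) (0, Y s t - Y s₀ t)‖ ≤
        ε * |s - s₀| := by
  obtain ⟨δ, hδ, hd⟩ := uniform_diff h.isCompact_graph (H := H)
    (by rintro _ ⟨t, ht, rfl⟩; exact hH t ht) (div_pos hε h.C_pos)
  have h2 : ∀ᶠ s in 𝓝 s₀, dist s s₀ < δ / C := Metric.ball_mem_nhds _ (div_pos hδ h.C_pos)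
  filter_upwards [h.lipschitz, h2] with s hs hs2 t ht
  rw [dist_eq, lt_div_iff₀ h.C_pos] at hs2
  have hw : ((t, Y s t) : ℝ × E) - (t, Y s₀ t) = (0, Y s t - Y s₀ t) := by simp
  have hn : ‖((t, Y s t) : ℝ × E) - (t, Y s₀ t)‖ = ‖Y s t - Y s₀ t‖ := by
    rw [hw, Prod.norm_mk, norm_zero, max_eq_right (norm_nonneg _)]
  have h3 := hd _ (mem_image_of_mem _ ht) (t, Y s t)
    (by rw [dist_eq_norm, hn]; linarith [hs t ht])
  rw [hn, hw] at h3
  refine h3.trans ((mul_le_mul_of_nonneg_left (hs t ht) (div_pos hε h.C_pos).le).trans_eq ?_)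
  have := h.C_pos.ne'
  field_simp

theorem exists_fderiv_bound (h : IsFamily Y T C s₀) {H : ℝ × E → G}
    (hH : ∀ t ∈ Icc 0 T, ContDiffAt ℝ 1 H (t, Y s₀ t)) :
    ∃ D > 0, ∀ t ∈ Icc 0 T, ∀ v : E, ‖fderiv ℝ H (t, Y s₀ t) (0, v)‖ ≤ D * ‖v‖ := by
  obtain ⟨D, hD⟩ := h.isCompact_graph.exists_bound_of_continuousOn (f := fderiv ℝ H)
    (by rintro _ ⟨t, ht, rfl⟩
        exact ((hH t ht).continuousAt_fderiv one_ne_zero).continuousWithinAt)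
  refine ⟨|D| + 1, by positivity, fun t ht v => ?_⟩
  refine (ContinuousLinearMap.le_opNorm _ _).trans ?_
  rw [Prod.norm_mk, norm_zero, max_eq_right (norm_nonneg _)]
  gcongr
  linarith [hD _ (mem_image_of_mem _ ht), le_abs_self D]

/-- Differentiability of the solutions of an ordinary differential equation with respect to a
parameter. -/
theorem eventually_expansion (h : IsFamily Y T C s₀) {F : ℝ × E → E}
    (hF : ∀ t ∈ Icc 0 T, ContDiffAt ℝ 1 F (t, Y s₀ t))
    (hY : ∀ᶠ s in 𝓝 s₀, ∀ t ∈ Icc 0 T, HasDerivAt (Y s) (F (t, Y s t)) t)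
    (hJ : ∀ t ∈ Icc 0 T, HasDerivAt J (fderiv ℝ F (t, Y s₀ t) (0, J t)) t)
    (h0 : ∀ᶠ s in 𝓝 s₀, Y s 0 - Y s₀ 0 = (s - s₀) • J 0) {ε : ℝ} (hε : 0 < ε) :
    ∀ᶠ s in 𝓝 s₀, ∀ t ∈ Icc 0 T, ‖Y s t - Y s₀ t - (s - s₀) • J t‖ ≤ ε * |s - s₀| := by
  obtain ⟨D, hD0, hD⟩ := h.exists_fderiv_bound hF
  set ε' := ε * D / exp (D * T) with hε'
  have hε'0 : 0 < ε' := by positivity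
  filter_upwards [h.eventually_diff hF hε'0, hY, h0] with s hs hYs hs0 t ht
  have hg := norm_le_gronwallBound_of_norm_deriv_right_le
    (f := fun t => Y s t - Y s₀ t - (s - s₀) • J t) (a := 0) (b := T) (δ := 0) (K := D)
    (ε := ε' * |s - s₀|)
    (f' := fun t => F (t, Y s t) - F (t, Y s₀ t) - (s - s₀) • fderiv ℝ F (t, Y s₀ t) (0, J t))
    (fun t ht => (((hYs t ht).sub (hY.self_of_nhds t ht)).sub
      ((hJ t ht).const_smul _)).continuousAt.continuousWithinAt)
    (fun t ht => (((hYs t (Ico_subset_Icc_self ht)).sub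
      (hY.self_of_nhds t (Ico_subset_Icc_self ht))).sub
      ((hJ t (Ico_subset_Icc_self ht)).const_smul _)).hasDerivWithinAt)
    (by simp [hs0])
    (fun t ht => by
      have ht := Ico_subset_Icc_self ht
      have e : F (t, Y s t) - F (t, Y s₀ t) - (s - s₀) • fderiv ℝ F (t, Y s₀ t) (0, J t) =
          fderiv ℝ F (t, Y s₀ t) (0, Y s t - Y s₀ t - (s - s₀) • J t) +
          (F (t, Y s t) - F (t, Y s₀ t) - fderiv ℝ F (t, Y s₀ t) (0, Y s t - Y s₀ t)) := by
        have : ((0, Y s t - Y s₀ t - (s - s₀) • J t) : ℝ × E) =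
          (0, Y s t - Y s₀ t) - (s - s₀) • (0, J t) := by simp
        rw [this, map_sub, map_smul]; abel
      rw [e]
      exact (norm_add_le _ _).trans (add_le_add (hD t ht _) (hs t ht))) t ht
  refine hg.trans ?_
  rw [gronwallBound_of_K_ne_0 hD0.ne', sub_zero]
  simp only [zero_mul, zero_add]
  have h1 : exp (D * t) - 1 ≤ exp (D * T) := by
    have : exp (D * t) ≤ exp (D * T) := exp_le_exp.2 (mul_le_mul_of_nonneg_left ht.2 hD0.le)
    linarith
  calc ε' * |s - s₀| / D * (exp (D * t) - 1) ≤ ε' * |s - s₀| / D * exp (D * T) := by gcongr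
    _ = ε * |s - s₀| := by rw [hε']; field_simp

theorem hasDerivAt_of_expansion {t : ℝ}
    (he : ∀ ε > 0, ∀ᶠ s in 𝓝 s₀, ‖Y s t - Y s₀ t - (s - s₀) • J t‖ ≤ ε * |s - s₀|) :
    HasDerivAt (fun s => Y s t) (J t) s₀ := by
  rw [hasDerivAt_iff_isLittleO]
  exact Asymptotics.isLittleO_iff.2 fun ε hε => he ε hε

theorem hasDerivAt_integral (h : IsFamily Y T C s₀) (hT : 0 ≤ T) {H : ℝ × E → ℝ}
    (hH : ∀ t ∈ Icc 0 T, ContDiffAt ℝ 1 H (t, Y s₀ t)) (hJ : ContinuousOn J (Icc 0 T))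
    (hc : ∀ᶠ s in 𝓝 s₀, ContinuousOn (fun t => H (t, Y s t)) (Icc 0 T))
    (he : ∀ ε > 0, ∀ᶠ s in 𝓝 s₀, ∀ t ∈ Icc 0 T,
      ‖Y s t - Y s₀ t - (s - s₀) • J t‖ ≤ ε * |s - s₀|) :
    HasDerivAt (fun s => ∫ t in (0 : ℝ)..T, H (t, Y s t))
      (∫ t in (0 : ℝ)..T, fderiv ℝ H (t, Y s₀ t) (0, J t)) s₀ := by
  obtain ⟨D, hD0, hD⟩ := h.exists_fderiv_bound hH
  rw [hasDerivAt_iff_isLittleO, Asymptotics.isLittleO_iff]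
  intro ε hε
  have hε1 : 0 < ε / (2 * (T + 1)) := by positivity
  have hε2 : 0 < ε / (2 * (T + 1) * D) := by positivity
  have hI : ContinuousOn (fun t => fderiv ℝ H (t, Y s₀ t) (0, J t)) (Icc 0 T) := by
    refine ContinuousOn.clm_apply (fun t ht => ?_) (continuousOn_const.prodMk hJ)
    exact ContinuousAt.comp_continuousWithinAt (g := fderiv ℝ H) (f := fun t => (t, Y s₀ t))
      ((hH t ht).continuousAt_fderiv one_ne_zero)
      (continuousWithinAt_id.prodMk (h.continuousOn t ht))
  filter_upwards [h.eventually_diff hH hε1, he _ hε2, hc] with s h1 h2 h3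
  have u : uIcc 0 T = Icc 0 T := uIcc_of_le hT
  have i1 := (u ▸ h3).intervalIntegrable (μ := volume)
  have i2 := (u ▸ hc.self_of_nhds).intervalIntegrable (μ := volume)
  have i3 := (u ▸ hI).intervalIntegrable (μ := volume)
  rw [smul_eq_mul, ← intervalIntegral.integral_sub i1 i2, ← intervalIntegral.integral_const_mul,
    ← intervalIntegral.integral_sub (i1.sub i2) (i3.const_mul _)]
  have hb := intervalIntegral.norm_integral_le_of_norm_le_const (a := 0) (b := T)
    (C := ε / (T + 1) * |s - s₀|)
    (f := fun t => H (t, Y s t) - H (t, Y s₀ t) - (s - s₀) * fderiv ℝ H (t, Y s₀ t) (0, J t))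
    (fun t ht => by
      rw [uIoc_of_le hT] at ht
      have ht := Ioc_subset_Icc_self ht
      have e : H (t, Y s t) - H (t, Y s₀ t) - (s - s₀) * fderiv ℝ H (t, Y s₀ t) (0, J t) =
          fderiv ℝ H (t, Y s₀ t) (0, Y s t - Y s₀ t - (s - s₀) • J t) +
          (H (t, Y s t) - H (t, Y s₀ t) - fderiv ℝ H (t, Y s₀ t) (0, Y s t - Y s₀ t)) := by
        have : ((0, Y s t - Y s₀ t - (s - s₀) • J t) : ℝ × E) =
          (0, Y s t - Y s₀ t) - (s - s₀) • (0, J t) := by simp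
        rw [this, map_sub, map_smul, smul_eq_mul]; ring
      rw [e]
      refine (norm_add_le _ _).trans ((add_le_add ((hD t ht _).trans
        (mul_le_mul_of_nonneg_left (h2 t ht) hD0.le)) (h1 t ht)).trans_eq ?_)
      field_simp
      ring)
  refine hb.trans ?_
  rw [sub_zero, abs_of_nonneg hT, norm_eq_abs]
  have : T / (T + 1) ≤ 1 := by rw [div_le_one (by linarith)]; linarith
  calc ε / (T + 1) * |s - s₀| * T = ε * |s - s₀| * (T / (T + 1)) := by ring
    _ ≤ ε * |s - s₀| * 1 := by gcongr
    _ = _ := mul_one _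

end IsFamily

end

section

/-! ### The truncated flow -/

/-- The position truncated away from zero, on the side given by the sign `σ`. -/
noncomputable def cutQ (σ δ q : ℝ) : ℝ := σ * max (σ * q) δ

/-- The curvature truncated away from zero. -/
noncomputable def cutCurv (N σ δ θ x q : ℝ) : ℝ := max δ (curv N θ x (cutQ σ δ q))

/-- The truncated geodesic field. -/
noncomputable def cutField (N σ δ θ : ℝ) (y : ℝ × ℝ) : ℝ × ℝ :=
  (cos θ / cutCurv N σ δ θ y.1 y.2, sin θ / cutCurv N σ δ θ y.1 y.2)

/-- `Y` is a trajectory of the truncated flow starting at `(0, a)`. -/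
structure IsCutFlow (N σ δ a : ℝ) (Y : ℝ → ℝ × ℝ) : Prop where
  zero : Y 0 = (0, a)
  hasDerivAt : ∀ θ ∈ Icc 0 (π / 2), HasDerivAt Y (cutField N σ δ θ (Y θ)) θ

/-- The trajectory of the truncated flow starting at `(0, a)`. -/
noncomputable def cutFlow (N σ δ a : ℝ) : ℝ → ℝ × ℝ := Classical.epsilon (IsCutFlow N σ δ a)

theorem le_cutCurv (N σ δ θ x q : ℝ) : δ ≤ cutCurv N σ δ θ x q := le_max_left _ _

theorem cutQ_eq_self {σ δ q : ℝ} (hσ : σ ^ 2 = 1) (h : δ ≤ σ * q) : cutQ σ δ q = q := by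
  rw [cutQ, max_eq_left h]; linear_combination q * hσ

theorem cutCurv_eq_of_lt {N σ δ θ x q : ℝ} (hσ : σ ^ 2 = 1) (h : δ ≤ σ * q)
    (hk : δ ≤ curv N θ x q) : cutCurv N σ δ θ x q = curv N θ x q := by
  rw [cutCurv, cutQ_eq_self hσ h, max_eq_right hk]

variable {N σ δ : ℝ}

theorem abs_sub_mc_le (hN : 0 ≤ N) (hσ : σ ^ 2 = 1) (hδ : 0 < δ) {p q : ℝ}
    (hp : δ ≤ σ * p) (hq : δ ≤ σ * q) :
    |mc N p - mc N q| ≤ (N / δ ^ 2 + 1 / 2) * |p - q| := by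
  have hpq : δ ^ 2 ≤ p * q := by
    have : δ * δ ≤ (σ * p) * (σ * q) := mul_le_mul hp hq hδ.le (hδ.le.trans hp)
    calc δ ^ 2 ≤ σ ^ 2 * (p * q) := by linarith
      _ = p * q := by rw [hσ, one_mul]
  have hpq0 : 0 < p * q := (pow_pos hδ 2).trans_le hpq
  have hp0 : p ≠ 0 := left_ne_zero_of_mul hpq0.ne'
  have hq0 : q ≠ 0 := right_ne_zero_of_mul hpq0.ne'
  have e : mc N p - mc N q = -(N / (p * q) + 1 / 2) * (p - q) := by
    unfold mc; field_simp; ring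
  rw [e, abs_mul, abs_neg, abs_of_nonneg (by positivity)]
  gcongr

theorem abs_sub_cutQ_le (hσ : σ ^ 2 = 1) (p q : ℝ) : |cutQ σ δ p - cutQ σ δ q| ≤ |p - q| := by
  have hs : |σ| = 1 := by
    have : |σ| ^ 2 = 1 := by rw [sq_abs, hσ]
    nlinarith [abs_nonneg σ]
  rw [cutQ, cutQ, ← mul_sub, abs_mul, hs, one_mul]
  refine (abs_max_sub_max_le_max _ _ _ _).trans ?_
  rw [← mul_sub, abs_mul, hs, sub_self, abs_zero, one_mul, max_eq_left (abs_nonneg _)]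

theorem le_mul_cutQ (hσ : σ ^ 2 = 1) (q : ℝ) : δ ≤ σ * cutQ σ δ q := by
  rw [cutQ, ← mul_assoc, ← sq, hσ, one_mul]; exact le_max_right _ _

theorem abs_sub_cutCurv_le (hN : 0 ≤ N) (hσ : σ ^ 2 = 1) (hδ : 0 < δ) (θ : ℝ) (y z : ℝ × ℝ) :
    |cutCurv N σ δ θ y.1 y.2 - cutCurv N σ δ θ z.1 z.2| ≤ (N / δ ^ 2 + 1) * dist y z := by
  have h1 : |y.1 - z.1| ≤ dist y z := by rw [← dist_eq]; exact le_max_left _ _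
  have h2 : |y.2 - z.2| ≤ dist y z := by rw [← dist_eq]; exact le_max_right _ _
  have h3 := abs_sub_mc_le hN hσ hδ (le_mul_cutQ (δ := δ) hσ y.2) (le_mul_cutQ (δ := δ) hσ z.2)
  have h4 := h3.trans (mul_le_mul_of_nonneg_left ((abs_sub_cutQ_le hσ _ _).trans h2)
    (by positivity))
  refine (abs_max_sub_max_le_max _ _ _ _).trans ?_
  rw [sub_self, abs_zero, max_eq_right (abs_nonneg _)]
  have e : curv N θ y.1 (cutQ σ δ y.2) - curv N θ z.1 (cutQ σ δ z.2) =
      (mc N (cutQ σ δ y.2) - mc N (cutQ σ δ z.2)) * cos θ + (y.1 - z.1) * sin θ / 2 := by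
    unfold curv; ring
  rw [e]
  refine (abs_add_le _ _).trans ?_
  rw [abs_mul, abs_div, abs_mul, abs_two]
  have h5 := mul_le_mul h4 (abs_cos_le_one θ) (abs_nonneg _) (by positivity)
  have h6 := mul_le_mul h1 (abs_sin_le_one θ) (abs_nonneg _) dist_nonneg
  linarith

theorem lipschitzWith_cutField (hN : 0 ≤ N) (hσ : σ ^ 2 = 1) (hδ : 0 < δ) (θ : ℝ) :
    LipschitzWith (((N / δ ^ 2 + 1) / δ ^ 2).toNNReal) (cutField N σ δ θ) := by
  refine LipschitzWith.of_dist_le_mul fun y z => ?_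
  rw [coe_toNNReal _ (by positivity)]
  have h := abs_sub_cutCurv_le hN hσ hδ θ y z
  have hy := le_cutCurv N σ δ θ y.1 y.2
  have hz := le_cutCurv N σ δ θ z.1 z.2
  set k := cutCurv N σ δ θ y.1 y.2 with hk
  set l := cutCurv N σ δ θ z.1 z.2 with hl
  have hkl : δ ^ 2 ≤ k * l := by nlinarith
  have key (c : ℝ) (hc : |c| ≤ 1) : |c / k - c / l| ≤ (N / δ ^ 2 + 1) / δ ^ 2 * dist y z := by
    have hk0 : k ≠ 0 := (hδ.trans_le hy).ne'
    have hl0 : l ≠ 0 := (hδ.trans_le hz).ne'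
    have e : c / k - c / l = c * (-(k - l)) / (k * l) := by field_simp; ring
    rw [e, abs_div, abs_mul, abs_neg, abs_of_nonneg ((sq_nonneg δ).trans hkl)]
    calc |c| * |k - l| / (k * l) ≤ 1 * ((N / δ ^ 2 + 1) * dist y z) / δ ^ 2 := by gcongr
      _ = _ := by ring
  exact max_le (key _ (abs_cos_le_one θ)) (key _ (abs_sin_le_one θ))

theorem continuous_cutField (hδ : 0 < δ) (y : ℝ × ℝ) :
    Continuous fun θ => cutField N σ δ θ y := by
  have hk : Continuous fun θ => cutCurv N σ δ θ y.1 y.2 := by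
    unfold cutCurv curv; fun_prop
  exact (continuous_cos.div hk fun θ => (hδ.trans_le (le_cutCurv _ _ _ _ _ _)).ne').prodMk
    (continuous_sin.div hk fun θ => (hδ.trans_le (le_cutCurv _ _ _ _ _ _)).ne')

theorem isCutFlow_cutFlow (hN : 0 ≤ N) (hσ : σ ^ 2 = 1) (hδ : 0 < δ) (a : ℝ) :
    IsCutFlow N σ δ a (cutFlow N σ δ a) := by
  obtain ⟨Y, h0, h⟩ := exists_solution (lipschitzWith_cutField hN hσ hδ)
    (continuous_cutField hδ) (0, a)
  exact Classical.epsilon_spec (p := IsCutFlow N σ δ a) ⟨Y, h0, h⟩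

namespace IsCutFlow

variable {a a' : ℝ} {Y Z : ℝ → ℝ × ℝ}

theorem continuousOn (h : IsCutFlow N σ δ a Y) : ContinuousOn Y (Icc 0 (π / 2)) :=
  fun _ ht => (h.hasDerivAt _ ht).continuousAt.continuousWithinAt

theorem hasDerivAt_fst (h : IsCutFlow N σ δ a Y) {θ : ℝ} (hθ : θ ∈ Icc 0 (π / 2)) :
    HasDerivAt (fun t => (Y t).1) (cos θ / cutCurv N σ δ θ (Y θ).1 (Y θ).2) θ :=
  (h.hasDerivAt θ hθ).fst

theorem hasDerivAt_snd (h : IsCutFlow N σ δ a Y) {θ : ℝ} (hθ : θ ∈ Icc 0 (π / 2)) :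
    HasDerivAt (fun t => (Y t).2) (sin θ / cutCurv N σ δ θ (Y θ).1 (Y θ).2) θ :=
  (h.hasDerivAt θ hθ).snd

theorem monotoneOn_fst (hδ : 0 < δ) (h : IsCutFlow N σ δ a Y) :
    MonotoneOn (fun t => (Y t).1) (Icc 0 (π / 2)) := by
  refine monotoneOn_of_deriv_nonneg (convex_Icc _ _)
    (fun t ht => (h.hasDerivAt_fst ht).continuousAt.continuousWithinAt)
    (fun t ht => (h.hasDerivAt_fst (interior_subset ht)).differentiableAt.differentiableWithinAt)
    fun t ht => ?_
  have ht := interior_subset ht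
  rw [(h.hasDerivAt_fst ht).deriv]
  exact div_nonneg (cos_nonneg_of_mem_Icc ⟨by linarith [ht.1, pi_pos], ht.2⟩)
    (hδ.le.trans (le_cutCurv _ _ _ _ _ _))

theorem monotoneOn_snd (hδ : 0 < δ) (h : IsCutFlow N σ δ a Y) :
    MonotoneOn (fun t => (Y t).2) (Icc 0 (π / 2)) := by
  refine monotoneOn_of_deriv_nonneg (convex_Icc _ _)
    (fun t ht => (h.hasDerivAt_snd ht).continuousAt.continuousWithinAt)
    (fun t ht => (h.hasDerivAt_snd (interior_subset ht)).differentiableAt.differentiableWithinAt)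
    fun t ht => ?_
  have ht := interior_subset ht
  rw [(h.hasDerivAt_snd ht).deriv]
  exact div_nonneg (sin_nonneg_of_nonneg_of_le_pi ht.1 (by linarith [ht.2, pi_pos]))
    (hδ.le.trans (le_cutCurv _ _ _ _ _ _))

theorem dist_le (hN : 0 ≤ N) (hσ : σ ^ 2 = 1) (hδ : 0 < δ) (h : IsCutFlow N σ δ a Y)
    (h' : IsCutFlow N σ δ a' Z) {θ : ℝ} (hθ : θ ∈ Icc 0 (π / 2)) :
    dist (Y θ) (Z θ) ≤ exp ((N / δ ^ 2 + 1) / δ ^ 2 * (π / 2)) * |a - a'| := by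
  have := dist_le_of_trajectories_ODE (lipschitzWith_cutField hN hσ hδ) h.continuousOn
    (fun t ht => (h.hasDerivAt t (Ico_subset_Icc_self ht)).hasDerivWithinAt) h'.continuousOn
    (fun t ht => (h'.hasDerivAt t (Ico_subset_Icc_self ht)).hasDerivWithinAt) le_rfl θ hθ
  refine this.trans ?_
  have e : dist (Y 0) (Z 0) = |a - a'| := by
    rw [h.zero, h'.zero, Prod.dist_eq, dist_self, dist_eq, max_eq_right (abs_nonneg _)]
  rw [e, mul_comm, coe_toNNReal _ (by positivity)]
  gcongr
  linarith [hθ.2]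

end IsCutFlow

theorem continuous_cutFlow (hN : 0 ≤ N) (hσ : σ ^ 2 = 1) (hδ : 0 < δ) {θ : ℝ}
    (hθ : θ ∈ Icc 0 (π / 2)) : Continuous fun a => cutFlow N σ δ a θ := by
  have : LipschitzWith (exp ((N / δ ^ 2 + 1) / δ ^ 2 * (π / 2))).toNNReal
      fun a => cutFlow N σ δ a θ := by
    refine LipschitzWith.of_dist_le_mul fun a a' => ?_
    rw [coe_toNNReal _ (exp_pos _).le, dist_eq a]
    exact (isCutFlow_cutFlow hN hσ hδ a).dist_le hN hσ hδ (isCutFlow_cutFlow hN hσ hδ a') hθ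
  exact this.continuous

end

section

/-! ### Dependence of the arcs on the initial position -/

/-- The geodesic field for the parametrisation by the tangent angle. -/
noncomputable def field (N : ℝ) (p : ℝ × ℝ × ℝ) : ℝ × ℝ :=
  (cos p.1 / curv N p.1 p.2.1 p.2.2, sin p.1 / curv N p.1 p.2.1 p.2.2)

/-- A full quarter-turn trajectory of the geodesic field starting at `(0, a)`. -/
structure IsSol (N a : ℝ) (Y : ℝ → ℝ × ℝ) : Prop where
  zero : Y 0 = (0, a)
  same_sign : ∀ θ ∈ Icc 0 (π / 2), 0 < a * (Y θ).2
  curv_pos : ∀ θ ∈ Icc 0 (π / 2), 0 < curv N θ (Y θ).1 (Y θ).2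
  hasDerivAt : ∀ θ ∈ Icc 0 (π / 2), HasDerivAt Y (field N (θ, Y θ)) θ

/-- The full quarter-turn trajectory of the geodesic field starting at `(0, a)`, if it exists. -/
noncomputable def sol (N a : ℝ) : ℝ → ℝ × ℝ := Classical.epsilon (IsSol N a)

/-- The length density of a trajectory with respect to the tangent angle. -/
noncomputable def dens (N : ℝ) (p : ℝ × ℝ × ℝ) : ℝ :=
  wt N p.2.1 p.2.2 / curv N p.1 p.2.1 p.2.2

/-- The length of the quarter-turn trajectory starting at `(0, a)`. -/
noncomputable def len (N a : ℝ) : ℝ := ∫ θ in (0 : ℝ)..π / 2, dens N (θ, sol N a θ)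

variable {N a σ δ : ℝ} {Y Z : ℝ → ℝ × ℝ}

theorem zero_mem_quarter : (0 : ℝ) ∈ Icc 0 (π / 2) := ⟨le_rfl, by positivity⟩

theorem pi_div_two_mem_quarter : π / 2 ∈ Icc 0 (π / 2) := ⟨by positivity, le_rfl⟩

theorem isSol_sol (h : ∃ Y, IsSol N a Y) : IsSol N a (sol N a) := Classical.epsilon_spec h

theorem continuousOn_curv_of_ne {x q : ℝ → ℝ} {S : Set ℝ} (hx : ContinuousOn x S)
    (hq : ContinuousOn q S) (h0 : ∀ θ ∈ S, q θ ≠ 0) :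
    ContinuousOn (fun θ => curv N θ (x θ) (q θ)) S := by
  unfold curv mc
  exact (((continuousOn_const.div hq h0).sub (hq.div_const 2)).mul continuous_cos.continuousOn).add
    ((hx.mul continuous_sin.continuousOn).div_const 2)

theorem IsCutFlow.isSol (hσ : σ ^ 2 = 1) (hδ : 0 < δ) (h : IsCutFlow N σ δ a Y)
    (hq : ∀ θ ∈ Icc 0 (π / 2), δ ≤ σ * (Y θ).2)
    (hk : ∀ θ ∈ Icc 0 (π / 2), δ ≤ curv N θ (Y θ).1 (Y θ).2) : IsSol N a Y where
  zero := h.zero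
  same_sign θ hθ := by
    have h0 := hq 0 zero_mem_quarter
    rw [h.zero] at h0
    have : 0 < (σ * a) * (σ * (Y θ).2) := mul_pos (hδ.trans_le h0) (hδ.trans_le (hq θ hθ))
    linear_combination this + a * (Y θ).2 * hσ
  curv_pos θ hθ := hδ.trans_le (hk θ hθ)
  hasDerivAt θ hθ := by
    have := h.hasDerivAt θ hθ
    rwa [cutField, cutCurv_eq_of_lt hσ (hq θ hθ) (hk θ hθ)] at this

namespace IsSol

theorem isCutFlow (h : IsSol N a Y) (hσ : σ ^ 2 = 1)
    (hq : ∀ θ ∈ Icc 0 (π / 2), δ ≤ σ * (Y θ).2)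
    (hk : ∀ θ ∈ Icc 0 (π / 2), δ ≤ curv N θ (Y θ).1 (Y θ).2) : IsCutFlow N σ δ a Y where
  zero := h.zero
  hasDerivAt θ hθ := by
    rw [cutField, cutCurv_eq_of_lt hσ (hq θ hθ) (hk θ hθ)]
    exact h.hasDerivAt θ hθ

theorem continuousOn (h : IsSol N a Y) : ContinuousOn Y (Icc 0 (π / 2)) :=
  fun _ ht => (h.hasDerivAt _ ht).continuousAt.continuousWithinAt

theorem ne_zero (h : IsSol N a Y) {θ : ℝ} (hθ : θ ∈ Icc 0 (π / 2)) : (Y θ).2 ≠ 0 :=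
  right_ne_zero_of_mul (h.same_sign θ hθ).ne'

theorem continuousOn_curv (h : IsSol N a Y) :
    ContinuousOn (fun θ => curv N θ (Y θ).1 (Y θ).2) (Icc 0 (π / 2)) :=
  continuousOn_curv_of_ne (continuous_fst.comp_continuousOn h.continuousOn)
    (continuous_snd.comp_continuousOn h.continuousOn) fun _ => h.ne_zero

theorem exists_delta (h : IsSol N a Y) (hσ : σ ^ 2 = 1) (hσa : 0 < σ * a) :
    ∃ δ > 0, ∀ θ ∈ Icc 0 (π / 2), δ ≤ σ * (Y θ).2 ∧ δ ≤ curv N θ (Y θ).1 (Y θ).2 := by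
  have hne : (Icc 0 (π / 2)).Nonempty := ⟨0, zero_mem_quarter⟩
  obtain ⟨t, ht, h1⟩ := isCompact_Icc.exists_isMinOn hne h.continuousOn_curv
  obtain ⟨s, hs, h2⟩ := isCompact_Icc.exists_isMinOn hne
    ((continuousOn_const (c := σ)).mul (continuous_snd.comp_continuousOn h.continuousOn))
  refine ⟨min (σ * (Y s).2) (curv N t (Y t).1 (Y t).2), lt_min ?_ (h.curv_pos t ht),
    fun θ hθ => ⟨(min_le_left _ _).trans (h2 hθ), (min_le_right _ _).trans (h1 hθ)⟩⟩
  have h3 : 0 < (σ * a) * (σ * (Y s).2) := by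
    have := h.same_sign s hs
    linear_combination this - a * (Y s).2 * hσ
  exact (mul_pos_iff_of_pos_left hσa).1 h3

theorem a_ne (h : IsSol N a Y) : a ≠ 0 := left_ne_zero_of_mul (h.same_sign 0 zero_mem_quarter).ne'

theorem exists_sign (h : a ≠ 0) : ∃ σ : ℝ, σ ^ 2 = 1 ∧ 0 < σ * a := by
  rcases lt_or_gt_of_ne h with h | h
  · exact ⟨-1, by norm_num, by linarith⟩
  · exact ⟨1, by norm_num, by linarith⟩

theorem eqOn (hN : 0 ≤ N) (h : IsSol N a Y) (h' : IsSol N a Z) : EqOn Y Z (Icc 0 (π / 2)) := by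
  obtain ⟨σ, hσ, hσa⟩ := exists_sign h.a_ne
  obtain ⟨δ, hδ, h1⟩ := h.exists_delta hσ hσa
  obtain ⟨δ', hδ', h2⟩ := h'.exists_delta hσ hσa
  have c1 := h.isCutFlow (δ := min δ δ') hσ (fun θ hθ => (min_le_left _ _).trans (h1 θ hθ).1)
    fun θ hθ => (min_le_left _ _).trans (h1 θ hθ).2
  have c2 := h'.isCutFlow (δ := min δ δ') hσ (fun θ hθ => (min_le_right _ _).trans (h2 θ hθ).1)
    fun θ hθ => (min_le_right _ _).trans (h2 θ hθ).2
  intro θ hθ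
  have := c1.dist_le hN hσ (lt_min hδ hδ') c2 hθ
  rw [sub_self, abs_zero, mul_zero] at this
  exact dist_le_zero.1 this

theorem eqOn_sol (hN : 0 ≤ N) (h : IsSol N a Y) : EqOn (sol N a) Y (Icc 0 (π / 2)) :=
  (isSol_sol ⟨Y, h⟩).eqOn hN h

theorem exists_cutFlow (hN : 0 ≤ N) (h : IsSol N a Y) : ∃ σ δ : ℝ, σ ^ 2 = 1 ∧ 0 < δ ∧
    ∀ᶠ s in 𝓝 a, IsSol N s (cutFlow N σ δ s) := by
  obtain ⟨σ, hσ, hσa⟩ := exists_sign h.a_ne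
  obtain ⟨δ, hδ, h1⟩ := h.exists_delta hσ hσa
  have hδ2 := half_pos hδ
  refine ⟨σ, δ / 2, hσ, hδ2, ?_⟩
  have c := h.isCutFlow (δ := δ / 2) hσ (fun θ hθ => by linarith [h1 θ hθ])
    fun θ hθ => by linarith [h1 θ hθ]
  set C := exp ((N / (δ / 2) ^ 2 + 1) / (δ / 2) ^ 2 * (π / 2)) with hC
  have hd (s : ℝ) {θ : ℝ} (hθ : θ ∈ Icc 0 (π / 2)) :=
    (isCutFlow_cutFlow hN hσ hδ2 s).dist_le hN hσ hδ2 c hθ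
  have e1 : ∀ᶠ s in 𝓝 a, C * |s - a| < δ / 2 := by
    have : ContinuousAt (fun s => C * |s - a|) a := by fun_prop
    exact this.eventually (gt_mem_nhds (by simpa using hδ2))
  have e2 : ∀ᶠ s in 𝓝 a, (N / (δ / 2) ^ 2 + 1) * (C * |s - a|) < δ / 2 := by
    have : ContinuousAt (fun s => (N / (δ / 2) ^ 2 + 1) * (C * |s - a|)) a := by fun_prop
    exact this.eventually (gt_mem_nhds (by simpa using hδ2))
  filter_upwards [e1, e2] with s hs1 hs2
  have hq : ∀ θ ∈ Icc 0 (π / 2), δ / 2 ≤ σ * (cutFlow N σ (δ / 2) s θ).2 := by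
    intro θ hθ
    have h3 : |σ * (cutFlow N σ (δ / 2) s θ).2 - σ * (Y θ).2| ≤ C * |s - a| := by
      have hs : |σ| = 1 := by
        have : |σ| ^ 2 = 1 := by rw [sq_abs, hσ]
        nlinarith [abs_nonneg σ]
      rw [← mul_sub, abs_mul, hs, one_mul, ← dist_eq]
      exact (le_max_right _ _).trans (hd s hθ)
    linarith [(abs_le.1 h3).1, h1 θ hθ]
  refine (isCutFlow_cutFlow hN hσ hδ2 s).isSol hσ hδ2 hq fun θ hθ => ?_
  have h3 := (abs_le.1 (abs_sub_cutCurv_le hN hσ hδ2 θ (cutFlow N σ (δ / 2) s θ) (Y θ))).1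
  have h4 : (N / (δ / 2) ^ 2 + 1) * dist (cutFlow N σ (δ / 2) s θ) (Y θ) ≤
    (N / (δ / 2) ^ 2 + 1) * (C * |s - a|) := by gcongr; exact hd s hθ
  rw [cutCurv_eq_of_lt (q := (Y θ).2) hσ (by linarith [h1 θ hθ]) (by linarith [h1 θ hθ])] at h3
  have h5 : δ / 2 < cutCurv N σ (δ / 2) θ (cutFlow N σ (δ / 2) s θ).1
    (cutFlow N σ (δ / 2) s θ).2 := by linarith [h1 θ hθ]
  rw [cutCurv, lt_max_iff, cutQ_eq_self hσ (hq θ hθ)] at h5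
  exact (h5.resolve_left (lt_irrefl _)).le

theorem exists_isJacobi (hN : 0 ≤ N) (h : IsSol N a Y) :
    ∃ ξ η, IsJacobi N (fun t => (Y t).1) (fun t => (Y t).2) ξ η := by
  have hpi : (0 : ℝ) ≤ π / 2 := zero_mem_quarter.2
  set p : ℝ → ℝ := fun t => projIcc 0 (π / 2) hpi t with hp
  have hpc : Continuous p := continuous_subtype_val.comp continuous_projIcc
  have hpm (t : ℝ) : p t ∈ Icc 0 (π / 2) := (projIcc 0 (π / 2) hpi t).2
  have hYc : Continuous fun t => Y (p t) := h.continuousOn.comp_continuous hpc hpm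
  set k : ℝ → ℝ := fun t => curv N (p t) (Y (p t)).1 (Y (p t)).2 with hk
  have hkc : Continuous k := h.continuousOn_curv.comp_continuous hpc hpm
  have hk0 (t : ℝ) : 0 < k t := h.curv_pos _ (hpm t)
  have hq0 (t : ℝ) : (Y (p t)).2 ≠ 0 := h.ne_zero (hpm t)
  set l : ℝ → ℝ := fun t => 1 / 2 + N / (Y (p t)).2 ^ 2 with hl
  have hlc : Continuous l := by
    exact continuous_const.add
      (continuous_const.div (hYc.snd.pow 2) fun t => pow_ne_zero 2 (hq0 t))
  have hl0 (t : ℝ) : 0 ≤ l t := by positivity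
  obtain ⟨M, hM⟩ := isCompact_Icc.exists_bound_of_continuousOn (s := Icc (0 : ℝ) (π / 2))
    (f := fun t => (l t + 1 / 2) / k t ^ 2)
    ((hlc.add continuous_const).div (hkc.pow 2) fun t => (pow_pos (hk0 t) 2).ne').continuousOn
  have hpp (t : ℝ) : p (p t) = p t := by simp [hp, projIcc_val]
  have hM' (t : ℝ) : (l t + 1 / 2) / k t ^ 2 ≤ M := by
    have h1 := (le_abs_self _).trans (hM (p t) (hpm t))
    simpa only [hl, hk, hpp] using h1
  have hM0 : 0 ≤ M := (norm_nonneg _).trans (hM 0 zero_mem_quarter)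
  obtain ⟨J, hJ0, hJ⟩ := exists_solution (K := M.toNNReal) (y₀ := (0, 1))
    (f := fun t J => (-(cos (p t) * curvLin N (p t) (Y (p t)).2 J.1 J.2) / k t ^ 2,
      -(sin (p t) * curvLin N (p t) (Y (p t)).2 J.1 J.2) / k t ^ 2))
    (fun t => LipschitzWith.of_dist_le_mul fun y z => by
      have key (c : ℝ) (hc : |c| ≤ 1) :
          |-(c * curvLin N (p t) (Y (p t)).2 y.1 y.2) / k t ^ 2 -
            -(c * curvLin N (p t) (Y (p t)).2 z.1 z.2) / k t ^ 2| ≤ M * dist y z := by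
        have e : -(c * curvLin N (p t) (Y (p t)).2 y.1 y.2) / k t ^ 2 -
            -(c * curvLin N (p t) (Y (p t)).2 z.1 z.2) / k t ^ 2 =
            c * (l t * cos (p t) * (y.2 - z.2) - sin (p t) / 2 * (y.1 - z.1)) / k t ^ 2 := by
          simp only [curvLin, hl]; ring
        have h1 : |y.1 - z.1| ≤ dist y z := by rw [← dist_eq]; exact le_max_left _ _
        have h2 : |y.2 - z.2| ≤ dist y z := by rw [← dist_eq]; exact le_max_right _ _
        have h3 : |l t * cos (p t) * (y.2 - z.2) - sin (p t) / 2 * (y.1 - z.1)| ≤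
            (l t + 1 / 2) * dist y z := by
          refine (abs_sub _ _).trans ?_
          rw [abs_mul, abs_mul, abs_mul, abs_div, abs_two, abs_of_nonneg (hl0 t)]
          have h4 := mul_le_mul (mul_le_mul_of_nonneg_left (abs_cos_le_one (p t)) (hl0 t)) h2
            (abs_nonneg _) (by linarith [hl0 t])
          have h5 := mul_le_mul (abs_sin_le_one (p t)) h1 (abs_nonneg _) zero_le_one
          linarith
        rw [e, abs_div, abs_mul, abs_of_nonneg (sq_nonneg (k t))]
        calc _ ≤ 1 * ((l t + 1 / 2) * dist y z) / k t ^ 2 := by gcongr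
          _ = (l t + 1 / 2) / k t ^ 2 * dist y z := by ring
          _ ≤ _ := by gcongr; exact hM' t
      rw [coe_toNNReal _ hM0]
      exact max_le (key _ (abs_cos_le_one _)) (key _ (abs_sin_le_one _)))
    (fun y => by
      have hlin : Continuous fun t => curvLin N (p t) (Y (p t)).2 y.1 y.2 := by
        have : (fun t => curvLin N (p t) (Y (p t)).2 y.1 y.2) =
            fun t => -(l t) * cos (p t) * y.2 + sin (p t) / 2 * y.1 := rfl
        rw [this]
        fun_prop
      have hk2 : ∀ t, k t ^ 2 ≠ 0 := fun t => (pow_pos (hk0 t) 2).ne'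
      exact (((continuous_cos.comp hpc).mul hlin).neg.div (hkc.pow 2) hk2).prodMk
        (((continuous_sin.comp hpc).mul hlin).neg.div (hkc.pow 2) hk2))
  have hpt (t : ℝ) (ht : t ∈ Icc 0 (π / 2)) : p t = t := by simp [hp, projIcc_of_mem hpi ht]
  refine ⟨fun t => (J t).1, fun t => (J t).2, by simp [hJ0], by simp [hJ0], fun θ hθ => ?_,
    fun θ hθ => ?_⟩
  · have h1 := hJ θ hθ
    simp only [hk, hpt θ hθ] at h1
    exact h1.fst
  · have h1 := hJ θ hθ
    simp only [hk, hpt θ hθ] at h1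
    exact h1.snd

end IsSol

end

section

variable {N a σ δ : ℝ} {Y : ℝ → ℝ × ℝ}

theorem contDiffAt_curv {m : WithTop ℕ∞} {p : ℝ × ℝ × ℝ} (h : p.2.2 ≠ 0) :
    ContDiffAt ℝ m (fun p : ℝ × ℝ × ℝ => curv N p.1 p.2.1 p.2.2) p := by
  unfold curv mc
  have h1 : ContDiffAt ℝ m (fun p : ℝ × ℝ × ℝ => p.2.2) p := by fun_prop
  have h2 : ContDiffAt ℝ m (fun p : ℝ × ℝ × ℝ => N / p.2.2) p := contDiffAt_const.div h1 h
  fun_prop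

theorem contDiffAt_field {m : WithTop ℕ∞} {p : ℝ × ℝ × ℝ} (h : p.2.2 ≠ 0)
    (hk : curv N p.1 p.2.1 p.2.2 ≠ 0) :
    ContDiffAt ℝ m (field N) p := by
  have h1 : ContDiffAt ℝ m (fun p : ℝ × ℝ × ℝ => cos p.1) p := by fun_prop
  have h2 : ContDiffAt ℝ m (fun p : ℝ × ℝ × ℝ => sin p.1) p := by fun_prop
  exact (h1.div (contDiffAt_curv h) hk).prodMk (h2.div (contDiffAt_curv h) hk)

theorem contDiffAt_dens {m : WithTop ℕ∞} {p : ℝ × ℝ × ℝ} (h : p.2.2 ≠ 0)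
    (hk : curv N p.1 p.2.1 p.2.2 ≠ 0) :
    ContDiffAt ℝ m (dens N) p := by
  have h1 : ContDiffAt ℝ m (fun p : ℝ × ℝ × ℝ => p.2.2) p := by fun_prop
  have h2 : ContDiffAt ℝ m (fun p : ℝ × ℝ × ℝ => log p.2.2) p := h1.log h
  have h3 : ContDiffAt ℝ m (fun p : ℝ × ℝ × ℝ => wt N p.2.1 p.2.2) p := by
    unfold wt; fun_prop
  exact h3.div (contDiffAt_curv h) hk

theorem hasDerivAt_curv_line (N θ x ξ η : ℝ) {q : ℝ} (h : q ≠ 0) :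
    HasDerivAt (fun τ => curv N θ (x + τ * ξ) (q + τ * η)) (curvLin N θ q ξ η) 0 := by
  have hq : HasDerivAt (fun τ : ℝ => q + τ * η) η 0 := by
    simpa using ((hasDerivAt_id (0 : ℝ)).mul_const η).const_add q
  have hx : HasDerivAt (fun τ : ℝ => x + τ * ξ) ξ 0 := by
    simpa using ((hasDerivAt_id (0 : ℝ)).mul_const ξ).const_add x
  have h1 := (((((hasDerivAt_const (0 : ℝ) N).div hq (by simpa using h))).sub
    (hq.div_const 2)).mul_const (cos θ)).add ((hx.mul_const (sin θ)).div_const 2)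
  refine h1.congr_deriv ?_
  simp only [zero_mul, add_zero, curvLin]
  field_simp
  ring

theorem hasDerivAt_wt_comp (N : ℝ) {x q : ℝ → ℝ} {x' q' t : ℝ} (hx : HasDerivAt x x' t)
    (hq : HasDerivAt q q' t) (h : q t ≠ 0) :
    HasDerivAt (fun τ => wt N (x τ) (q τ))
      (wt N (x t) (q t) * (mc N (q t) * q' - x t / 2 * x')) t := by
  have h1 := (((hq.log h).const_mul N).sub (((hx.pow 2).add (hq.pow 2)).div_const 4)).exp
  refine h1.congr_deriv ?_
  have e : ((fun y => N * log (q y)) - fun y => (x ^ 2 + q ^ 2) y / 4) t =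
    N * log (q t) - (x t ^ 2 + q t ^ 2) / 4 := rfl
  rw [e, wt, mc]
  field_simp
  ring

theorem hasDerivAt_wt_line (N x ξ η : ℝ) {q : ℝ} (h : q ≠ 0) :
    HasDerivAt (fun τ => wt N (x + τ * ξ) (q + τ * η))
      (wt N x q * (mc N q * η - x / 2 * ξ)) 0 := by
  have hq : HasDerivAt (fun τ : ℝ => q + τ * η) η 0 := by
    simpa using ((hasDerivAt_id (0 : ℝ)).mul_const η).const_add q
  have hx : HasDerivAt (fun τ : ℝ => x + τ * ξ) ξ 0 := by
    simpa using ((hasDerivAt_id (0 : ℝ)).mul_const ξ).const_add x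
  simpa using hasDerivAt_wt_comp N hx hq (by simpa using h)

theorem fderiv_line {G : Type*} [NormedAddCommGroup G] [NormedSpace ℝ G] {H : ℝ × ℝ × ℝ → G}
    {p : ℝ × ℝ × ℝ} (hH : ContDiffAt ℝ 1 H p) {ξ η : ℝ} {H' : G}
    (h : HasDerivAt (fun τ : ℝ => H (p.1, p.2.1 + τ * ξ, p.2.2 + τ * η)) H' 0) :
    fderiv ℝ H p (0, (ξ, η)) = H' := by
  have h1 := (hH.differentiableAt one_ne_zero).hasFDerivAt.hasLineDerivAt ((0, (ξ, η)) : ℝ × ℝ × ℝ)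
  have h2 : HasDerivAt (fun τ : ℝ => H (p.1, p.2.1 + τ * ξ, p.2.2 + τ * η))
      (fderiv ℝ H p (0, (ξ, η))) 0 := by
    have e : (fun τ : ℝ => H (p.1, p.2.1 + τ * ξ, p.2.2 + τ * η)) =
        fun τ : ℝ => H (p + τ • ((0, (ξ, η)) : ℝ × ℝ × ℝ)) := by
      funext τ; congr 1; ext <;> simp
    rw [e]; exact h1
  exact h2.unique h

theorem fderiv_field {p : ℝ × ℝ × ℝ} (h : p.2.2 ≠ 0) (hk : curv N p.1 p.2.1 p.2.2 ≠ 0)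
    (ξ η : ℝ) : fderiv ℝ (field N) p (0, (ξ, η)) =
      (-(cos p.1 * curvLin N p.1 p.2.2 ξ η) / curv N p.1 p.2.1 p.2.2 ^ 2,
        -(sin p.1 * curvLin N p.1 p.2.2 ξ η) / curv N p.1 p.2.1 p.2.2 ^ 2) := by
  refine fderiv_line (contDiffAt_field h hk) ?_
  have h1 := hasDerivAt_curv_line N p.1 p.2.1 ξ η h
  have hk0 : curv N p.1 (p.2.1 + 0 * ξ) (p.2.2 + 0 * η) ≠ 0 := by simpa using hk
  refine (((hasDerivAt_const (0 : ℝ) (cos p.1)).div h1 hk0).prodMk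
    ((hasDerivAt_const (0 : ℝ) (sin p.1)).div h1 hk0)).congr_deriv ?_
  simp

theorem fderiv_dens {p : ℝ × ℝ × ℝ} (h : p.2.2 ≠ 0) (hk : curv N p.1 p.2.1 p.2.2 ≠ 0)
    (ξ η : ℝ) : fderiv ℝ (dens N) p (0, (ξ, η)) =
      (wt N p.2.1 p.2.2 * (mc N p.2.2 * η - p.2.1 / 2 * ξ) * curv N p.1 p.2.1 p.2.2 -
        wt N p.2.1 p.2.2 * curvLin N p.1 p.2.2 ξ η) / curv N p.1 p.2.1 p.2.2 ^ 2 := by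
  refine fderiv_line (contDiffAt_dens h hk) ?_
  have h1 := hasDerivAt_curv_line N p.1 p.2.1 ξ η h
  have hk0 : curv N p.1 (p.2.1 + 0 * ξ) (p.2.2 + 0 * η) ≠ 0 := by simpa using hk
  refine ((hasDerivAt_wt_line N p.2.1 ξ η h).div h1 hk0).congr_deriv ?_
  simp

namespace IsSol

theorem continuousOn_dens (h : IsSol N a Y) :
    ContinuousOn (fun θ => dens N (θ, Y θ)) (Icc 0 (π / 2)) := by
  intro θ hθ
  exact ContinuousAt.comp_continuousWithinAt (g := dens N) (f := fun θ => (θ, Y θ))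
    (contDiffAt_dens (m := 0) (h.ne_zero hθ) (h.curv_pos θ hθ).ne').continuousAt
    (continuousWithinAt_id.prodMk (h.continuousOn θ hθ))

theorem len_eq (hN : 0 ≤ N) (h : IsSol N a Y) :
    len N a = ∫ θ in (0 : ℝ)..π / 2, dens N (θ, Y θ) := by
  refine intervalIntegral.integral_congr fun θ hθ => ?_
  rw [uIcc_of_le zero_mem_quarter.2] at hθ
  simp only [h.eqOn_sol hN hθ]

/-- The first variation of length, integrated along the arc. -/
theorem integral_fderiv_dens {ξ η : ℝ → ℝ} (h : IsSol N a Y)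
    (hJ : IsJacobi N (fun t => (Y t).1) (fun t => (Y t).2) ξ η) :
    ∫ t in (0 : ℝ)..π / 2, fderiv ℝ (dens N) (t, Y t) (0, (ξ t, η t)) =
      wt N (Y (π / 2)).1 (Y (π / 2)).2 * η (π / 2) := by
  have key : ∀ t ∈ Icc 0 (π / 2), HasDerivAt
      (fun t => wt N (Y t).1 (Y t).2 * (cos t * ξ t + sin t * η t))
      (fderiv ℝ (dens N) (t, Y t) (0, (ξ t, η t))) t := by
    intro t ht
    have hk := h.curv_pos t ht
    have hq0 := h.ne_zero ht
    rw [fderiv_dens hq0 hk.ne']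
    have hx : HasDerivAt (fun t => (Y t).1) (field N (t, Y t)).1 t := (h.hasDerivAt t ht).fst
    have hq : HasDerivAt (fun t => (Y t).2) (field N (t, Y t)).2 t := (h.hasDerivAt t ht).snd
    have hτ := ((hasDerivAt_cos t).mul (hJ.hasDerivAt_ξ t ht)).add
      ((hasDerivAt_sin t).mul (hJ.hasDerivAt_η t ht))
    refine ((hasDerivAt_wt_comp N hx hq hq0).mul hτ).congr_deriv ?_
    simp only [field, Pi.add_apply, Pi.mul_apply]
    have hs2 : sin t ^ 2 = 1 - cos t ^ 2 := by linarith [sin_sq_add_cos_sq t]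
    have hcm : mc N (Y t).2 * cos t = curv N t (Y t).1 (Y t).2 - (Y t).1 * sin t / 2 := by
      unfold curv; ring
    generalize curv N t (Y t).1 (Y t).2 = k at *
    generalize mc N (Y t).2 = m at *
    generalize curvLin N t (Y t).2 (ξ t) (η t) = l
    generalize wt N (Y t).1 (Y t).2 = w
    generalize (Y t).1 = X at *
    have hk0 := hk.ne'
    field_simp
    linear_combination w * k * (2 * sin t * ξ t - 2 * cos t * η t) * hcm +
      w * (-X * k * ξ t + 2 * m * k * η t - 2 * l) * hs2
  rw [intervalIntegral.integral_eq_sub_of_hasDerivAt (fun t ht => key t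
    (by rwa [uIcc_of_le zero_mem_quarter.2] at ht)) ?_]
  · simp [hJ.ξ_zero]
  · refine ContinuousOn.intervalIntegrable ?_
    rw [uIcc_of_le zero_mem_quarter.2]
    refine ContinuousOn.clm_apply (fun t ht => ?_) (continuousOn_const.prodMk fun t ht =>
      ((hJ.hasDerivAt_ξ t ht).continuousAt.prodMk
        (hJ.hasDerivAt_η t ht).continuousAt).continuousWithinAt)
    exact ContinuousAt.comp_continuousWithinAt (g := fderiv ℝ (dens N)) (f := fun t => (t, Y t))
      ((contDiffAt_dens (h.ne_zero ht) (h.curv_pos t ht).ne').continuousAt_fderiv one_ne_zero)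
      (continuousWithinAt_id.prodMk (h.continuousOn t ht))

/-- The end point and the length of the quarter-turn trajectories depend differentiably on the
initial position. -/
theorem hasDerivAt_end (hN : 0 ≤ N) (h : IsSol N a Y) {ξ η : ℝ → ℝ}
    (hJ : IsJacobi N (fun t => (Y t).1) (fun t => (Y t).2) ξ η) :
    HasDerivAt (fun s => sol N s (π / 2)) (ξ (π / 2), η (π / 2)) a ∧
      HasDerivAt (len N) (wt N (Y (π / 2)).1 (Y (π / 2)).2 * η (π / 2)) a := by
  obtain ⟨σ, δ, hσ, hδ, hS⟩ := h.exists_cutFlow hN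
  have hSa := hS.self_of_nhds
  have hE : EqOn Y (cutFlow N σ δ a) (Icc 0 (π / 2)) := h.eqOn hN hSa
  have hF : IsFamily (cutFlow N σ δ) (π / 2)
      (exp ((N / δ ^ 2 + 1) / δ ^ 2 * (π / 2))) a :=
    { C_pos := exp_pos _
      continuousOn := hSa.continuousOn
      lipschitz := Eventually.of_forall fun s θ hθ => by
        rw [← dist_eq_norm]
        exact (isCutFlow_cutFlow hN hσ hδ s).dist_le hN hσ hδ (isCutFlow_cutFlow hN hσ hδ a) hθ }
  have hJd : ∀ t ∈ Icc 0 (π / 2), HasDerivAt (fun t => (ξ t, η t))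
      (fderiv ℝ (field N) (t, cutFlow N σ δ a t) (0, (ξ t, η t))) t := by
    intro t ht
    rw [fderiv_field (hSa.ne_zero ht) (hSa.curv_pos t ht).ne', ← hE ht]
    exact (hJ.hasDerivAt_ξ t ht).prodMk (hJ.hasDerivAt_η t ht)
  have hexp := fun ε hε => hF.eventually_expansion (F := field N) (J := fun t => (ξ t, η t))
    (fun t ht => contDiffAt_field (hSa.ne_zero ht) (hSa.curv_pos t ht).ne')
    (hS.mono fun s hs => hs.hasDerivAt) hJd
    (hS.mono fun s hs => by rw [hs.zero, hSa.zero, hJ.ξ_zero, hJ.η_zero]; simp) (ε := ε) hε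
  refine ⟨?_, ?_⟩
  · have h1 := IsFamily.hasDerivAt_of_expansion (Y := cutFlow N σ δ)
      (J := fun t => (ξ t, η t)) (t := π / 2) fun ε hε => (hexp ε hε).mono
      fun s hs => hs _ pi_div_two_mem_quarter
    exact h1.congr_of_eventuallyEq (hS.mono fun s hs => hs.eqOn_sol hN pi_div_two_mem_quarter)
  · have h1 := hF.hasDerivAt_integral zero_mem_quarter.2 (H := dens N) (J := fun t => (ξ t, η t))
      (fun t ht => contDiffAt_dens (hSa.ne_zero ht) (hSa.curv_pos t ht).ne')
      (fun t ht => (hJd t ht).continuousAt.continuousWithinAt)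
      (hS.mono fun s hs => hs.continuousOn_dens) hexp
    have h2 : ∫ t in (0 : ℝ)..π / 2,
        fderiv ℝ (dens N) (t, cutFlow N σ δ a t) (0, (ξ t, η t)) =
        wt N (Y (π / 2)).1 (Y (π / 2)).2 * η (π / 2) := by
      rw [← h.integral_fderiv_dens hJ]
      refine intervalIntegral.integral_congr fun θ hθ => ?_
      rw [uIcc_of_le zero_mem_quarter.2] at hθ
      simp only [hE hθ]
    rw [h2] at h1
    exact h1.congr_of_eventuallyEq (hS.mono fun s hs => hs.len_eq hN)

end IsSol

end

section

/-! ### A priori estimates and existence of arcs -/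

/-- A continuous function on an interval that drops to the level `d` has a first time of doing
so. -/
theorem exists_first {f : ℝ → ℝ} {c T d : ℝ} (hf : ContinuousOn f (Icc c T)) (h0 : d < f c)
    (hex : ∃ t ∈ Icc c T, f t ≤ d) :
    ∃ t ∈ Ioc c T, f t = d ∧ ∀ s ∈ Ico c t, d < f s := by
  have hcl : IsClosed (Icc c T ∩ f ⁻¹' Iic d) := hf.preimage_isClosed_of_isClosed isClosed_Icc
    isClosed_Iic
  have hcp : IsCompact (Icc c T ∩ f ⁻¹' Iic d) :=
    isCompact_Icc.of_isClosed_subset hcl inter_subset_left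
  obtain ⟨t₁, ht₁, h₁⟩ := hex
  obtain ⟨t, ⟨ht, htd⟩, hmin⟩ := hcp.exists_isLeast ⟨t₁, ht₁, h₁⟩
  have hlt : c < t := by
    refine lt_of_le_of_ne ht.1 fun e => ?_
    rw [mem_preimage, ← e] at htd
    exact absurd htd (not_le.2 h0)
  have hs : ∀ s ∈ Ico c t, d < f s := fun s hs => by
    by_contra hc
    exact absurd (hmin ⟨⟨hs.1, hs.2.le.trans ht.2⟩, not_lt.1 hc⟩) (not_le.2 hs.2)
  refine ⟨t, ⟨hlt, ht.2⟩, le_antisymm htd ?_, hs⟩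
  by_contra hc
  obtain ⟨s, hs1, hs2⟩ := intermediate_value_Icc' hlt.le
    (hf.mono (Icc_subset_Icc_right ht.2)) (show (f t + d) / 2 ∈ Icc (f t) (f c) from
      ⟨by linarith, by linarith⟩)
  have hst : s ≠ t := by rintro rfl; linarith
  linarith [hs s ⟨hs1.1, lt_of_le_of_ne hs1.2 hst⟩]

/-- A lower bound for the curvature in terms of bounds for the position. -/
noncomputable def curvMin (N B ρ m : ℝ) : ℝ :=
  1 / (2 * m * (1 + (N + B ^ 2 / 2) / ρ) + B / ρ)

namespace IsArc

variable {N a b B ρ : ℝ} {x q : ℝ → ℝ}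

theorem mul_cos_le (h : IsArc N a b x q) {θ : ℝ} (hθ : θ ∈ Icc 0 b) :
    |a| * mc N a * cos θ ≤ |q θ| * curv N θ (x θ) (q θ) := by
  rcases eq_or_lt_of_le (hθ.2.trans h.b_le) with he | hlt
  · rw [he, cos_pi_div_two, mul_zero]
    rw [← he]
    exact mul_nonneg (abs_nonneg _) (h.curv_pos θ hθ).le
  · have hc : 0 < cos θ := cos_pos_of_mem_Ioo ⟨by linarith [hθ.1, pi_pos], hlt⟩
    have hb : ∀ t ∈ Ico 0 b, a * (a * mc N a) ≤ a * (q t * pf N t (x t) (q t)) := fun t ht => by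
      have := h.monotoneOn_mul_pf ⟨le_rfl, h.b_pos⟩ ht ht.1
      simpa [h.q_zero, h.x_zero, pf, pif] using this
    have hb' : a * (a * mc N a) ≤ a * (q θ * pf N θ (x θ) (q θ)) := by
      rcases eq_or_lt_of_le hθ.2 with he | hlt'
      · subst he
        have hcont : ContinuousWithinAt (fun t => a * (q t * pf N t (x t) (q t))) (Iio θ) θ := by
          have h1 : ContinuousAt x θ := (h.hasDerivAt_x θ hθ).continuousAt
          have h2 : ContinuousAt q θ := (h.hasDerivAt_q θ hθ).continuousAt
          have h3 : q θ ≠ 0 := h.q_ne hθ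
          have h4 : 2 * cos θ ≠ 0 := by positivity
          have : ContinuousAt (fun t => a * (q t * pf N t (x t) (q t))) θ := by
            unfold pf pif mc
            exact continuousAt_const.mul (h2.mul (((continuousAt_const.div h2 h3).sub
              (h2.div_const 2)).add ((h1.mul continuous_sin.continuousAt).div
              (continuousAt_const.mul continuous_cos.continuousAt) h4)))
          exact this.continuousWithinAt
        refine ge_of_tendsto hcont.tendsto ?_
        filter_upwards [Ioo_mem_nhdsLT h.b_pos] with t ht using hb t ⟨ht.1.le, ht.2⟩
      · exact hb θ ⟨hθ.1, hlt'⟩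
    rw [curv_eq_pf_mul_cos hc.ne', ← mul_assoc]
    refine mul_le_mul_of_nonneg_right ?_ hc.le
    have ha : 0 < |a| := abs_pos.2 h.a_ne
    have hq : |a| * |q θ| = a * q θ := by rw [← abs_mul, abs_of_pos (h.same_sign θ hθ)]
    refine le_of_mul_le_mul_left ?_ ha
    calc |a| * (|a| * mc N a) = a * (a * mc N a) := by rw [← mul_assoc, abs_mul_abs_self]; ring
      _ ≤ _ := hb'
      _ = _ := by rw [← mul_assoc |a|, hq]; ring

theorem curvMin_le (h : IsArc N a b x q) (hB : ∀ θ ∈ Icc 0 b, |q θ| ≤ B) (hρ : 0 < ρ)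
    (hρa : ρ ≤ |a| * mc N a) {θ : ℝ} (hθ : θ ∈ Icc 0 b) :
    curvMin N B ρ (mc N a) ≤ curv N θ (x θ) (q θ) := by
  have hN := h.N_pos
  have hk := h.curv_pos θ hθ
  have hm := h.mc_a_pos
  have hc := h.cos_nonneg' hθ
  have hs := h.sin_nonneg' hθ
  have hqk : ρ * cos θ ≤ |q θ| * curv N θ (x θ) (q θ) :=
    (mul_le_mul_of_nonneg_right hρa hc).trans (h.mul_cos_le hθ)
  have hBθ := hB θ hθ
  have hq : 0 < |q θ| := abs_pos.2 (h.q_ne hθ)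
  have hB0 : 0 < B := hq.trans_le hBθ
  set k := curv N θ (x θ) (q θ) with hkdef
  have hxs : sin θ ^ 2 / (2 * mc N a) ≤ x θ * sin θ / 2 := by
    rcases eq_or_lt_of_le hθ.1 with he | hlt
    · simp [← he]
    · have := h.sin_le_mul_x ⟨hlt, hθ.2⟩
      rw [div_le_iff₀ (by positivity)]
      nlinarith [mul_le_mul_of_nonneg_right this hs]
  have hcB : cos θ ≤ B * k / ρ := by
    rw [le_div_iff₀ hρ]
    nlinarith [mul_le_mul_of_nonneg_right hBθ hk.le]
  have hmc : -((N + B ^ 2 / 2) / ρ * k) ≤ mc N (q θ) * cos θ := by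
    have e1 : cos θ / |q θ| ≤ k / ρ := by
      rw [div_le_div_iff₀ hq hρ]; linarith
    have e2 : -(N * (k / ρ)) ≤ N / q θ * cos θ := by
      have : -(N * (cos θ / |q θ|)) ≤ N / q θ * cos θ := by
        have : -(1 / |q θ|) ≤ 1 / q θ := by
          rw [one_div, one_div, ← abs_inv]; exact neg_abs_le _
        have h2 := mul_le_mul_of_nonneg_left this (mul_nonneg (by linarith : 0 ≤ N) hc)
        calc _ = N * cos θ * -(1 / |q θ|) := by ring
          _ ≤ _ := h2
          _ = _ := by ring
      have h3 := mul_le_mul_of_nonneg_left e1 (by linarith : 0 ≤ N)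
      linarith
    have e3 : q θ / 2 * cos θ ≤ B ^ 2 / 2 * (k / ρ) := by
      have h1 : q θ ≤ B := (le_abs_self _).trans hBθ
      calc q θ / 2 * cos θ ≤ B / 2 * (B * k / ρ) := by gcongr
        _ = _ := by ring
    unfold mc
    calc -((N + B ^ 2 / 2) / ρ * k) = -(N * (k / ρ)) - B ^ 2 / 2 * (k / ρ) := by ring
      _ ≤ N / q θ * cos θ - q θ / 2 * cos θ := by linarith
      _ = _ := by ring
  have hkeq : k = mc N (q θ) * cos θ + x θ * sin θ / 2 := rfl
  have hs2 : sin θ ^ 2 ≤ 2 * mc N a * (1 + (N + B ^ 2 / 2) / ρ) * k := by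
    have : sin θ ^ 2 / (2 * mc N a) ≤ (1 + (N + B ^ 2 / 2) / ρ) * k := by linarith
    rw [div_le_iff₀ (by positivity)] at this
    linarith
  have hsc : 1 ≤ sin θ ^ 2 + cos θ := by nlinarith [sin_sq_add_cos_sq θ, cos_le_one θ]
  unfold curvMin
  rw [div_le_iff₀ (by positivity)]
  calc (1 : ℝ) ≤ sin θ ^ 2 + cos θ := hsc
    _ ≤ 2 * mc N a * (1 + (N + B ^ 2 / 2) / ρ) * k + B * k / ρ := add_le_add hs2 hcB
    _ = _ := by ring

/-- The bootstrap: a trajectory of the truncated flow is an arc as long as the truncation is finer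
than the a priori curvature bound. -/
theorem of_cutFlow {σ δ T : ℝ} {Y : ℝ → ℝ × ℝ} (hN : 1 ≤ N) (hσ : σ ^ 2 = 1) (hδ : 0 < δ)
    (hY : IsCutFlow N σ δ a Y) (hT : 0 < T) (hT' : T ≤ π / 2) (hpsi : 0 < mc N a + 1 / a)
    (hq : ∀ θ ∈ Icc 0 T, δ ≤ σ * (Y θ).2)
    (hbd : ∀ θ ∈ Icc 0 T, (Y θ).1 ^ 2 ≤ 2 ∨ 0 ≤ mc N (Y θ).2) (hρ : 0 < ρ)
    (hρa : ρ ≤ |a| * mc N a) (hδa : δ < mc N a) (hδk : δ < curvMin N B ρ (mc N a))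
    (hB : ∀ t ∈ Ioc 0 T, IsArc N a t (fun θ => (Y θ).1) (fun θ => (Y θ).2) →
      ∀ θ ∈ Icc 0 t, |(Y θ).2| ≤ B) :
    IsArc N a T (fun θ => (Y θ).1) (fun θ => (Y θ).2) := by
  have hsub : Icc 0 T ⊆ Icc 0 (π / 2) := Icc_subset_Icc_right hT'
  have key : ∀ t ∈ Ioc 0 T, (∀ θ ∈ Icc 0 t, δ ≤ curv N θ (Y θ).1 (Y θ).2) →
      IsArc N a t (fun θ => (Y θ).1) (fun θ => (Y θ).2) := fun t ht hk => by
    have hst : Icc 0 t ⊆ Icc 0 T := Icc_subset_Icc_right ht.2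
    have h0 := hq 0 ⟨le_rfl, hT.le⟩
    rw [hY.zero] at h0
    exact
    { N_pos := hN
      b_pos := ht.1
      b_le := ht.2.trans hT'
      psi_pos := hpsi
      x_zero := by simp [hY.zero]
      q_zero := by simp [hY.zero]
      same_sign := fun θ hθ => by
        have : 0 < (σ * a) * (σ * (Y θ).2) :=
          mul_pos (hδ.trans_le h0) (hδ.trans_le (hq θ (hst hθ)))
        linear_combination this + a * (Y θ).2 * hσ
      curv_pos := fun θ hθ => hδ.trans_le (hk θ hθ)
      hasDerivAt_x := fun θ hθ => by
        have := hY.hasDerivAt_fst (hsub (hst hθ))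
        rwa [cutCurv_eq_of_lt hσ (hq θ (hst hθ)) (hk θ hθ)] at this
      hasDerivAt_q := fun θ hθ => by
        have := hY.hasDerivAt_snd (hsub (hst hθ))
        rwa [cutCurv_eq_of_lt hσ (hq θ (hst hθ)) (hk θ hθ)] at this
      bound := fun θ hθ => hbd θ (hst hθ) }
  refine key T ⟨hT, le_rfl⟩ ?_
  by_contra! hcon
  have hcont : ContinuousOn (fun θ => curv N θ (Y θ).1 (Y θ).2) (Icc 0 T) :=
    continuousOn_curv_of_ne (continuous_fst.comp_continuousOn (hY.continuousOn.mono hsub))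
      (continuous_snd.comp_continuousOn (hY.continuousOn.mono hsub)) fun θ hθ h0 => by
        have := hq θ hθ
        rw [h0, mul_zero] at this
        linarith
  obtain ⟨t₁, ht₁, h₁⟩ := hcon
  obtain ⟨t, ht, htd, hlt⟩ := exists_first hcont (d := δ)
    (by simpa [hY.zero, curv] using hδa) ⟨t₁, ht₁, h₁.le⟩
  have harc := key t ht fun θ hθ => by
    rcases eq_or_lt_of_le hθ.2 with rfl | hl
    · exact htd.ge
    · exact (hlt θ ⟨hθ.1, hl⟩).le
  have := harc.curvMin_le (hB t ht harc) hρ hρa ⟨ht.1.le, le_rfl⟩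
  linarith

end IsArc

theorem curvMin_pos {N B ρ m : ℝ} (hN : 1 ≤ N) (hB : 0 ≤ B) (hρ : 0 < ρ) (hm : 0 < m) :
    0 < curvMin N B ρ m := by
  unfold curvMin; positivity

end

section

namespace IsArc

variable {N a b B ρ : ℝ} {x q : ℝ → ℝ}

/-- A crude bound for the position on lower arcs. -/
theorem q_le_of_le (h : IsArc N a b x q) (ha : 0 < a) (hρ : 0 < ρ) (hρa : ρ ≤ a * mc N a)
    {M : ℝ} (haM : a ≤ M) (hM : 2 * (N + N / ρ) ≤ M ^ 2) {θ : ℝ} (hθ : θ ∈ Ico 0 b) :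
    q θ ≤ M * (1 + 1 / ρ) := by
  have hN := h.N_pos
  have hM0 : 0 < M := ha.trans_le haM
  have hsub : Ico 0 b ⊆ Icc 0 b := Ico_subset_Icc_self
  have hM1 : M ≤ M * (1 + 1 / ρ) := by
    have : 0 < M * (1 / ρ) := by positivity
    linarith
  rcases le_or_gt (q θ) M with hle | hgt
  · exact hle.trans hM1
  obtain ⟨t, ht, htM⟩ := intermediate_value_Icc hθ.1
    (h.continuousOn_q.mono (Icc_subset_Icc_right hθ.2.le)) ⟨h.q_zero.le.trans haM, hgt.le⟩
  have hq0 : ∀ s ∈ Ico 0 b, 0 < q s := fun s hs =>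
    (mul_pos_iff_of_pos_left ha).1 (h.same_sign s (hsub hs))
  have hP : ∀ s ∈ Ico 0 b, ρ ≤ q s * pf N s (x s) (q s) := fun s hs => by
    have h1 := h.mul_cos_le (hsub hs)
    have hc := h.cos_pos' hs
    rw [curv_eq_pf_mul_cos hc.ne', abs_of_pos ha, abs_of_pos (hq0 s hs), ← mul_assoc] at h1
    exact hρa.trans (le_of_mul_le_mul_right h1 hc)
  have htb : t < b := ht.2.trans_lt hθ.2
  have hanti : AntitoneOn (fun s => 1 / pf N s (x s) (q s) + q s) (Icc t θ) := by
    have hin : Icc t θ ⊆ Ico 0 b := fun s hs => ⟨ht.1.trans hs.1, hs.2.trans_lt hθ.2⟩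
    have hd : ∀ s ∈ Ioo t θ, HasDerivAt (fun s => 1 / pf N s (x s) (q s) + q s)
        (-(sin s / curv N s (x s) (q s) *
            (pf N s (x s) (q s) * pif s (x s) + (1 - zf N s (x s) (q s)) / 2 - N / q s ^ 2)) /
          pf N s (x s) (q s) ^ 2 + sin s / curv N s (x s) (q s)) s := fun s hs => by
      have hs' : s ∈ Ioo 0 b := ⟨ht.1.trans_lt hs.1, hs.2.trans hθ.2⟩
      have h1 := (h.hasDerivAt_pf hs').inv (h.pf_pos ⟨hs'.1.le, hs'.2⟩).ne'
      have h2 := h.hasDerivAt_q s (Ioo_subset_Icc_self hs')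
      have h3 := h1.add h2
      simp only [one_div]
      exact h3
    refine antitoneOn_of_deriv_nonpos (convex_Icc _ _) ?_ ?_ ?_
    · exact (continuousOn_const.div (h.continuousOn_pf.mono hin)
        fun s hs => (h.pf_pos (hin hs)).ne').add (h.continuousOn_q.mono (hin.trans hsub))
    · intro s hs
      rw [interior_Icc] at hs
      exact (hd s hs).differentiableAt.differentiableWithinAt
    · intro s hs
      rw [interior_Icc] at hs
      rw [(hd s hs).deriv]
      have hs' : s ∈ Ioo 0 b := ⟨ht.1.trans_lt hs.1, hs.2.trans hθ.2⟩
      have hsI : s ∈ Ico 0 b := ⟨hs'.1.le, hs'.2⟩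
      have hp := h.pf_pos hsI
      have hz := h.zf_lt_one hs'
      have hqs := hq0 s hsI
      have hPs := hP s hsI
      have hk := h.curv_pos s (hsub hsI)
      have hsin := h.sin_pos' ⟨hs'.1, hs'.2.le⟩
      have hMq : M ≤ q s := htM ▸ h.strictMonoOn_q.monotoneOn ⟨ht.1, htb.le⟩ (hsub hsI) hs.1.le
      have hpi : pif s (x s) = pf N s (x s) (q s) - N / q s + q s / 2 := by unfold pf mc; ring
      have key : pf N s (x s) (q s) ^ 2 ≤
          pf N s (x s) (q s) * pif s (x s) + (1 - zf N s (x s) (q s)) / 2 - N / q s ^ 2 := by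
        rw [hpi]
        generalize pf N s (x s) (q s) = P at *
        generalize zf N s (x s) (q s) = z at *
        generalize q s = Q at *
        have hQ2 : 2 * (N + N / ρ) ≤ Q ^ 2 := hM.trans (by gcongr)
        have h3 : 0 ≤ P * (Q / 2 - N / Q) - N / Q ^ 2 := by
          have e : P * (Q / 2 - N / Q) - N / Q ^ 2 = ((P * Q) * (Q ^ 2 / 2 - N) - N) / Q ^ 2 := by
            field_simp
          rw [e]
          refine div_nonneg ?_ (sq_nonneg _)
          have h4 : N / ρ ≤ Q ^ 2 / 2 - N := by linarith
          have h5 : N / ρ * ρ = N := by field_simp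
          have h6 : 0 ≤ N / ρ := by positivity
          nlinarith only [h4, h5, h6, hPs,
            mul_le_mul (by linarith : ρ ≤ P * Q) h4 h6 (by positivity)]
        nlinarith only [h3, hz]
      have e : -(sin s / curv N s (x s) (q s) *
            (pf N s (x s) (q s) * pif s (x s) + (1 - zf N s (x s) (q s)) / 2 - N / q s ^ 2)) /
          pf N s (x s) (q s) ^ 2 + sin s / curv N s (x s) (q s) =
          -(sin s / curv N s (x s) (q s)) * ((pf N s (x s) (q s) * pif s (x s) +
            (1 - zf N s (x s) (q s)) / 2 - N / q s ^ 2) - pf N s (x s) (q s) ^ 2) /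
          pf N s (x s) (q s) ^ 2 := by
        field_simp; ring
      rw [e]
      refine div_nonpos_of_nonpos_of_nonneg ?_ (sq_nonneg _)
      exact mul_nonpos_of_nonpos_of_nonneg (neg_nonpos.2 (div_pos hsin hk).le) (sub_nonneg.2 key)
  have h1 := hanti ⟨le_rfl, ht.2⟩ ⟨ht.2, le_rfl⟩ ht.2
  have h2 : 1 / pf N t (x t) (q t) ≤ M / ρ := by
    have h3 := hP t ⟨ht.1, htb⟩
    rw [htM] at h3 ⊢
    have h4 := h.pf_pos ⟨ht.1, htb⟩
    rw [htM] at h4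
    rw [div_le_div_iff₀ h4 hρ]
    linarith
  have h3 : 0 < 1 / pf N θ (x θ) (q θ) := one_div_pos.2 (h.pf_pos hθ)
  simp only [htM] at h1 h2
  have e : M * (1 + 1 / ρ) = M / ρ + M := by ring
  linarith

theorem le_of_continuous (h : IsArc N a b x q) {f : ℝ → ℝ} (hf : ContinuousOn f (Icc 0 b)) {C : ℝ}
    (hC : ∀ θ ∈ Ico 0 b, f θ ≤ C) : ∀ θ ∈ Icc 0 b, f θ ≤ C := by
  intro θ hθ
  rcases eq_or_lt_of_le hθ.2 with rfl | hlt
  · have h1 := (hf θ hθ).mono_left (nhdsWithin_mono _ Ioo_subset_Icc_self)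
    rw [nhdsWithin_Ioo_eq_nhdsLT h.b_pos] at h1
    refine le_of_tendsto h1 ?_
    filter_upwards [Ioo_mem_nhdsLT h.b_pos] with t ht using hC t ⟨ht.1.le, ht.2⟩
  · exact hC θ ⟨hθ.1, hlt⟩

theorem hasDerivAt_wt_mul_cos (h : IsArc N a b x q) {θ : ℝ} (hθ : θ ∈ Icc 0 b) :
    HasDerivAt (fun θ => wt N (x θ) (q θ) * cos θ)
      (-(wt N (x θ) (q θ) * x θ / (2 * curv N θ (x θ) (q θ)))) θ := by
  have hk := h.curv_pos θ hθ
  refine ((hasDerivAt_wt_comp N (h.hasDerivAt_x θ hθ) (h.hasDerivAt_q θ hθ) (h.q_ne hθ)).mul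
    (hasDerivAt_cos θ)).congr_deriv ?_
  have hs2 : sin θ ^ 2 = 1 - cos θ ^ 2 := by linarith [sin_sq_add_cos_sq θ]
  have hcm : mc N (q θ) * cos θ = curv N θ (x θ) (q θ) - x θ * sin θ / 2 := by
    unfold curv; ring
  generalize curv N θ (x θ) (q θ) = k at *
  generalize mc N (q θ) = m at *
  generalize wt N (x θ) (q θ) = w
  have hk0 := hk.ne'
  field_simp
  linear_combination w * 2 * sin θ * hcm - w * x θ * hs2

theorem mul_cos_le_of_small (h : IsArc N a b x q) (ha : 0 < a) (hx : ∀ θ ∈ Icc 0 b, x θ ^ 2 ≤ 2)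
    (hB : ∀ θ ∈ Icc 0 b, |q θ| ≤ B) {θ : ℝ} (hθ : θ ∈ Icc 0 b) :
    q θ * cos θ ≤ a * exp ((2 + B ^ 2) / 4) := by
  have hanti : AntitoneOn (fun θ => wt N (x θ) (q θ) * cos θ) (Icc 0 b) := by
    refine antitoneOn_of_deriv_nonpos (convex_Icc _ _)
      (fun s hs => (h.hasDerivAt_wt_mul_cos hs).continuousAt.continuousWithinAt)
      (fun s hs =>
        (h.hasDerivAt_wt_mul_cos (interior_subset hs)).differentiableAt.differentiableWithinAt)
      fun s hs => ?_
    have hs := interior_subset hs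
    rw [(h.hasDerivAt_wt_mul_cos hs).deriv, neg_nonpos]
    exact div_nonneg (mul_nonneg (wt_pos _ _ _).le (h.x_nonneg hs))
      (mul_nonneg two_pos.le (h.curv_pos s hs).le)
  have h0 : (0 : ℝ) ∈ Icc 0 b := ⟨le_rfl, h.b_pos.le⟩
  have h1 := hanti h0 hθ hθ.1
  simp only [h.x_zero, h.q_zero, cos_zero, mul_one] at h1
  have hq : 0 < q θ := (mul_pos_iff_of_pos_left ha).1 (h.same_sign θ hθ)
  have hc := h.cos_nonneg' hθ
  have haq : a ≤ q θ := h.q_zero ▸ h.strictMonoOn_q.monotoneOn h0 hθ hθ.1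
  have hq2 : q θ ^ 2 ≤ B ^ 2 :=
    sq_le_sq' (by linarith [(abs_le.1 (hB θ hθ)).1]) (abs_le.1 (hB θ hθ)).2
  have hE : wt N 0 a ≤ exp (N * log a) := by
    unfold wt; exact exp_le_exp.2 (by nlinarith [sq_nonneg a])
  have hF : exp (N * log a + (log (q θ) - log a) - (2 + B ^ 2) / 4) ≤ wt N (x θ) (q θ) := by
    unfold wt
    refine exp_le_exp.2 ?_
    have := log_le_log ha haq
    nlinarith [hx θ hθ, h.N_pos]
  have h2 : exp (N * log a + (log (q θ) - log a) - (2 + B ^ 2) / 4) * cos θ ≤ exp (N * log a) :=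
    (mul_le_mul_of_nonneg_right hF hc).trans (h1.trans hE)
  rw [exp_sub, exp_add, exp_sub, exp_log hq, exp_log ha] at h2
  have e1 := exp_pos (N * log a)
  have e2 := exp_pos ((2 + B ^ 2) / 4)
  have h3 : exp (N * log a) * (q θ * cos θ) ≤ exp (N * log a) * (a * exp ((2 + B ^ 2) / 4)) := by
    have : exp (N * log a) * (q θ / a) / exp ((2 + B ^ 2) / 4) * cos θ =
      exp (N * log a) * (q θ * cos θ) / (a * exp ((2 + B ^ 2) / 4)) := by field_simp
    rwa [this, div_le_iff₀ (by positivity)] at h2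
  exact le_of_mul_le_mul_left h3 e1

/-- Lower arcs starting close to the origin stay close to the axis `x = 0`. -/
theorem x_le_of_small (h : IsArc N a b x q) (ha : 0 < a) (hρ : 0 < ρ) (hρa : ρ ≤ a * mc N a)
    (hx : ∀ θ ∈ Icc 0 b, x θ ^ 2 ≤ 2) (hB : ∀ θ ∈ Icc 0 b, |q θ| ≤ B)
    {ε : ℝ} (hε : 0 < ε) (hε' : ε ≤ 1 / 2) {θ : ℝ} (hθ : θ ∈ Icc 0 b) :
    x θ ≤ a * exp ((2 + B ^ 2) / 4) / (ε * ρ) * (π / 2) + 2 * ε * B := by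
  set A := a * exp ((2 + B ^ 2) / 4) / (ε * ρ) with hA
  have hA0 : 0 < A := by positivity
  have hd : ∀ s ∈ Icc 0 b, HasDerivAt (fun s => A * s + 2 * ε * q s - x s)
      (A + 2 * ε * (sin s / curv N s (x s) (q s)) - cos s / curv N s (x s) (q s)) s :=
    fun s hs =>
      ((((hasDerivAt_id s).const_mul A).add ((h.hasDerivAt_q s hs).const_mul (2 * ε))).sub
        (h.hasDerivAt_x s hs)).congr_deriv (by rw [mul_one])
  have hmono : MonotoneOn (fun s => A * s + 2 * ε * q s - x s) (Icc 0 b) := by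
    refine monotoneOn_of_deriv_nonneg (convex_Icc _ _)
      (fun s hs => (hd s hs).continuousAt.continuousWithinAt)
      (fun s hs => (hd s (interior_subset hs)).differentiableAt.differentiableWithinAt)
      fun s hs => ?_
    have hs := interior_subset hs
    rw [(hd s hs).deriv]
    have hk := h.curv_pos s hs
    have hsin := h.sin_nonneg' hs
    have hcos := h.cos_nonneg' hs
    rcases le_total ε (cos s) with hc | hc
    · have h1 := h.mul_cos_le_of_small ha hx hB hs
      have h2 := h.mul_cos_le hs
      have hq : 0 < q s := (mul_pos_iff_of_pos_left ha).1 (h.same_sign s hs)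
      rw [abs_of_pos ha, abs_of_pos hq] at h2
      have h3 : cos s / curv N s (x s) (q s) ≤ A := by
        rw [hA, div_le_div_iff₀ hk (by positivity)]
        have h4 : ρ * cos s ≤ q s * curv N s (x s) (q s) :=
          (mul_le_mul_of_nonneg_right hρa hcos).trans h2
        calc cos s * (ε * ρ) = ε * (ρ * cos s) := by ring
          _ ≤ cos s * (q s * curv N s (x s) (q s)) := by gcongr
          _ = q s * cos s * curv N s (x s) (q s) := by ring
          _ ≤ _ := by gcongr
      have h5 : 0 ≤ 2 * ε * (sin s / curv N s (x s) (q s)) := by positivity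
      linarith
    · have h1 : 1 / 2 ≤ sin s := by nlinarith [sin_sq_add_cos_sq s]
      have h2 : cos s / curv N s (x s) (q s) ≤ 2 * ε * (sin s / curv N s (x s) (q s)) := by
        rw [← mul_div_assoc]
        gcongr
        nlinarith
      linarith
  have h1 := hmono ⟨le_rfl, h.b_pos.le⟩ hθ hθ.1
  simp only [h.x_zero, h.q_zero] at h1
  have h2 := (abs_le.1 (hB θ hθ)).2
  have h3 : A * θ ≤ A * (π / 2) := by gcongr; exact hθ.2.trans h.b_le
  have h4 : 2 * ε * q θ ≤ 2 * ε * B := by gcongr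
  have h5 : 0 < 2 * ε * a := by positivity
  linarith

/-- The position changes by a bounded amount on upper arcs of nonnegative mean curvature. -/
theorem sub_le_of_mc_nonneg (h : IsArc N a b x q) (hm : ∀ θ ∈ Icc 0 b, 0 ≤ mc N (q θ)) {θ : ℝ}
    (hθ : θ ∈ Ico 0 b) : q θ - a ≤ π / √2 := by
  have h2 : (0 : ℝ) < √2 := by positivity
  have hsq : √2 ^ 2 = 2 := sq_sqrt (by norm_num)
  have hd : ∀ s ∈ Ioo 0 b, HasDerivAt (fun s => √2 * arctan (√2 * pif s (x s)) - q s)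
      (√2 * (1 / (1 + (√2 * pif s (x s)) ^ 2) * (√2 * (sin s / curv N s (x s) (q s) *
        (pf N s (x s) (q s) * pif s (x s) + (2 - zf N s (x s) (q s)) / 2)))) -
        sin s / curv N s (x s) (q s)) s := fun s hs =>
    (((h.hasDerivAt_pif hs).const_mul √2).arctan.const_mul √2).sub
      (h.hasDerivAt_q s (Ioo_subset_Icc_self hs))
  have hmono : MonotoneOn (fun s => √2 * arctan (√2 * pif s (x s)) - q s) (Ico 0 b) := by
    refine monotoneOn_of_deriv_nonneg (convex_Ico _ _) ?_ ?_ ?_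
    · exact (continuousOn_const.mul (continuous_arctan.comp_continuousOn
        (continuousOn_const.mul h.continuousOn_pif))).sub
        (h.continuousOn_q.mono Ico_subset_Icc_self)
    · intro s hs
      rw [interior_Ico] at hs
      exact (hd s hs).differentiableAt.differentiableWithinAt
    · intro s hs
      rw [interior_Ico] at hs
      rw [(hd s hs).deriv]
      have hk := h.curv_pos s (Ioo_subset_Icc_self hs)
      have hsin := h.sin_pos' (Ioo_subset_Ioc_self hs)
      have hz := h.zf_lt_one hs
      have hpi := h.pif_pos hs
      have hP : pif s (x s) ≤ pf N s (x s) (q s) := by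
        have := hm s (Ioo_subset_Icc_self hs)
        unfold pf; linarith
      generalize pf N s (x s) (q s) = P at *
      generalize zf N s (x s) (q s) = z at *
      generalize pif s (x s) = p at *
      have hg : 0 < sin s / curv N s (x s) (q s) := div_pos hsin hk
      generalize sin s / curv N s (x s) (q s) = g at *
      have e : √2 * (1 / (1 + (√2 * p) ^ 2) * (√2 * (g * (P * p + (2 - z) / 2)))) - g =
          g * (2 * (P * p + (2 - z) / 2) - (1 + 2 * p ^ 2)) / (1 + 2 * p ^ 2) := by
        rw [mul_pow, hsq]
        field_simp
        rw [hsq]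
        ring
      rw [e]
      refine div_nonneg (mul_nonneg hg.le ?_) (by positivity)
      nlinarith only [hP, hz, hpi, mul_le_mul_of_nonneg_right hP hpi.le]
  have h1 := hmono ⟨le_rfl, h.b_pos⟩ hθ hθ.1
  simp only [pif_zero, mul_zero, arctan_zero, h.q_zero] at h1
  have h3 := (arctan_lt_pi_div_two (√2 * pif θ (x θ))).le
  have h4 : π / √2 = √2 * (π / 2) := by
    field_simp; rw [hsq]
  rw [h4]
  nlinarith [mul_le_mul_of_nonneg_left h3 h2.le]

theorem x_le_of_mc (h : IsArc N a b x q) {m : ℝ} (hm0 : 0 < m) (hm : ∀ θ ∈ Icc 0 b, m ≤ mc N (q θ))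
    {θ : ℝ} (hθ : θ ∈ Icc 0 b) : x θ ≤ π / (2 * m) := by
  have hd : ∀ s ∈ Icc 0 b, HasDerivAt (fun s => s / m - x s)
      (1 / m - cos s / curv N s (x s) (q s)) s :=
    fun s hs => ((hasDerivAt_id s).div_const m).sub (h.hasDerivAt_x s hs)
  have hmono : MonotoneOn (fun s => s / m - x s) (Icc 0 b) := by
    refine monotoneOn_of_deriv_nonneg (convex_Icc _ _)
      (fun s hs => (hd s hs).continuousAt.continuousWithinAt)
      (fun s hs => (hd s (interior_subset hs)).differentiableAt.differentiableWithinAt)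
      fun s hs => ?_
    have hs := interior_subset hs
    rw [(hd s hs).deriv, sub_nonneg, div_le_div_iff₀ (h.curv_pos s hs) hm0]
    unfold curv
    have h1 := mul_le_mul_of_nonneg_right (hm s hs) (h.cos_nonneg' hs)
    have h2 := mul_nonneg (h.x_nonneg hs) (h.sin_nonneg' hs)
    linarith
  have h1 := hmono ⟨le_rfl, h.b_pos.le⟩ hθ hθ.1
  simp only [h.x_zero, zero_div] at h1
  have h2 : θ / m ≤ π / 2 / m := by gcongr; exact hθ.2.trans h.b_le
  have h3 : π / (2 * m) = π / 2 / m := by field_simp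
  linarith

end IsArc

end

section

/-! ### Good initial positions -/

/-- The initial position `a` is good if the quarter-turn trajectory from `(0, a)` exists and stays
in the range where it depends monotonically on `a`. -/
structure Good (N a : ℝ) : Prop where
  N_pos : 1 ≤ N
  isSol : IsSol N a (sol N a)
  psi_pos : 0 < mc N a + 1 / a
  bound : (sol N a (π / 2)).1 ^ 2 ≤ 2

/-- The `x`-coordinate of the end point of the quarter-turn trajectory. -/
noncomputable def xEnd (N a : ℝ) : ℝ := (sol N a (π / 2)).1

/-- The position `q` of the end point of the quarter-turn trajectory. -/
noncomputable def qEnd (N a : ℝ) : ℝ := (sol N a (π / 2)).2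

variable {N a b B ρ : ℝ}

namespace IsArc

variable {x q : ℝ → ℝ}

theorem abs_le_of_pos (h : IsArc N a b x q) (ha : 0 < a) (hρ : 0 < ρ) (hρa : ρ ≤ a * mc N a)
    {M : ℝ} (haM : a ≤ M) (hM : 2 * (N + N / ρ) ≤ M ^ 2) :
    ∀ θ ∈ Icc 0 b, |q θ| ≤ M * (1 + 1 / ρ) := by
  intro θ hθ
  rw [abs_of_pos ((mul_pos_iff_of_pos_left ha).1 (h.same_sign θ hθ))]
  exact h.le_of_continuous h.continuousOn_q
    (fun t ht => h.q_le_of_le ha hρ hρa haM hM ht) θ hθ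

theorem abs_le_of_neg (h : IsArc N a b x q) (ha : a < 0) : ∀ θ ∈ Icc 0 b, |q θ| ≤ -a := by
  intro θ hθ
  have h1 : q θ < 0 := by
    have := h.same_sign θ hθ
    by_contra! hc
    nlinarith
  rw [abs_of_neg h1]
  have := h.strictMonoOn_q.monotoneOn ⟨le_rfl, h.b_pos.le⟩ hθ hθ.1
  rw [h.q_zero] at this
  linarith

theorem sq_x_end_le (h : IsArc N a (π / 2) x q) : x (π / 2) ^ 2 ≤ 2 := by
  have hf : ContinuousOn (fun θ => curv N θ (x θ) (q θ) * x θ / sin θ) (Ioc 0 (π / 2)) :=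
    ((h.continuousOn_curv.mul h.continuousOn_x).mono Ioc_subset_Icc_self).div
      continuous_sin.continuousOn fun θ hθ => (h.sin_pos' hθ).ne'
  have hmem : π / 2 ∈ Ioc 0 (π / 2) := ⟨h.b_pos, le_rfl⟩
  have h1 := (hf _ hmem).mono_left (nhdsWithin_mono _ Ioo_subset_Ioc_self)
  rw [nhdsWithin_Ioo_eq_nhdsLT h.b_pos] at h1
  have h2 : curv N (π / 2) (x (π / 2)) (q (π / 2)) * x (π / 2) / sin (π / 2) ≤ 1 := by
    refine le_of_tendsto h1 ?_
    filter_upwards [Ioo_mem_nhdsLT h.b_pos] with t ht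
    have := h.zf_nonneg t ht
    unfold zf at this
    linarith
  simp only [curv, cos_pi_div_two, sin_pi_div_two] at h2
  nlinarith

theorem isSol {Y : ℝ → ℝ × ℝ} (h : IsArc N a (π / 2) (fun θ => (Y θ).1) (fun θ => (Y θ).2)) :
    IsSol N a Y where
  zero := Prod.ext h.x_zero h.q_zero
  same_sign := h.same_sign
  curv_pos := h.curv_pos
  hasDerivAt θ hθ := (h.hasDerivAt_x θ hθ).prodMk (h.hasDerivAt_q θ hθ)

theorem good {Y : ℝ → ℝ × ℝ} (h : IsArc N a (π / 2) (fun θ => (Y θ).1) (fun θ => (Y θ).2)) :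
    Good N a ∧ xEnd N a = (Y (π / 2)).1 ∧ qEnd N a = (Y (π / 2)).2 := by
  have hN : 0 ≤ N := by linarith [h.N_pos]
  have hE := h.isSol.eqOn_sol hN pi_div_two_mem_quarter
  refine ⟨⟨h.N_pos, isSol_sol ⟨Y, h.isSol⟩, h.psi_pos, ?_⟩, ?_, ?_⟩
  · rw [hE]; exact h.sq_x_end_le
  · rw [xEnd, hE]
  · rw [qEnd, hE]

end IsArc

theorem Good.isArc (h : Good N a) :
    IsArc N a (π / 2) (fun θ => (sol N a θ).1) (fun θ => (sol N a θ).2) where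
  N_pos := h.N_pos
  b_pos := by positivity
  b_le := le_rfl
  psi_pos := h.psi_pos
  x_zero := by simp [h.isSol.zero]
  q_zero := by simp [h.isSol.zero]
  same_sign := h.isSol.same_sign
  curv_pos := h.isSol.curv_pos
  hasDerivAt_x θ hθ := (h.isSol.hasDerivAt θ hθ).fst
  hasDerivAt_q θ hθ := (h.isSol.hasDerivAt θ hθ).snd
  bound θ hθ := by
    left
    have hm : ∀ s ∈ Icc 0 (π / 2), HasDerivAt (fun θ => (sol N a θ).1) _ s :=
      fun s hs => (h.isSol.hasDerivAt s hs).fst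
    have hmono : MonotoneOn (fun θ => (sol N a θ).1) (Icc 0 (π / 2)) := by
      refine monotoneOn_of_deriv_nonneg (convex_Icc _ _)
        (fun s hs => (hm s hs).continuousAt.continuousWithinAt)
        (fun s hs => (hm s (interior_subset hs)).differentiableAt.differentiableWithinAt)
        fun s hs => ?_
      have hs := interior_subset hs
      rw [(hm s hs).deriv]
      exact div_nonneg (cos_nonneg_of_mem_Icc ⟨by linarith [hs.1, pi_pos], hs.2⟩)
        (h.isSol.curv_pos s hs).le
    have h0 := hmono zero_mem_quarter hθ hθ.1
    have h1 := hmono hθ pi_div_two_mem_quarter hθ.2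
    simp only [h.isSol.zero] at h0
    exact (pow_le_pow_left₀ h0 h1 2).trans h.bound

/-- An initial position whose truncated trajectory avoids the truncation is good. -/
theorem good_of_cutFlow {σ δ : ℝ} (hN : 1 ≤ N) (hσ : σ ^ 2 = 1) (hδ : 0 < δ)
    (hpsi : 0 < mc N a + 1 / a)
    (hq : ∀ θ ∈ Icc 0 (π / 2), δ ≤ σ * (cutFlow N σ δ a θ).2)
    (hbd : (cutFlow N σ δ a (π / 2)).1 ^ 2 ≤ 2) (hρ : 0 < ρ)
    (hρa : ρ ≤ |a| * mc N a) (hδa : δ < mc N a) (hδk : δ < curvMin N B ρ (mc N a))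
    (hB : ∀ t, ∀ x q : ℝ → ℝ, IsArc N a t x q → ∀ θ ∈ Icc 0 t, |q θ| ≤ B) :
    Good N a ∧ xEnd N a = (cutFlow N σ δ a (π / 2)).1 ∧
      qEnd N a = (cutFlow N σ δ a (π / 2)).2 := by
  have hY := isCutFlow_cutFlow (by linarith : 0 ≤ N) hσ hδ a
  refine (IsArc.of_cutFlow hN hσ hδ hY (by positivity) le_rfl hpsi hq (fun θ hθ => Or.inl ?_) hρ
    hρa hδa hδk fun t ht h => hB t _ _ h).good
  have hmono := hY.monotoneOn_fst hδ
  have h0 := hmono zero_mem_quarter hθ hθ.1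
  have h1 := hmono hθ pi_div_two_mem_quarter hθ.2
  simp only [hY.zero] at h0
  exact (pow_le_pow_left₀ h0 h1 2).trans hbd

/-- Lower arcs starting close to the origin exist and stay close to the axis `x = 0`. -/
theorem exists_good_small (hN : 1 ≤ N) {ε : ℝ} (hε : 0 < ε) :
    ∃ a₀ > 0, ∀ a ∈ Ioc 0 a₀, Good N a ∧ xEnd N a ≤ ε := by
  wlog hε1 : ε ≤ 1 generalizing ε
  · obtain ⟨a₀, h0, h⟩ := this one_pos le_rfl
    exact ⟨a₀, h0, fun a ha => ⟨(h a ha).1, (h a ha).2.trans (not_le.1 hε1).le⟩⟩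
  set M := √(6 * N) with hMdef
  have hM2 : M ^ 2 = 6 * N := sq_sqrt (by linarith)
  have hM1 : 1 ≤ M := by rw [hMdef]; exact Real.one_le_sqrt.2 (by linarith)
  set B := M * (1 + 1 / (1 / 2)) with hBdef
  have hB0 : 0 < B := by positivity
  set e := min (1 / 2) (ε / (4 * B)) with hedef
  have he0 : 0 < e := by positivity
  have he1 : e ≤ 1 / 2 := min_le_left _ _
  have he2 : 2 * e * B ≤ ε / 2 := by
    have := min_le_right (1 / 2) (ε / (4 * B))
    rw [← hedef, le_div_iff₀ (by positivity)] at this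
    linarith
  set E := exp ((2 + B ^ 2) / 4) with hE
  have hE0 : 0 < E := exp_pos _
  refine ⟨min 1 (ε * e / (2 * π * E)), by positivity, fun a ha => ?_⟩
  have ha0 : 0 < a := ha.1
  have ha1 : a ≤ 1 := ha.2.trans (min_le_left _ _)
  have ha2 : a * E / (e * (1 / 2)) * (π / 2) ≤ ε / 2 := by
    have := ha.2.trans (min_le_right _ _)
    rw [le_div_iff₀ (by positivity)] at this
    have e1 : a * E / (e * (1 / 2)) * (π / 2) = a * (2 * π * E) / (2 * e) := by field_simp
    rw [e1, div_le_iff₀ (by positivity)]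
    linarith
  have hmc : a * mc N a = N - a ^ 2 / 2 := by unfold mc; field_simp
  have hρa : 1 / 2 ≤ a * mc N a := by rw [hmc]; nlinarith
  have hm0 : 0 < mc N a := (mul_pos_iff_of_pos_left ha0).1 (by linarith)
  have hbound : ∀ t, ∀ x q : ℝ → ℝ, IsArc N a t x q → ∀ θ ∈ Icc 0 t, |q θ| ≤ B :=
    fun t x q h => h.abs_le_of_pos ha0 (by norm_num) hρa (ha1.trans hM1) (by rw [hM2]; linarith)
  have hk0 := curvMin_pos hN hB0.le (by norm_num : (0 : ℝ) < 1 / 2) hm0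
  set δ := min a (min (mc N a) (curvMin N B (1 / 2) (mc N a))) / 2 with hδdef
  have hδ0 : 0 < δ := by positivity
  have hδ2 : 2 * δ = min a (min (mc N a) (curvMin N B (1 / 2) (mc N a))) := by rw [hδdef]; ring
  have hδa : 2 * δ ≤ a := hδ2.le.trans (min_le_left _ _)
  have hδm : 2 * δ ≤ mc N a := hδ2.le.trans ((min_le_right _ _).trans (min_le_left _ _))
  have hδk : 2 * δ ≤ curvMin N B (1 / 2) (mc N a) :=
    hδ2.le.trans ((min_le_right _ _).trans (min_le_right _ _))
  have hY := isCutFlow_cutFlow (by linarith : 0 ≤ N) (by norm_num : (1 : ℝ) ^ 2 = 1) hδ0 a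
  set Y := cutFlow N 1 δ a
  have hpsi : 0 < mc N a + 1 / a := by positivity
  have hq : ∀ θ ∈ Icc 0 (π / 2), δ ≤ 1 * (Y θ).2 := fun θ hθ => by
    have := hY.monotoneOn_snd hδ0 zero_mem_quarter hθ hθ.1
    simp only [hY.zero] at this
    linarith
  have hx0 : ∀ θ ∈ Icc 0 (π / 2), 0 ≤ (Y θ).1 := fun θ hθ => by
    have := hY.monotoneOn_fst hδ0 zero_mem_quarter hθ hθ.1
    simpa only [hY.zero] using this
  have hρa' : 1 / 2 ≤ |a| * mc N a := by rwa [abs_of_pos ha0]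
  have harc : ∀ T ∈ Ioc 0 (π / 2), (∀ θ ∈ Icc 0 T, (Y θ).1 ^ 2 ≤ 2) →
      IsArc N a T (fun θ => (Y θ).1) (fun θ => (Y θ).2) ∧ (Y T).1 ≤ ε := fun T hT hx => by
    have h1 := IsArc.of_cutFlow hN (by norm_num) hδ0 hY hT.1 hT.2 hpsi
      (fun θ hθ => hq θ (Icc_subset_Icc_right hT.2 hθ)) (fun θ hθ => Or.inl (hx θ hθ))
      (by norm_num : (0 : ℝ) < 1 / 2) hρa' (by linarith) (by linarith : δ < _)
      fun t ht h => hbound t _ _ h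
    refine ⟨h1, (h1.x_le_of_small ha0 (by norm_num : (0 : ℝ) < 1 / 2) hρa hx (hbound T _ _ h1) he0
      he1 ⟨hT.1.le, le_rfl⟩).trans ?_⟩
    linarith
  have hxle : ∀ θ ∈ Icc 0 (π / 2), (Y θ).1 ^ 2 ≤ 2 := by
    by_contra! hcon
    obtain ⟨s, hs, hs2⟩ := hcon
    have hcont : ContinuousOn (fun θ => 2 - (Y θ).1 ^ 2) (Icc 0 (π / 2)) :=
      continuousOn_const.sub ((continuous_fst.comp_continuousOn hY.continuousOn).pow 2)
    obtain ⟨t, ht, ht2, hlt⟩ := exists_first hcont (d := 0) (by simp [hY.zero])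
      ⟨s, hs, by linarith⟩
    have h1 := (harc t ht fun θ hθ => by
      rcases eq_or_lt_of_le hθ.2 with rfl | hl
      · linarith
      · linarith [hlt θ ⟨hθ.1, hl⟩]).2
    have h2 := hx0 t ⟨ht.1.le, ht.2⟩
    nlinarith
  obtain ⟨h1, h2⟩ := harc (π / 2) ⟨by positivity, le_rfl⟩ hxle
  obtain ⟨hg, hX, -⟩ := h1.good
  exact ⟨hg, hX ▸ h2⟩

theorem pi_div_sqrt_two_lt : π / √2 < 223 / 100 := by
  rw [div_lt_iff₀ (by positivity)]
  have h1 : (1.414 : ℝ) < √2 := lt_sqrt_of_sq_lt (by norm_num)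
  linarith [pi_lt_d4]

theorem mc_neg (N r : ℝ) : mc N (-r) = r / 2 - N / r := by unfold mc; rw [div_neg]; ring

theorem mc_neg_mono (hN : 0 ≤ N) {r s : ℝ} (hr : 0 < r) (h : r ≤ s) : mc N (-r) ≤ mc N (-s) := by
  rw [mc_neg, mc_neg]
  have : N / s ≤ N / r := by gcongr
  linarith

theorem mc_neg_nonneg {r : ℝ} (hr : 0 < r) (h : √(2 * N) ≤ r) : 0 ≤ mc N (-r) := by
  rw [mc_neg, sub_nonneg, div_le_div_iff₀ hr two_pos]
  have := sqrt_le_left (by linarith : (0 : ℝ) ≤ r) |>.1 h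
  nlinarith

/-- Upper arcs starting far from the axis of rotation exist. -/
theorem good_of_large (hN : 1 ≤ N) {R : ℝ} (hR : √(2 * N) + 6 ≤ R) :
    Good N (-R) ∧ qEnd N (-R) ≤ -(R - π / √2) ∧
      xEnd N (-R) ≤ π / (2 * mc N (-(R - π / √2))) := by
  have hN0 : 0 ≤ N := by linarith
  set r₀ := √(2 * N) with hr₀
  have hr2 : r₀ ^ 2 = 2 * N := sq_sqrt (by linarith)
  have hr1 : 1 ≤ r₀ := Real.one_le_sqrt.2 (by linarith)
  have hpi := pi_div_sqrt_two_lt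
  have hR0 : 0 < R := by linarith
  have hm0 : 0 < mc N (-R) := by
    rw [mc_neg, sub_pos, div_lt_div_iff₀ hR0 two_pos]; nlinarith
  have hρ : 0 < R * mc N (-R) := by positivity
  have habs : |-R| = R := by rw [abs_neg, abs_of_pos hR0]
  have hpsi : 0 < mc N (-R) + 1 / (-R) := by
    rw [mc_neg, div_neg]
    have : R / 2 - N / R + -(1 / R) = (R ^ 2 / 2 - N - 1) / R := by field_simp; ring
    rw [this]
    exact div_pos (by nlinarith) hR0
  have hk0 := curvMin_pos hN hR0.le hρ hm0
  set δ := min r₀ (min (mc N (-R)) (curvMin N R (R * mc N (-R)) (mc N (-R)))) / 2 with hδdef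
  have hδ0 : 0 < δ := by positivity
  have hδ2 : 2 * δ = min r₀ (min (mc N (-R)) (curvMin N R (R * mc N (-R)) (mc N (-R)))) := by
    rw [hδdef]; ring
  have hδa : 2 * δ ≤ r₀ := hδ2.le.trans (min_le_left _ _)
  have hδm : 2 * δ ≤ mc N (-R) := hδ2.le.trans ((min_le_right _ _).trans (min_le_left _ _))
  have hδk : 2 * δ ≤ curvMin N R (R * mc N (-R)) (mc N (-R)) :=
    hδ2.le.trans ((min_le_right _ _).trans (min_le_right _ _))
  have hσ : (-1 : ℝ) ^ 2 = 1 := by norm_num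
  have hY := isCutFlow_cutFlow hN0 hσ hδ0 (-R)
  set Y := cutFlow N (-1) δ (-R)
  have harc : ∀ T ∈ Ioc 0 (π / 2), (∀ θ ∈ Icc 0 T, r₀ ≤ -(Y θ).2) →
      IsArc N (-R) T (fun θ => (Y θ).1) (fun θ => (Y θ).2) ∧
        ∀ θ ∈ Icc 0 T, (Y θ).2 + R ≤ π / √2 := fun T hT hq => by
    have hm : ∀ θ ∈ Icc 0 T, 0 ≤ mc N (Y θ).2 := fun θ hθ => by
      have := mc_neg_nonneg (by linarith [hq θ hθ] : 0 < -(Y θ).2) (hq θ hθ)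
      rwa [neg_neg] at this
    have h1 := IsArc.of_cutFlow hN hσ hδ0 hY hT.1 hT.2 hpsi
      (fun θ hθ => by linarith [hq θ hθ]) (fun θ hθ => Or.inr (hm θ hθ))
      hρ (by rw [habs]) (by linarith) (by linarith : δ < _)
      fun t ht h => by simpa using h.abs_le_of_neg (by linarith)
    refine ⟨h1, h1.le_of_continuous (h1.continuousOn_q.add continuousOn_const) fun θ hθ => ?_⟩
    have := h1.sub_le_of_mc_nonneg hm hθ
    change (Y θ).2 + R ≤ π / √2
    linarith
  have hqle : ∀ θ ∈ Icc 0 (π / 2), r₀ ≤ -(Y θ).2 := by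
    by_contra! hcon
    obtain ⟨s, hs, hs2⟩ := hcon
    have hcont : ContinuousOn (fun θ => -(Y θ).2) (Icc 0 (π / 2)) :=
      (continuous_snd.comp_continuousOn hY.continuousOn).neg
    obtain ⟨t, ht, ht2, hlt⟩ := exists_first hcont (d := r₀) (by simp only [hY.zero]; linarith)
      ⟨s, hs, hs2.le⟩
    have h1 := (harc t ht fun θ hθ => by
      rcases eq_or_lt_of_le hθ.2 with rfl | hl
      · linarith
      · linarith [hlt θ ⟨hθ.1, hl⟩]).2 t ⟨ht.1.le, le_rfl⟩
    linarith
  obtain ⟨h1, h2⟩ := harc (π / 2) ⟨by positivity, le_rfl⟩ hqle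
  obtain ⟨hg, hX, hQ⟩ := h1.good
  have h3 := h2 _ pi_div_two_mem_quarter
  refine ⟨hg, by rw [hQ]; linarith, ?_⟩
  rw [hX]
  have hR1 : r₀ < R - π / √2 := by linarith
  refine h1.x_le_of_mc ?_ (fun θ hθ => ?_) pi_div_two_mem_quarter
  · rw [mc_neg, sub_pos, div_lt_div_iff₀ (by linarith) two_pos]; nlinarith
  · have := mc_neg_mono hN0 (by linarith : 0 < R - π / √2)
      (by linarith [h2 θ hθ] : R - π / √2 ≤ -(Y θ).2)
    rwa [neg_neg] at this

end

section

/-! ### Monotone dependence and comparison of lengths -/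

/-- The length density of the half-line `x = 0`, extended evenly. -/
noncomputable def axisDens (N q : ℝ) : ℝ := |q| ^ N * exp (-(1 / 4) * q ^ 2)

/-- The length of the half-line `x = 0`. -/
noncomputable def axisLen (N : ℝ) : ℝ := ∫ s in Ioi 0, axisDens N s

/-- The difference of the length of an axis segment and that of an arc with the same end
position. -/
noncomputable def gap (N a : ℝ) : ℝ := (∫ s in (0 : ℝ)..qEnd N a, axisDens N s) - len N a

variable {N a : ℝ}

theorem continuous_axisDens (hN : 0 ≤ N) : Continuous (axisDens N) := by
  unfold axisDens
  exact (continuous_abs.rpow_const fun _ => Or.inr hN).mul (by fun_prop)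

theorem axisDens_nonneg (N q : ℝ) : 0 ≤ axisDens N q := by unfold axisDens; positivity

theorem axisDens_neg (N q : ℝ) : axisDens N (-q) = axisDens N q := by simp [axisDens]

theorem axisDens_eq {q : ℝ} (hq : q ≠ 0) : axisDens N q = wt N 0 q := by
  unfold axisDens wt
  rw [rpow_def_of_pos (abs_pos.2 hq), ← exp_add, log_abs]
  ring_nf

theorem wt_le_axisDens (x : ℝ) {q : ℝ} (hq : q ≠ 0) : wt N x q ≤ axisDens N q := by
  rw [axisDens_eq hq]
  unfold wt
  exact exp_le_exp.2 (by nlinarith [sq_nonneg x])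

theorem wt_lt_axisDens {x q : ℝ} (hx : x ≠ 0) (hq : q ≠ 0) : wt N x q < axisDens N q := by
  rw [axisDens_eq hq]
  unfold wt
  exact exp_lt_exp.2 (by have := sq_pos_of_ne_zero hx; linarith)

theorem exists_axisDens_le (hN : 1 ≤ N) : ∃ C > 0, ∀ q, q ≠ 0 → axisDens N q ≤ C := by
  refine ⟨exp (N / 2 * log (2 * N)), exp_pos _, fun q hq => ?_⟩
  rw [axisDens_eq hq, wt]
  refine exp_le_exp.2 ?_
  have h0 : 0 < q ^ 2 := by positivity
  have h1 := log_le_sub_one_of_pos (show 0 < q ^ 2 / (2 * N) by positivity)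
  rw [log_div h0.ne' (by positivity), log_pow] at h1
  push_cast at h1
  have h2 : N * (q ^ 2 / (2 * N)) = q ^ 2 / 2 := by field_simp
  have h3 := mul_le_mul_of_nonneg_left h1 (by linarith : 0 ≤ N)
  have h4 : N * (q ^ 2 / (2 * N) - 1) = q ^ 2 / 2 - N := by rw [← h2]; ring
  rw [h4] at h3
  nlinarith

theorem integrableOn_axisDens (hN : 0 ≤ N) : IntegrableOn (axisDens N) (Ioi 0) := by
  refine (integrableOn_rpow_mul_exp_neg_mul_sq (by norm_num : (0 : ℝ) < 1 / 4)
    (by linarith : -1 < N)).congr_fun (fun s hs => ?_) measurableSet_Ioi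
  rw [axisDens, abs_of_pos hs]

theorem integral_axisDens_le (hN : 0 ≤ N) {R : ℝ} (hR : 0 ≤ R) :
    ∫ s in (0 : ℝ)..R, axisDens N s ≤ axisLen N := by
  rw [intervalIntegral.integral_of_le hR]
  exact setIntegral_mono_set (integrableOn_axisDens hN)
    (Eventually.of_forall fun s => axisDens_nonneg N s) Ioc_subset_Ioi_self.eventuallyLE

theorem integral_axisDens_neg (N R : ℝ) :
    ∫ s in (0 : ℝ)..-R, axisDens N s = -∫ s in (0 : ℝ)..R, axisDens N s := by
  rw [intervalIntegral.integral_symm]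
  have := intervalIntegral.integral_comp_neg (axisDens N) (a := 0) (b := R)
  simp only [axisDens_neg, neg_zero] at this
  rw [← this]

namespace Good

theorem ne_zero (h : Good N a) : a ≠ 0 := h.isSol.a_ne

theorem xEnd_pos (h : Good N a) : 0 < xEnd N a := h.isArc.x_pos ⟨by positivity, le_rfl⟩

theorem xEnd_le (h : Good N a) : xEnd N a ≤ √2 := le_sqrt_of_sq_le h.bound

theorem qEnd_ne (h : Good N a) : qEnd N a ≠ 0 := h.isSol.ne_zero pi_div_two_mem_quarter

theorem lt_qEnd (h : Good N a) : a < qEnd N a := by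
  have := h.isArc.strictMonoOn_q zero_mem_quarter pi_div_two_mem_quarter (by positivity)
  simpa [qEnd, h.isSol.zero] using this

theorem inv_le_xEnd (h : Good N a) : 1 ≤ mc N a * xEnd N a := by
  simpa [xEnd] using h.isArc.sin_le_mul_x (θ := π / 2) ⟨by positivity, le_rfl⟩

theorem exists_deriv (h : Good N a) : ∃ ξ η : ℝ, 0 < η ∧ HasDerivAt (xEnd N) ξ a ∧
    HasDerivAt (qEnd N) η a ∧ HasDerivAt (len N) (wt N (xEnd N a) (qEnd N a) * η) a := by
  have hN : 0 ≤ N := by linarith [h.N_pos]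
  obtain ⟨ξ, η, hJ⟩ := h.isSol.exists_isJacobi hN
  obtain ⟨h1, h2⟩ := h.isSol.hasDerivAt_end hN hJ
  refine ⟨ξ (π / 2), η (π / 2), ?_, h1.fst, h1.snd, h2⟩
  rcases lt_or_gt_of_ne h.ne_zero with ha | ha
  · exact h.isArc.η_pos_upper hJ h.bound ha _ pi_div_two_mem_quarter
  · exact h.isArc.η_pos_lower hJ h.bound ha _ pi_div_two_mem_quarter

theorem continuousAt_xEnd (h : Good N a) : ContinuousAt (xEnd N) a := by
  obtain ⟨ξ, η, -, h1, -⟩ := h.exists_deriv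
  exact h1.continuousAt

theorem continuousAt_qEnd (h : Good N a) : ContinuousAt (qEnd N) a := by
  obtain ⟨ξ, η, -, -, h1, -⟩ := h.exists_deriv
  exact h1.continuousAt

theorem exists_deriv_gap (h : Good N a) : ∃ d > 0, HasDerivAt (gap N) d a := by
  have hN : 0 ≤ N := by linarith [h.N_pos]
  obtain ⟨ξ, η, hη, -, hq, hl⟩ := h.exists_deriv
  have hI : HasDerivAt (fun u => ∫ s in (0 : ℝ)..u, axisDens N s) (axisDens N (qEnd N a))
      (qEnd N a) :=
    intervalIntegral.integral_hasDerivAt_right ((continuous_axisDens hN).intervalIntegrable _ _)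
      ((continuous_axisDens hN).stronglyMeasurableAtFilter _ _)
          (continuous_axisDens hN).continuousAt
  refine ⟨_, ?_, (hI.comp a hq).sub hl⟩
  rw [← sub_mul]
  exact mul_pos (sub_pos.2 (wt_lt_axisDens h.xEnd_pos.ne' h.qEnd_ne)) hη

theorem len_le (h : Good N a) {C : ℝ} (hC : ∀ q, q ≠ 0 → axisDens N q ≤ C) :
    len N a ≤ (∫ s in a..qEnd N a, axisDens N s) + C * xEnd N a := by
  have hN : 0 ≤ N := by linarith [h.N_pos]
  have harc := h.isArc
  have hcq : ContinuousOn (fun θ => axisDens N (sol N a θ).2) (Icc 0 (π / 2)) :=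
    (continuous_axisDens hN).comp_continuousOn harc.continuousOn_q
  have hk : ∀ θ ∈ Icc 0 (π / 2), curv N θ (sol N a θ).1 (sol N a θ).2 ≠ 0 :=
    fun θ hθ => (harc.curv_pos θ hθ).ne'
  have hd : ∀ θ ∈ uIcc 0 (π / 2),
      HasDerivAt (fun θ => (∫ s in a..(sol N a θ).2, axisDens N s) + C * (sol N a θ).1)
      (axisDens N (sol N a θ).2 * (sin θ / curv N θ (sol N a θ).1 (sol N a θ).2) +
        C * (cos θ / curv N θ (sol N a θ).1 (sol N a θ).2)) θ := fun θ hθ => by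
    rw [uIcc_of_le zero_mem_quarter.2] at hθ
    have hI : HasDerivAt (fun u => ∫ s in a..u, axisDens N s) (axisDens N (sol N a θ).2)
        (sol N a θ).2 :=
      intervalIntegral.integral_hasDerivAt_right ((continuous_axisDens hN).intervalIntegrable _ _)
        ((continuous_axisDens hN).stronglyMeasurableAtFilter _ _)
          (continuous_axisDens hN).continuousAt
    exact (hI.comp θ (harc.hasDerivAt_q θ hθ)).add ((harc.hasDerivAt_x θ hθ).const_mul C)
  have hcont : ContinuousOn (fun θ =>
      axisDens N (sol N a θ).2 * (sin θ / curv N θ (sol N a θ).1 (sol N a θ).2) +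
        C * (cos θ / curv N θ (sol N a θ).1 (sol N a θ).2)) (Icc 0 (π / 2)) :=
    (hcq.mul (continuous_sin.continuousOn.div harc.continuousOn_curv hk)).add
      (continuousOn_const.mul (continuous_cos.continuousOn.div harc.continuousOn_curv hk))
  have hIt : IntervalIntegrable (fun θ =>
      axisDens N (sol N a θ).2 * (sin θ / curv N θ (sol N a θ).1 (sol N a θ).2) +
        C * (cos θ / curv N θ (sol N a θ).1 (sol N a θ).2)) volume 0 (π / 2) :=
    ContinuousOn.intervalIntegrable (by rwa [uIcc_of_le zero_mem_quarter.2])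
  have hIt' : IntervalIntegrable (fun θ => dens N (θ, sol N a θ)) volume 0 (π / 2) :=
    ContinuousOn.intervalIntegrable (by
      rw [uIcc_of_le zero_mem_quarter.2]; exact h.isSol.continuousOn_dens)
  have h1 := intervalIntegral.integral_eq_sub_of_hasDerivAt hd hIt
  have h2 := intervalIntegral.integral_mono_on zero_mem_quarter.2 hIt' hIt fun θ hθ => by
    have hk := harc.curv_pos θ hθ
    have hs := harc.sin_nonneg' hθ
    have hc := harc.cos_nonneg' hθ
    have hq : (sol N a θ).2 ≠ 0 := h.isSol.ne_zero hθ
    have hw := wt_le_axisDens (N := N) (sol N a θ).1 hq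
    have hwC := hw.trans (hC _ hq)
    have hw0 := wt_pos N (sol N a θ).1 (sol N a θ).2
    have hsc : 1 ≤ sin θ + cos θ := by
      nlinarith [sin_sq_add_cos_sq θ, sin_le_one θ, cos_le_one θ]
    rw [dens, ← mul_div_assoc, ← mul_div_assoc, ← add_div]
    refine div_le_div_of_nonneg_right ?_ hk.le
    have h3 := mul_le_mul_of_nonneg_right hw hs
    have h4 := mul_le_mul_of_nonneg_right hwC hc
    have h5 := mul_le_mul_of_nonneg_left hsc hw0.le
    dsimp only
    linarith
  rw [h1] at h2
  simpa [len, qEnd, xEnd, h.isSol.zero] using h2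

theorem le_gap (h : Good N a) {C : ℝ} (hC : ∀ q, q ≠ 0 → axisDens N q ≤ C) :
    (∫ s in (0 : ℝ)..a, axisDens N s) - C * xEnd N a ≤ gap N a := by
  have hN : 0 ≤ N := by linarith [h.N_pos]
  have h1 := h.len_le hC
  have h2 := intervalIntegral.integral_add_adjacent_intervals
    ((continuous_axisDens hN).intervalIntegrable (μ := volume) 0 a)
    ((continuous_axisDens hN).intervalIntegrable (μ := volume) a (qEnd N a))
  unfold gap
  linarith

end Good

theorem strictMonoOn_qEnd {s : Set ℝ} (hs : Convex ℝ s) (h : ∀ a ∈ s, Good N a) :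
    StrictMonoOn (qEnd N) s := by
  refine strictMonoOn_of_deriv_pos hs
    (fun a ha => (h a ha).continuousAt_qEnd.continuousWithinAt) fun a ha => ?_
  obtain ⟨ξ, η, hη, -, h1, -⟩ := (h a (interior_subset ha)).exists_deriv
  rwa [h1.deriv]

theorem strictMonoOn_gap {s : Set ℝ} (hs : Convex ℝ s) (h : ∀ a ∈ s, Good N a) :
    StrictMonoOn (gap N) s := by
  refine strictMonoOn_of_deriv_pos hs (fun a ha => ?_) fun a ha => ?_
  · obtain ⟨d, -, h1⟩ := (h a ha).exists_deriv_gap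
    exact h1.continuousAt.continuousWithinAt
  · obtain ⟨d, hd, h1⟩ := (h a (interior_subset ha)).exists_deriv_gap
    rwa [h1.deriv]

/-- Lower arcs are shorter than the corresponding segment of the axis. -/
theorem gap_pos (ha : 0 < a) (h : ∀ s ∈ Ioc 0 a, Good N s) : 0 < gap N a := by
  have hN := (h a ⟨ha, le_rfl⟩).N_pos
  obtain ⟨C, hC0, hC⟩ := exists_axisDens_le hN
  have hmono := strictMonoOn_gap (convex_Ioc 0 a) h
  refine lt_of_le_of_lt ?_
      (hmono (a := a / 2) ⟨by linarith, by linarith⟩ ⟨ha, le_rfl⟩ (by linarith))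
  refine le_of_forall_pos_sub_le fun ε hε => ?_
  obtain ⟨a₀, ha₀, h₀⟩ := exists_good_small hN (show 0 < ε / C by positivity)
  have hs0 : 0 < min a₀ (a / 2) := by positivity
  have hs2 : min a₀ (a / 2) ≤ a / 2 := min_le_right _ _
  obtain ⟨hg, hx⟩ := h₀ _ ⟨hs0, min_le_left _ _⟩
  have h1 := hmono.monotoneOn ⟨hs0, by linarith⟩ ⟨by linarith, by linarith⟩ hs2
  have h2 := hg.le_gap hC
  have h3 : 0 ≤ ∫ s in (0 : ℝ)..min a₀ (a / 2), axisDens N s :=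
    intervalIntegral.integral_nonneg hs0.le fun s _ => axisDens_nonneg N s
  rw [le_div_iff₀ hC0] at hx
  linarith

/-- Upper arcs are shorter than the corresponding segment of the axis. -/
theorem neg_axisLen_lt_gap (ha : a < 0) (h : ∀ s ≤ a, Good N s) : -axisLen N < gap N a := by
  have hN := (h a le_rfl).N_pos
  have hN0 : 0 ≤ N := by linarith
  obtain ⟨C, hC0, hC⟩ := exists_axisDens_le hN
  have hmono := strictMonoOn_gap (convex_Iic a) h
  refine lt_of_le_of_lt ?_
      (hmono (a := a - 1) (by simp) (by simp) (by linarith))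
  refine le_of_forall_pos_sub_le fun ε hε => ?_
  set R := √(2 * N) + 6 + (1 - a) + 2 * N + π * C / ε with hR
  have hr : 0 ≤ √(2 * N) := sqrt_nonneg _
  have hpC : 0 < π * C / ε := by positivity
  obtain ⟨hg, -, hx⟩ := good_of_large hN (show √(2 * N) + 6 ≤ R by linarith)
  have hpi := pi_div_sqrt_two_lt
  have h1 := hmono.monotoneOn (show -R ≤ a by linarith) (show a - 1 ≤ a by linarith)
    (by linarith : -R ≤ a - 1)
  have h2 := hg.le_gap hC
  rw [integral_axisDens_neg] at h2
  have h3 := integral_axisDens_le hN0 (by linarith : 0 ≤ R)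
  have hm : π * C / ε / 2 ≤ mc N (-(R - π / √2)) := by
    rw [mc_neg]
    have : N / (R - π / √2) ≤ N := div_le_self hN0 (by linarith)
    linarith
  have h4 : C * xEnd N (-R) ≤ ε := by
    have h5 : xEnd N (-R) ≤ π / (2 * (π * C / ε / 2)) := hx.trans (by gcongr)
    have h6 : π / (2 * (π * C / ε / 2)) = ε / C := by field_simp
    rw [h6, le_div_iff₀ hC0] at h5
    linarith
  linarith

end

section

/-! ### Matching a lower and an upper arc -/

variable {N a : ℝ}

/-- Two curves in the plane, the first of which is a graph over the second coordinate, meet if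
their end points are suitably ordered. -/
theorem exists_match {F G U V : ℝ → ℝ} {α β γ κ : ℝ} (hαβ : α ≤ β) (hγκ : γ ≤ κ)
    (hF : ContinuousOn F (Icc α β)) (hG : ContinuousOn G (Icc α β)) (hGm : StrictMonoOn G (Icc α β))
    (hU : ContinuousOn U (Icc γ κ)) (hV : ContinuousOn V (Icc γ κ))
    (hVm : ∀ c ∈ Icc γ κ, V c ∈ Icc (G α) (G β))
    (h₁ : ∀ a ∈ Icc α β, G a = V γ → U γ ≤ F a) (h₂ : ∀ a ∈ Icc α β, G a = V κ → F a ≤ U κ) :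
    ∃ a ∈ Icc α β, ∃ c ∈ Icc γ κ, G a = V c ∧ F a = U c := by
  have hinj : Function.Injective fun a : Icc α β => G a := fun a b hab =>
    Subtype.ext (hGm.injOn a.2 b.2 hab)
  have hGc : Continuous fun a : Icc α β => G a := continuousOn_iff_continuous_domRestrict.1 hG
  have hFc : Continuous fun a : Icc α β => F a := continuousOn_iff_continuous_domRestrict.1 hF
  let e := (hGc.isClosedEmbedding hinj).isEmbedding.toHomeomorph
  have hmem : ∀ c : Icc γ κ, V c ∈ range fun a : Icc α β => G a := fun c => by
    obtain ⟨a, ha, h⟩ := intermediate_value_Icc hαβ hG (hVm c c.2)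
    exact ⟨⟨a, ha⟩, h⟩
  let b : Icc γ κ → Icc α β := fun c => e.symm ⟨V c, hmem c⟩
  have hbc : Continuous b := e.symm.continuous.comp
    ((continuousOn_iff_continuous_domRestrict.1 hV).subtype_mk hmem)
  have hb : ∀ c, G (b c) = V c := fun c => congrArg Subtype.val (e.apply_symm_apply ⟨V c, hmem c⟩)
  have : PreconnectedSpace (Icc γ κ) := isPreconnected_iff_preconnectedSpace.1 isPreconnected_Icc
  have hUc : Continuous fun c : Icc γ κ => U c := continuousOn_iff_continuous_domRestrict.1 hU
  obtain ⟨c, hc⟩ := intermediate_value_univ (⟨κ, hγκ, le_rfl⟩ : Icc γ κ) ⟨γ, le_rfl, hγκ⟩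
    ((hFc.comp hbc).sub hUc) (show (0 : ℝ) ∈ Icc _ _ from
      ⟨sub_nonpos.2 (h₂ _ (b _).2 (hb _)), sub_nonneg.2 (h₁ _ (b _).2 (hb _))⟩)
  exact ⟨b c, (b c).2, c, c.2, hb c, sub_eq_zero.1 hc⟩

theorem curvMin_anti {B ρ m m' : ℝ} (hN : 1 ≤ N) (hB : 0 ≤ B) (hρ : 0 < ρ) (hm : 0 < m)
    (h : m ≤ m') : curvMin N B ρ m' ≤ curvMin N B ρ m := by
  unfold curvMin; gcongr

theorem mc_anti (hN : 0 ≤ N) {p q : ℝ} (hp : 0 < p) (h : p ≤ q) : mc N q ≤ mc N p := by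
  unfold mc; gcongr

/-- The end point of an arc that ends on the convex side of the stationary position lies strictly
inside the strip `x ^ 2 ≤ 2`. -/
theorem IsArc.sq_x_end_lt {x q : ℝ → ℝ} (h : IsArc N a (π / 2) x q)
    (hm : 0 ≤ mc N (q (π / 2))) : x (π / 2) ^ 2 < 2 := by
  have hmem : π / 2 ∈ Ioc 0 (π / 2) := ⟨h.b_pos, le_rfl⟩
  have hmpos : ∀ t ∈ Ioo 0 (π / 2), 0 < mc N (q t) := fun t ht => by
    refine hm.trans_lt ?_
    have hanti : StrictAntiOn (fun θ => mc N (q θ)) (Icc 0 (π / 2)) := by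
      refine strictAntiOn_of_deriv_neg (convex_Icc _ _) h.continuousOn_mc fun s hs => ?_
      rw [interior_Icc] at hs
      have hs' := Ioo_subset_Icc_self hs
      rw [(h.hasDerivAt_mc hs').deriv, neg_mul, neg_lt_zero]
      have := h.N_pos
      exact mul_pos (by positivity)
        (div_pos (h.sin_pos' (Ioo_subset_Ioc_self hs)) (h.curv_pos s hs'))
    exact hanti (Ioo_subset_Icc_self ht) (Ioc_subset_Icc_self hmem) ht.2
  have hcont : ContinuousOn (fun θ => zf N θ (x θ) (q θ)) (Ioc 0 (π / 2)) :=
    continuousOn_const.sub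
      (((h.continuousOn_curv.mul h.continuousOn_x).mono Ioc_subset_Icc_self).div
      continuous_sin.continuousOn fun θ hθ => (h.sin_pos' hθ).ne')
  have hmono : StrictMonoOn (fun θ => zf N θ (x θ) (q θ)) (Ioc 0 (π / 2)) := by
    refine strictMonoOn_of_deriv_pos (convex_Ioc _ _) hcont fun s hs => ?_
    rw [interior_Ioc] at hs
    rw [(h.hasDerivAt_zf hs).deriv]
    have h1 := h.growth_pos hs
    have h2 := h.zf_lt_one hs
    have h3 := h.pf_pos ⟨hs.1.le, hs.2⟩
    have h4 := h.pif_pos hs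
    have h5 := div_pos (h.sin_pos' (Ioo_subset_Ioc_self hs)) (h.curv_pos s (Ioo_subset_Icc_self hs))
    have h6 := hmpos s hs
    have h7 : 0 < 1 - zf N s (x s) (q s) := by linarith
    positivity
  have hhalf : π / 2 / 2 ∈ Ioo 0 (π / 2) := ⟨by positivity, by linarith [pi_pos]⟩
  have h1 := h.zf_nonneg _ hhalf
  have h2 := hmono (Ioo_subset_Ioc_self hhalf) hmem hhalf.2
  have h3 : 0 < zf N (π / 2) (x (π / 2)) (q (π / 2)) := h1.trans_lt h2
  simp only [zf, curv, cos_pi_div_two, sin_pi_div_two] at h3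
  nlinarith

theorem Good.mc_qEnd_neg (h : Good N a) (hx : xEnd N a = √2) : mc N (qEnd N a) < 0 := by
  by_contra! hc
  have h1 := h.isArc.sq_x_end_lt hc
  have h2 : xEnd N a ^ 2 < 2 := h1
  rw [hx, sq_sqrt (by norm_num)] at h2
  exact lt_irrefl _ h2

/-- The truncated flow agrees with a good trajectory if the truncation is fine enough. -/
theorem Good.cutFlow_end {σ δ B ρ : ℝ} (h : Good N a) (hσ : σ ^ 2 = 1) (hδ : 0 < δ)
    (hq : ∀ θ ∈ Icc 0 (π / 2), δ ≤ σ * (sol N a θ).2) (hρ : 0 < ρ) (hρa : ρ ≤ |a| * mc N a)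
    (hδk : δ < curvMin N B ρ (mc N a))
    (hB : ∀ t, ∀ x q : ℝ → ℝ, IsArc N a t x q → ∀ θ ∈ Icc 0 t, |q θ| ≤ B) :
    cutFlow N σ δ a (π / 2) = sol N a (π / 2) := by
  have hN : 0 ≤ N := by linarith [h.N_pos]
  have h1 := h.isSol.isCutFlow (δ := δ) hσ hq fun θ hθ =>
    hδk.le.trans (h.isArc.curvMin_le (hB _ _ _ h.isArc) hρ hρa hθ)
  have := (isCutFlow_cutFlow hN hσ hδ a).dist_le hN hσ hδ h1 pi_div_two_mem_quarter
  rw [sub_self, abs_zero, mul_zero] at this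
  exact dist_le_zero.1 this

/-- The positions of mean curvature `mc` equal to `1 / √2`. -/
theorem exists_mc_eq (hN : 1 ≤ N) : ∃ p r : ℝ, 0 < p ∧ p < √(2 * N) ∧ √2 < r ∧ r < √(2 * N) + 2 ∧
    p ^ 2 + √2 * p = 2 * N ∧ r ^ 2 = √2 * r + 2 * N := by
  have h2 : √2 ^ 2 = 2 := sq_sqrt (by norm_num)
  have h20 : 0 < √2 := by positivity
  have hr2 : √(2 * N) ^ 2 = 2 * N := sq_sqrt (by linarith)
  have hr0 : 0 < √(2 * N) := by positivity
  have hs2 : √(2 + 8 * N) ^ 2 = 2 + 8 * N := sq_sqrt (by linarith)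
  have hs0 : 0 < √(2 + 8 * N) := by positivity
  have hlt : √(2 + 8 * N) < √2 + 2 * √(2 * N) := by
    refine lt_of_pow_lt_pow_left₀ 2 (by positivity) ?_
    nlinarith [mul_pos h20 hr0]
  have hgt : 2 * √2 < √(2 + 8 * N) := by
    refine lt_of_pow_lt_pow_left₀ 2 hs0.le ?_
    nlinarith
  have h2lt : √2 < 3 / 2 := by
    rw [sqrt_lt' (by norm_num)]; norm_num
  exact ⟨(√(2 + 8 * N) - √2) / 2, (√(2 + 8 * N) + √2) / 2, by linarith, by linarith, by linarith,
    by linarith, by nlinarith, by nlinarith⟩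

/-- The lower arcs up to the first one ending at the boundary of the strip `x ^ 2 ≤ 2`. -/
theorem exists_lower (hN : 1 ≤ N) {ε : ℝ} (hε : 0 < ε) :
    ∃ α β : ℝ, 0 < α ∧ α < β ∧ (∀ s ∈ Ioc 0 β, Good N s) ∧ xEnd N α ≤ ε ∧ xEnd N β = √2 := by
  have hN0 : 0 ≤ N := by linarith
  obtain ⟨p, -, hp0, hpr, -, -, hp, -⟩ := exists_mc_eq hN
  obtain ⟨a₀, ha₀, hsmall⟩ := exists_good_small hN (show 0 < min ε 1 by positivity)
  have h2 : √2 ^ 2 = 2 := sq_sqrt (by norm_num)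
  have h20 : 0 < √2 := by positivity
  have h21 : 1 < √2 := by nlinarith
  have hr2 : √(2 * N) ^ 2 = 2 * N := sq_sqrt (by linarith)
  set α := min a₀ (p / 2) with hα
  have hα0 : 0 < α := by positivity
  have hαp : α < p := (min_le_right _ _).trans_lt (by linarith)
  have hmc : ∀ a, 0 < a → a * mc N a = N - a ^ 2 / 2 := fun a ha => by unfold mc; field_simp
  have hmp : 2 * mc N p = √2 := by
    have h3 := hmc p hp0
    have : p * (2 * mc N p) = p * √2 := by linarith
    exact mul_left_cancel₀ hp0.ne' this
  set ρ := N - p ^ 2 / 2 with hρ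
  have hρ0 : 0 < ρ := by rw [hρ]; nlinarith
  set M := max p √(2 * (N + N / ρ)) with hM
  have hM2 : 2 * (N + N / ρ) ≤ M ^ 2 := by
    have h1 : √(2 * (N + N / ρ)) ≤ M := le_max_right _ _
    calc 2 * (N + N / ρ) = √(2 * (N + N / ρ)) ^ 2 := (sq_sqrt (by positivity)).symm
      _ ≤ M ^ 2 := by gcongr
  have hpM : p ≤ M := le_max_left _ _
  set B := M * (1 + 1 / ρ) with hBdef
  have hB0 : 0 ≤ B := by have : 0 < M := hp0.trans_le hpM; positivity
  have hmα : 0 < mc N α := by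
    have := mc_anti hN0 hα0 hαp.le; linarith
  have hk0 := curvMin_pos hN hB0 hρ0 hmα
  set δ := min α (min (mc N p) (curvMin N B ρ (mc N α))) / 2 with hδdef
  have hmp0 : 0 < mc N p := by linarith
  have hδ0 : 0 < δ := by positivity
  have hδ2 : 2 * δ = min α (min (mc N p) (curvMin N B ρ (mc N α))) := by rw [hδdef]; ring
  have hδa : 2 * δ ≤ α := hδ2.le.trans (min_le_left _ _)
  have hδm : 2 * δ ≤ mc N p := hδ2.le.trans ((min_le_right _ _).trans (min_le_left _ _))
  have hδk : 2 * δ ≤ curvMin N B ρ (mc N α) :=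
    hδ2.le.trans ((min_le_right _ _).trans (min_le_right _ _))
  have hσ : (1 : ℝ) ^ 2 = 1 := by norm_num
  have hρa : ∀ a ∈ Icc α p, ρ ≤ |a| * mc N a := fun a ha => by
    have ha0 := hα0.trans_le ha.1
    rw [abs_of_pos ha0, hmc a ha0, hρ]
    have := pow_le_pow_left₀ ha0.le ha.2 2
    linarith
  have hBa : ∀ a ∈ Icc α p, ∀ t, ∀ x q : ℝ → ℝ, IsArc N a t x q → ∀ θ ∈ Icc 0 t, |q θ| ≤ B :=
    fun a ha t x q h => h.abs_le_of_pos (hα0.trans_le ha.1) hρ0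
      (by simpa [abs_of_pos (hα0.trans_le ha.1)] using hρa a ha) (ha.2.trans hpM) hM2
  have hδka : ∀ a ∈ Icc α p, δ < curvMin N B ρ (mc N a) := fun a ha => by
    have h1 := mc_anti hN0 (hα0.trans_le ha.1) ha.2
    have h3 := curvMin_anti hN hB0 hρ0 (hmp0.trans_le h1) (mc_anti hN0 hα0 ha.1)
    linarith
  have hgood : ∀ a ∈ Icc α p, (cutFlow N 1 δ a (π / 2)).1 ≤ √2 →
      Good N a ∧ xEnd N a = (cutFlow N 1 δ a (π / 2)).1 := fun a ha hx => by
    have ha0 := hα0.trans_le ha.1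
    have hY := isCutFlow_cutFlow hN0 hσ hδ0 a
    have hma := hmp0.trans_le (mc_anti hN0 ha0 ha.2)
    have hx0 := hY.monotoneOn_fst hδ0 zero_mem_quarter pi_div_two_mem_quarter
      pi_div_two_mem_quarter.1
    simp only [hY.zero] at hx0
    obtain ⟨h3, h4, -⟩ := good_of_cutFlow hN hσ hδ0 (by positivity) (fun θ hθ => by
        have := hY.monotoneOn_snd hδ0 zero_mem_quarter hθ hθ.1
        simp only [hY.zero] at this
        linarith [ha.1]) (by have h3 := pow_le_pow_left₀ hx0 hx 2; rwa [h2] at h3) hρ0 (hρa a ha)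
      (by linarith [mc_anti hN0 ha0 ha.2]) (hδka a ha) (hBa a ha)
    exact ⟨h3, h4⟩
  have hαg := hsmall α ⟨hα0, min_le_left _ _⟩
  have hαX : (cutFlow N 1 δ α (π / 2)).1 < √2 := by
    have hαm : α ∈ Icc α p := ⟨le_rfl, hαp.le⟩
    rw [hαg.1.cutFlow_end hσ hδ0 (fun θ hθ => by
      have := hαg.1.isArc.strictMonoOn_q.monotoneOn zero_mem_quarter hθ hθ.1
      simp only [hαg.1.isSol.zero] at this
      linarith) hρ0 (hρa α hαm) (hδka α hαm) (hBa α hαm)]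
    exact (hαg.2.trans (min_le_right _ _)).trans_lt h21
  have hpX : √2 ≤ (cutFlow N 1 δ p (π / 2)).1 := by
    by_contra! hc
    obtain ⟨h3, h4⟩ := hgood p ⟨hαp.le, le_rfl⟩ hc.le
    have h5 := h3.inv_le_xEnd
    rw [h4] at h5
    nlinarith
  have hcont : ContinuousOn (fun a => √2 - (cutFlow N 1 δ a (π / 2)).1) (Icc α p) :=
    (continuous_const.sub (continuous_fst.comp
      (continuous_cutFlow hN0 hσ hδ0 pi_div_two_mem_quarter))).continuousOn
  obtain ⟨β, hβ, hβX, hlt⟩ := exists_first hcont (d := 0) (by linarith)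
    ⟨p, ⟨hαp.le, le_rfl⟩, by linarith⟩
  have hβg := hgood β ⟨hβ.1.le, hβ.2⟩ (by linarith)
  refine ⟨α, β, hα0, hβ.1, fun s hs => ?_, hαg.2.trans (min_le_left _ _), by linarith [hβg.2]⟩
  rcases le_or_gt s α with hsα | hsα
  · exact (hsmall s ⟨hs.1, hsα.trans (min_le_left _ _)⟩).1
  · rcases eq_or_lt_of_le hs.2 with rfl | hsβ
    · exact hβg.1
    · exact (hgood s ⟨hsα.le, hs.2.trans hβ.2⟩ (by linarith [hlt s ⟨hsα.le, hsβ⟩])).1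

/-- The upper arcs up to the first one that either ends at the boundary of the strip `x ^ 2 ≤ 2` or
ends at the prescribed position. -/
theorem exists_upper (hN : 1 ≤ N) {r : ℝ} (hr : 0 < r) (hr' : r < √(2 * N) + 3) :
    ∃ κ : ℝ, -(√(2 * N) + 6) < κ ∧ κ < 0 ∧ (∀ s ≤ κ, Good N s) ∧ qEnd N κ ≤ -r ∧
      (xEnd N κ = √2 ∨ qEnd N κ = -r) := by
  have hN0 : 0 ≤ N := by linarith
  obtain ⟨-, p, -, -, hp2, hpr, -, hp⟩ := exists_mc_eq hN
  set R := √(2 * N) + 6 with hR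
  obtain ⟨hRg, hRq, -⟩ := good_of_large hN hR.ge
  have hpi := pi_div_sqrt_two_lt
  have h2 : √2 ^ 2 = 2 := sq_sqrt (by norm_num)
  have h20 : 0 < √2 := by positivity
  have hp0 : 0 < p := h20.trans hp2
  have hr2 : √(2 * N) ^ 2 = 2 * N := sq_sqrt (by linarith)
  have hr00 : 0 ≤ √(2 * N) := sqrt_nonneg _
  have hR0 : 0 < R := by linarith
  have hpR : p < R := by linarith
  have hmc : ∀ a, 0 < a → a * mc N (-a) = a ^ 2 / 2 - N := fun a ha => by
    rw [mc_neg]; field_simp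
  have hmp : 2 * mc N (-p) = √2 := by
    have h3 := hmc p hp0
    have : p * (2 * mc N (-p)) = p * √2 := by linarith
    exact mul_left_cancel₀ hp0.ne' this
  set ρ := p ^ 2 / 2 - N with hρ
  have hρ0 : 0 < ρ := by rw [hρ]; nlinarith
  have hmp0 : 0 < mc N (-p) := by linarith
  have hmR : 0 < mc N (-R) := hmp0.trans_le (mc_neg_mono hN0 hp0 hpR.le)
  have hk0 := curvMin_pos hN hR0.le hρ0 hmR
  set δ := min r (min (mc N (-p)) (curvMin N R ρ (mc N (-R)))) / 2 with hδdef
  have hδ0 : 0 < δ := by positivity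
  have hδ2 : 2 * δ = min r (min (mc N (-p)) (curvMin N R ρ (mc N (-R)))) := by rw [hδdef]; ring
  have hδa : 2 * δ ≤ r := hδ2.le.trans (min_le_left _ _)
  have hδm : 2 * δ ≤ mc N (-p) := hδ2.le.trans ((min_le_right _ _).trans (min_le_left _ _))
  have hδk : 2 * δ ≤ curvMin N R ρ (mc N (-R)) :=
    hδ2.le.trans ((min_le_right _ _).trans (min_le_right _ _))
  have hσ : (-1 : ℝ) ^ 2 = 1 := by norm_num
  have hma : ∀ a ∈ Icc (-R) (-p), mc N (-p) ≤ mc N a := fun a ha => by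
    have := mc_neg_mono hN0 hp0 (by linarith [ha.2] : p ≤ -a)
    rwa [neg_neg] at this
  have hmaR : ∀ a ∈ Icc (-R) (-p), mc N a ≤ mc N (-R) := fun a ha => by
    have := mc_neg_mono hN0 (by linarith [ha.2] : 0 < -a) (by linarith [ha.1] : -a ≤ R)
    rwa [neg_neg] at this
  have hρa : ∀ a ∈ Icc (-R) (-p), ρ ≤ |a| * mc N a := fun a ha => by
    have ha0 : a < 0 := by linarith [ha.2]
    have h3 := hmc (-a) (by linarith)
    rw [neg_neg] at h3
    rw [abs_of_neg ha0, h3, hρ]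
    have := pow_le_pow_left₀ hp0.le (by linarith [ha.2] : p ≤ -a) 2
    linarith
  have hBa : ∀ a ∈ Icc (-R) (-p), ∀ t, ∀ x q : ℝ → ℝ, IsArc N a t x q →
      ∀ θ ∈ Icc 0 t, |q θ| ≤ R := fun a ha t x q h θ hθ =>
    (h.abs_le_of_neg (by linarith [ha.2]) θ hθ).trans (by linarith [ha.1])
  have hδka : ∀ a ∈ Icc (-R) (-p), δ < curvMin N R ρ (mc N a) := fun a ha => by
    have h3 := curvMin_anti hN hR0.le hρ0 (hmp0.trans_le (hma a ha)) (hmaR a ha)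
    linarith
  have hgood : ∀ a ∈ Icc (-R) (-p), (cutFlow N (-1) δ a (π / 2)).1 ≤ √2 →
      (cutFlow N (-1) δ a (π / 2)).2 ≤ -r → Good N a ∧
      xEnd N a = (cutFlow N (-1) δ a (π / 2)).1 ∧
      qEnd N a = (cutFlow N (-1) δ a (π / 2)).2 := fun a ha hx hq => by
    have hY := isCutFlow_cutFlow hN0 hσ hδ0 a
    have hx0 := hY.monotoneOn_fst hδ0 zero_mem_quarter pi_div_two_mem_quarter
      pi_div_two_mem_quarter.1
    simp only [hY.zero] at hx0
    have hpsi : 0 < mc N a + 1 / a := by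
      have ha0 : 0 < -a := by linarith [ha.2]
      have h3 := hmc (-a) ha0
      rw [neg_neg] at h3
      have h4 : mc N a + 1 / a = ((-a) * mc N a - 1) / (-a) := by
        have : a ≠ 0 := by linarith
        field_simp; ring
      rw [h4]
      refine div_pos ?_ ha0
      have h5 := hma a ha
      have h6 : √2 < -a := by linarith [ha.2]
      nlinarith
    exact good_of_cutFlow hN hσ hδ0 hpsi (fun θ hθ => by
        have := hY.monotoneOn_snd hδ0 hθ pi_div_two_mem_quarter hθ.2
        linarith) (by have h3 := pow_le_pow_left₀ hx0 hx 2; rwa [h2] at h3) hρ0 (hρa a ha)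
      (by linarith [hma a ha]) (hδka a ha) (hBa a ha)
  have hRm : -R ∈ Icc (-R) (-p) := ⟨le_rfl, by linarith⟩
  have hRe := hRg.cutFlow_end hσ hδ0 (fun θ hθ => by
      have := hRg.isArc.strictMonoOn_q.monotoneOn hθ pi_div_two_mem_quarter hθ.2
      change _ ≤ qEnd N (-R) at this
      linarith) hρ0 (hρa _ hRm) (hδka _ hRm) (hBa _ hRm)
  have hRX : xEnd N (-R) < √2 := by
    refine lt_of_le_of_ne hRg.xEnd_le fun he => ?_
    have h3 := hRg.mc_qEnd_neg he
    have h4 := mc_neg_nonneg (N := N) (r := -qEnd N (-R)) (by linarith) (by linarith)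
    rw [neg_neg] at h4
    linarith
  have hcont : ContinuousOn (fun a => min (√2 - (cutFlow N (-1) δ a (π / 2)).1)
      (-r - (cutFlow N (-1) δ a (π / 2)).2)) (Icc (-R) (-p)) := by
    have hc := continuous_cutFlow hN0 hσ hδ0 pi_div_two_mem_quarter
    exact ((continuous_const.sub (continuous_fst.comp hc)).min
      (continuous_const.sub (continuous_snd.comp hc))).continuousOn
  obtain ⟨κ, hκ, hκ0, hlt⟩ := exists_first hcont (d := 0) (by
      rw [hRe]
      change xEnd N (-R) < √2 at hRX
      exact lt_min (sub_pos.2 hRX) (by change 0 < -r - qEnd N (-R); linarith))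
    ⟨-p, ⟨by linarith, le_rfl⟩, by
      by_contra! hc
      obtain ⟨h3, h4⟩ := lt_min_iff.1 hc
      obtain ⟨h5, h6, -⟩ := hgood (-p) ⟨by linarith, le_rfl⟩ (by linarith) (by linarith)
      have h7 := h5.inv_le_xEnd
      rw [h6] at h7
      nlinarith⟩
  have hκg := hgood κ ⟨hκ.1.le, hκ.2⟩
    (by linarith [hκ0.ge.trans (min_le_left _ _)]) (by linarith [hκ0.ge.trans (min_le_right _ _)])
  refine ⟨κ, hκ.1, by linarith [hκ.2], fun s hs => ?_,
    hκg.2.2.trans_le (by linarith [hκ0.ge.trans (min_le_right _ _)]), ?_⟩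
  · rcases le_or_gt s (-R) with hsR | hsR
    · simpa using (good_of_large hN (by linarith : √(2 * N) + 6 ≤ -s)).1
    · rcases eq_or_lt_of_le hs with rfl | hsκ
      · exact hκg.1
      · have h3 := lt_min_iff.1 (hlt s ⟨hsR.le, hsκ⟩)
        exact (hgood s ⟨hsR.le, hs.trans hκ.2⟩ (by linarith) (by linarith)).1
  · rw [hκg.2.1, hκg.2.2]
    rcases min_choice (√2 - (cutFlow N (-1) δ κ (π / 2)).1)
      (-r - (cutFlow N (-1) δ κ (π / 2)).2) with h | h
    · left; linarith
    · right; linarith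

/-- There are a lower and an upper arc that fit together and are short. -/
theorem exists_pair (hN : 1 ≤ N) : ∃ a c : ℝ, 0 < a ∧ c < 0 ∧ Good N a ∧ Good N c ∧
    xEnd N a = xEnd N c ∧ qEnd N a = -qEnd N c ∧ len N a + len N c < axisLen N := by
  have hN0 : 0 ≤ N := by linarith
  set R := √(2 * N) + 6 with hR
  have hr00 : 0 ≤ √(2 * N) := sqrt_nonneg _
  have hr2 : √(2 * N) ^ 2 = 2 * N := sq_sqrt (by linarith)
  obtain ⟨hRg, hRq, -⟩ := good_of_large hN hR.ge
  have hpi := pi_div_sqrt_two_lt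
  have hmR := hRg.isArc.mc_a_pos
  obtain ⟨α, β, hα0, hαβ, hlow, hαx, hβx⟩ := exists_lower hN (one_div_pos.2 hmR)
  have hαg := hlow α ⟨hα0, hαβ.le⟩
  have hβg := hlow β ⟨hα0.trans hαβ, le_rfl⟩
  have hlow' : ∀ s ∈ Icc α β, Good N s := fun s hs => hlow s ⟨hα0.trans_le hs.1, hs.2⟩
  have hGm := strictMonoOn_qEnd (convex_Icc α β) hlow'
  have hαq : 0 < qEnd N α := hα0.trans hαg.lt_qEnd
  have hαβq := hGm (left_mem_Icc.2 hαβ.le) (right_mem_Icc.2 hαβ.le) hαβ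
  have hβq : qEnd N β ≤ √(2 * N) + 121 / 50 :=
    hβg.isArc.q_le hβg.bound (hα0.trans hαβ) pi_div_two_mem_quarter
  have hβr : √(2 * N) < qEnd N β := by
    have h1 := hβg.mc_qEnd_neg hβx
    have h3 : 0 < qEnd N β := hαq.trans hαβq
    unfold mc at h1
    rw [sub_neg, div_lt_div_iff₀ h3 two_pos] at h1
    nlinarith
  obtain ⟨κ, hκR, hκ0, hup, hκα, hκ⟩ := exists_upper hN hαq (by linarith)
  have hκg := hup κ le_rfl
  have hQm := strictMonoOn_qEnd (convex_Iic κ) hup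
  have hκq : -qEnd N κ < qEnd N β := by
    rcases hκ with h | h
    · have h1 := hκg.mc_qEnd_neg h
      by_contra! hc
      have h4 := mc_neg_nonneg (N := N) (r := -qEnd N κ) (by linarith) (by linarith)
      rw [neg_neg] at h4
      linarith
    · linarith
  have hQc : ContinuousOn (fun c => -qEnd N c) (Icc (-R) κ) := fun c hc =>
    (hup c hc.2).continuousAt_qEnd.neg.continuousWithinAt
  obtain ⟨γ, hγ, hγq⟩ := intermediate_value_Icc' hκR.le hQc
    (show qEnd N β ∈ Icc _ _ from ⟨hκq.le, by linarith⟩)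
  obtain ⟨a, ha, c, hc, hac, hx⟩ := exists_match (F := xEnd N) (G := qEnd N) (U := xEnd N)
    (V := fun c => -qEnd N c) hαβ.le hγ.2
    (fun s hs => (hlow' s hs).continuousAt_xEnd.continuousWithinAt)
    (fun s hs => (hlow' s hs).continuousAt_qEnd.continuousWithinAt) hGm
    (fun s hs => (hup s hs.2).continuousAt_xEnd.continuousWithinAt)
    (fun s hs => (hup s hs.2).continuousAt_qEnd.neg.continuousWithinAt)
    (fun s hs => by
      have h1 := hQm.monotoneOn (show γ ≤ κ from hγ.2) (show s ≤ κ from hs.2) hs.1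
      have h3 := hQm.monotoneOn (show s ≤ κ from hs.2) (show κ ≤ κ from le_rfl) hs.2
      dsimp only at hγq
      exact ⟨by linarith, by linarith⟩)
    (fun s hs h => by
      have h1 : s = β := hGm.injOn hs (right_mem_Icc.2 hαβ.le) (h.trans hγq)
      rw [h1, hβx]
      exact (hup γ hγ.2).xEnd_le)
    (fun s hs h => by
      rcases hκ with h1 | h1
      · rw [h1]; exact (hlow' s hs).xEnd_le
      · have h3 : s = α := hGm.injOn hs (left_mem_Icc.2 hαβ.le) (by linarith)
        rw [h3]
        refine hαx.trans ?_
        rw [div_le_iff₀ hmR]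
        have h4 := mc_neg_mono hN0 (by linarith : 0 < -κ) (by linarith : -κ ≤ R)
        rw [neg_neg] at h4
        have h5 := hκg.inv_le_xEnd
        have h6 := mul_le_mul_of_nonneg_right h4 hκg.xEnd_pos.le
        linarith)
  have hag := hlow' a ha
  have hcg := hup c hc.2
  have ha0 : 0 < a := hα0.trans_le ha.1
  have hc0 : c < 0 := hc.2.trans_lt hκ0
  refine ⟨a, c, ha0, hc0, hag, hcg, hx, hac, ?_⟩
  have g1 := gap_pos ha0 fun s hs => hlow s ⟨hs.1, hs.2.trans ha.2⟩
  have g2 := neg_axisLen_lt_gap hc0 fun s hs => hup s (hs.trans hc.2)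
  unfold gap at g1 g2
  have h1 : qEnd N c = -qEnd N a := by linarith
  rw [h1, integral_axisDens_neg] at g2
  linarith

end

section

/-! ### Gluing arcs to a closed curve -/

variable {N : ℝ} {P Q F : ℝ → ℝ × ℝ} {t : ℝ}

/-- The curve `P` solves the geodesic equation, parametrised by the tangent angle, at `t`. -/
structure SolvesAt (N : ℝ) (P : ℝ → ℝ × ℝ) (t : ℝ) : Prop where
  pos : 0 < (P t).2
  curv_pos : 0 < curv N t (P t).1 (P t).2
  hasDerivAt : HasDerivAt P (field N (t, P t)) t

theorem SolvesAt.congr (h : SolvesAt N P t) (hF : F =ᶠ[𝓝 t] P) : SolvesAt N F t := by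
  obtain ⟨h1, h2, h3⟩ := h
  rw [← hF.eq_of_nhds] at h1 h2 h3
  exact ⟨h1, h2, h3.congr_of_eventuallyEq hF⟩

theorem SolvesAt.glue (hP : SolvesAt N P t) (hQ : SolvesAt N Q t)
    (h₁ : F =ᶠ[𝓝[≤] t] P) (h₂ : F =ᶠ[𝓝[≥] t] Q) : SolvesAt N F t := by
  have e1 : F t = P t := h₁.eq_of_nhdsWithin self_mem_Iic
  have e2 : F t = Q t := h₂.eq_of_nhdsWithin self_mem_Ici
  obtain ⟨h1, h2, h3⟩ := hP
  have h4 := hQ.hasDerivAt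
  rw [← e1] at h1 h2 h3
  rw [← e2] at h4
  refine ⟨h1, h2, ?_⟩
  have h5 := (h3.hasDerivWithinAt.congr_of_eventuallyEq h₁ e1).union
    (h4.hasDerivWithinAt.congr_of_eventuallyEq h₂ e2)
  rwa [Iic_union_Ici, hasDerivWithinAt_univ] at h5

theorem curv_add_two_pi (N θ x q : ℝ) : curv N (θ + 2 * π) x q = curv N θ x q := by
  simp [curv]

theorem curv_neg_neg (N θ x q : ℝ) : curv N (-θ) (-x) q = curv N θ x q := by
  simp [curv]

theorem curv_pi_sub_neg (N θ x q : ℝ) : curv N (π - θ) x (-q) = curv N θ x q := by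
  simp only [curv, mc_neg, cos_pi_sub, sin_pi_sub]; unfold mc; ring

theorem wt_neg (N x q : ℝ) : wt N x (-q) = wt N x q := by simp [wt]

theorem SolvesAt.shift (h : SolvesAt N P t) :
    SolvesAt N (fun θ => P (θ - 2 * π)) (t + 2 * π) := by
  obtain ⟨h1, h2, h3⟩ := h
  refine ⟨by simpa using h1, by simpa [curv_add_two_pi] using h2, ?_⟩
  have h4 : HasDerivAt P (field N (t, P t)) (t + 2 * π - 2 * π) := by rwa [add_sub_cancel_right]
  refine (h4.comp_sub_const (t + 2 * π) (2 * π)).congr_deriv ?_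
  simp [field, curv_add_two_pi]

theorem SolvesAt.unshift (h : SolvesAt N P t) :
    SolvesAt N (fun θ => P (θ + 2 * π)) (t - 2 * π) := by
  have hc : ∀ x q, curv N (t - 2 * π) x q = curv N t x q := fun x q => by simp [curv]
  obtain ⟨h1, h2, h3⟩ := h
  refine ⟨by simpa using h1, by simpa [hc] using h2, ?_⟩
  have h4 : HasDerivAt P (field N (t, P t)) (t - 2 * π + 2 * π) := by rwa [sub_add_cancel]
  refine (h4.comp_add_const (t - 2 * π) (2 * π)).congr_deriv ?_
  simp [field, hc]

theorem SolvesAt.reflect (h : SolvesAt N P t) :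
    SolvesAt N (fun θ => (-(P (-θ)).1, (P (-θ)).2)) (-t) := by
  obtain ⟨h1, h2, h3⟩ := h
  refine ⟨by simpa using h1, by simpa [curv_neg_neg] using h2, ?_⟩
  have h4 : HasDerivAt P (field N (t, P t)) (- -t) := by rwa [neg_neg]
  have h5 : HasDerivAt (fun θ => P (-θ)) _ (-t) := h4.scomp (-t) (hasDerivAt_neg (-t))
  have h6 : HasDerivAt (fun θ => -(P (-θ)).1) _ (-t) := HasDerivAt.fun_neg h5.fst
  have h7 : HasDerivAt (fun θ => (P (-θ)).2) _ (-t) := h5.snd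
  refine (h6.prodMk h7).congr_deriv ?_
  simp [field, curv_neg_neg, neg_div]

theorem IsSol.solvesAt {a : ℝ} {Y : ℝ → ℝ × ℝ} (h : IsSol N a Y) (ha : 0 < a)
    (ht : t ∈ Icc 0 (π / 2)) : SolvesAt N Y t :=
  ⟨pos_of_mul_pos_right (h.same_sign t ht) ha.le, h.curv_pos t ht, h.hasDerivAt t ht⟩

theorem IsSol.solvesAt_flip {c : ℝ} {Y : ℝ → ℝ × ℝ} (h : IsSol N c Y) (hc : c < 0)
    (ht : π - t ∈ Icc 0 (π / 2)) :
    SolvesAt N (fun θ => ((Y (π - θ)).1, -(Y (π - θ)).2)) t := by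
  have h1 := neg_pos.2 (neg_of_mul_pos_right (h.same_sign _ ht) hc.le)
  have hk : ∀ x q, curv N t x (-q) = curv N (π - t) x q := fun x q => by
    rw [← curv_pi_sub_neg, neg_neg]
  refine ⟨h1, by simpa only [hk] using h.curv_pos _ ht, ?_⟩
  have h5 : HasDerivAt (fun θ => Y (π - θ)) _ t :=
    (h.hasDerivAt _ ht).scomp t ((hasDerivAt_id t).const_sub π)
  have h6 : HasDerivAt (fun θ => (Y (π - θ)).1) _ t := h5.fst
  have h7 : HasDerivAt (fun θ => -(Y (π - θ)).2) _ t := HasDerivAt.fun_neg h5.snd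
  refine (h6.prodMk h7).congr_deriv ?_
  simp [field, hk, neg_div]

/-- The upper half of a closed curve: a lower arc followed by an upper one. -/
noncomputable def halfCurve (Y Z : ℝ → ℝ × ℝ) (θ : ℝ) : ℝ × ℝ :=
  if θ ≤ π / 2 then Y θ else ((Z (π - θ)).1, -(Z (π - θ)).2)

theorem halfCurve_solvesAt {a c : ℝ} {Y Z : ℝ → ℝ × ℝ} (hY : IsSol N a Y) (hZ : IsSol N c Z)
    (ha : 0 < a) (hc : c < 0) (h₁ : (Y (π / 2)).1 = (Z (π / 2)).1)
    (h₂ : (Y (π / 2)).2 = -(Z (π / 2)).2) (ht : t ∈ Icc 0 π) :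
    SolvesAt N (halfCurve Y Z) t := by
  rcases lt_trichotomy t (π / 2) with h | rfl | h
  · refine (hY.solvesAt ha ⟨ht.1, h.le⟩).congr ?_
    filter_upwards [Iio_mem_nhds h] with s hs using if_pos (le_of_lt hs)
  · refine (hY.solvesAt ha pi_div_two_mem_quarter).glue
      (hZ.solvesAt_flip hc (by rw [sub_half]; exact pi_div_two_mem_quarter)) ?_ ?_
    · filter_upwards [self_mem_nhdsWithin] with s hs using if_pos hs
    · filter_upwards [self_mem_nhdsWithin] with s hs
      rcases eq_or_lt_of_le (show π / 2 ≤ s from hs) with rfl | hs'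
      · rw [halfCurve, if_pos le_rfl, sub_half, ← h₁, ← h₂]
      · exact if_neg hs'.not_ge
  · refine (hZ.solvesAt_flip hc ⟨by linarith [ht.2], by linarith⟩).congr ?_
    filter_upwards [Ioi_mem_nhds h] with s hs using if_neg (not_le.2 hs)

/-- The closed curve consisting of a curve over `[0, π]` and its reflection. -/
noncomputable def fullCurve (Y : ℝ → ℝ × ℝ) (θ : ℝ) : ℝ × ℝ :=
  let s := toIocMod two_pi_pos (-π) θ
  if 0 ≤ s then Y s else (-(Y (-s)).1, (Y (-s)).2)

variable {Y : ℝ → ℝ × ℝ}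

theorem fullCurve_periodic : Function.Periodic (fullCurve Y) (2 * π) := fun θ => by
  simp only [fullCurve, toIocMod_add_right]

theorem toIocMod_of_mem {s : ℝ} (h : s ∈ Ioc (-π) π) : toIocMod two_pi_pos (-π) s = s := by
  rw [toIocMod_eq_self]
  exact ⟨h.1, by linarith [h.2]⟩

theorem fullCurve_of_nonneg {s : ℝ} (h : s ∈ Icc 0 π) : fullCurve Y s = Y s := by
  have h1 := toIocMod_of_mem (s := s) ⟨by linarith [h.1, pi_pos], h.2⟩
  simp only [fullCurve, h1, h.1, if_true]

theorem fullCurve_neg (h0 : (Y 0).1 = 0) (hπ : (Y π).1 = 0) {s : ℝ} (h : s ∈ Icc 0 π) :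
    fullCurve Y (-s) = (-(Y s).1, (Y s).2) := by
  rcases eq_or_lt_of_le h.1 with rfl | h1
  · rw [neg_zero, fullCurve_of_nonneg h]
    exact Prod.ext (by simp [h0]) rfl
  rcases eq_or_lt_of_le h.2 with rfl | h2
  · rw [← fullCurve_periodic, show -π + 2 * π = π by ring, fullCurve_of_nonneg h]
    exact Prod.ext (by simp [hπ]) rfl
  have h3 := toIocMod_of_mem (s := -s) ⟨by linarith, by linarith⟩
  simp only [fullCurve, h3, neg_neg, if_neg (show ¬ 0 ≤ -s by linarith)]

theorem fullCurve_two_pi_sub (h0 : (Y 0).1 = 0) (hπ : (Y π).1 = 0) {s : ℝ} (h : s ∈ Icc 0 π) :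
    fullCurve Y (2 * π - s) = (-(Y s).1, (Y s).2) := by
  rw [← fullCurve_neg h0 hπ h, ← fullCurve_periodic (-s), neg_add_eq_sub]

theorem fullCurve_solvesAt_of_mem (h0 : (Y 0).1 = 0) (hπ : (Y π).1 = 0)
    (hY : ∀ t ∈ Icc 0 π, SolvesAt N Y t) (ht : t ∈ Ioc (-π) π) :
    SolvesAt N (fullCurve Y) t := by
  have hpi := pi_pos
  rcases lt_trichotomy t 0 with h | rfl | h
  · have h1 := (hY (-t) ⟨by linarith, by linarith [ht.1]⟩).reflect
    rw [neg_neg] at h1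
    refine h1.congr ?_
    filter_upwards [Ioo_mem_nhds ht.1 h] with s hs
    rw [← fullCurve_neg h0 hπ ⟨by linarith [hs.2], by linarith [hs.1]⟩, neg_neg]
  · have h1 := hY 0 ⟨le_rfl, hpi.le⟩
    have h2 := h1.reflect
    rw [neg_zero] at h2
    refine h2.glue h1 ?_ ?_
    · filter_upwards [self_mem_nhdsWithin, nhdsWithin_le_nhds (Ioi_mem_nhds ht.1)] with s hs hs'
      rw [← fullCurve_neg h0 hπ ⟨neg_nonneg.2 hs, by linarith [show -π < s from hs']⟩, neg_neg]
    · filter_upwards [self_mem_nhdsWithin, nhdsWithin_le_nhds (Iio_mem_nhds hpi)] with s hs hs'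
      exact fullCurve_of_nonneg ⟨hs, le_of_lt hs'⟩
  rcases eq_or_lt_of_le ht.2 with rfl | h'
  · have h1 := hY π ⟨h.le, le_rfl⟩
    have h2 := h1.reflect.shift
    rw [show -π + 2 * π = π by ring] at h2
    refine h1.glue h2 ?_ ?_
    · filter_upwards [self_mem_nhdsWithin, nhdsWithin_le_nhds (Ioi_mem_nhds h)] with s hs hs'
      exact fullCurve_of_nonneg ⟨le_of_lt hs', hs⟩
    · filter_upwards [self_mem_nhdsWithin,
        nhdsWithin_le_nhds (Iio_mem_nhds (by linarith : π < 2 * π))] with s hs hs'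
      have h3 := fullCurve_two_pi_sub h0 hπ (s := 2 * π - s)
        ⟨by linarith [show s < 2 * π from hs'], by linarith [show π ≤ s from hs]⟩
      rwa [sub_sub_cancel, ← neg_sub s] at h3
  · refine (hY t ⟨h.le, ht.2⟩).congr ?_
    filter_upwards [Ioo_mem_nhds h h'] with s hs
      using fullCurve_of_nonneg (Ioo_subset_Icc_self hs)

theorem fullCurve_solvesAt (h0 : (Y 0).1 = 0) (hπ : (Y π).1 = 0)
    (hY : ∀ t ∈ Icc 0 π, SolvesAt N Y t) (t : ℝ) : SolvesAt N (fullCurve Y) t := by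
  have key : ∀ k : ℤ, ∀ t, SolvesAt N (fullCurve Y) t →
      SolvesAt N (fullCurve Y) (t + k • (2 * π)) := fun k => by
    induction k with
    | zero => simp
    | succ k ih =>
      intro t ht
      have h1 := (ih t ht).shift
      rw [add_zsmul, one_zsmul, ← add_assoc]
      simpa only [fullCurve_periodic.sub_eq] using h1
    | pred k ih =>
      intro t ht
      have h1 := (ih t ht).unshift
      rw [sub_zsmul, one_zsmul, ← sub_eq_add_neg, ← add_sub_assoc]
      simpa only [fullCurve_periodic _] using h1
  have h1 := toIocMod_mem_Ioc two_pi_pos (-π) t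
  rw [show -π + 2 * π = π by ring] at h1
  have h2 := key (toIocDiv two_pi_pos (-π) t) _ (fullCurve_solvesAt_of_mem h0 hπ hY h1)
  rwa [toIocMod_add_toIocDiv_zsmul] at h2

end

section

/-! ### Properties of the closed curve -/

variable {N : ℝ} {P Y : ℝ → ℝ × ℝ}

theorem contDiff_of_solvesAt (h : ∀ t, SolvesAt N P t) : ContDiff ℝ (⊤ : ℕ∞) P := by
  refine contDiff_infty.2 fun k => ?_
  induction k with
  | zero =>
    exact contDiff_zero.2 (continuous_iff_continuousAt.2 fun t => (h t).hasDerivAt.continuousAt)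
  | succ k ih =>
    rw [Nat.cast_succ, contDiff_succ_iff_deriv]
    refine ⟨fun t => (h t).hasDerivAt.differentiableAt, by simp, ?_⟩
    rw [show deriv P = fun t => field N (t, P t) from funext fun t => (h t).hasDerivAt.deriv]
    refine contDiff_iff_contDiffAt.2 fun t => ?_
    have h1 : ContDiffAt ℝ k (fun s => (s, P s)) t := contDiffAt_id.prodMk ih.contDiffAt
    exact ContDiffAt.comp (g := field N) t
      (contDiffAt_field (p := (t, P t)) (h t).pos.ne' (h t).curv_pos.ne') h1

theorem SolvesAt.hasDerivAt_fst {t : ℝ} (h : SolvesAt N P t) :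
    HasDerivAt (fun θ => (P θ).1) (cos t / curv N t (P t).1 (P t).2) t := h.hasDerivAt.fst

theorem SolvesAt.hasDerivAt_snd {t : ℝ} (h : SolvesAt N P t) :
    HasDerivAt (fun θ => (P θ).2) (sin t / curv N t (P t).1 (P t).2) t := h.hasDerivAt.snd

theorem strictMonoOn_snd (h : ∀ t ∈ Icc 0 π, SolvesAt N Y t) :
    StrictMonoOn (fun θ => (Y θ).2) (Icc 0 π) := by
  refine strictMonoOn_of_deriv_pos (convex_Icc _ _)
    (fun t ht => (h t ht).hasDerivAt_snd.continuousAt.continuousWithinAt) fun t ht => ?_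
  rw [interior_Icc] at ht
  have h1 := h t (Ioo_subset_Icc_self ht)
  rw [h1.hasDerivAt_snd.deriv]
  exact div_pos (sin_pos_of_mem_Ioo ht) h1.curv_pos

theorem injOn_fullCurve (h0 : (Y 0).1 = 0) (hπ : (Y π).1 = 0)
    (hY : ∀ t ∈ Icc 0 π, SolvesAt N Y t) (hpos : ∀ t ∈ Ioo 0 π, 0 < (Y t).1) :
    InjOn (fullCurve Y) (Ico 0 (2 * π)) := by
  have hm := (strictMonoOn_snd hY).injOn
  have hnn : ∀ t ∈ Icc 0 π, 0 ≤ (Y t).1 := fun t ht => by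
    rcases eq_or_lt_of_le ht.1 with rfl | h1
    · exact h0.ge
    rcases eq_or_lt_of_le ht.2 with rfl | h2
    · exact hπ.ge
    exact (hpos t ⟨h1, h2⟩).le
  have hlow : ∀ s ∈ Ico 0 (2 * π), π < s → 2 * π - s ∈ Ioo 0 π ∧
      fullCurve Y s = (-(Y (2 * π - s)).1, (Y (2 * π - s)).2) := fun s hs h => by
    have h1 : 2 * π - s ∈ Ioo 0 π := ⟨by linarith [hs.2], by linarith⟩
    refine ⟨h1, ?_⟩
    rw [← fullCurve_two_pi_sub h0 hπ (Ioo_subset_Icc_self h1), sub_sub_cancel]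
  intro s hs t ht hst
  rcases le_or_gt s π with h1 | h1 <;> rcases le_or_gt t π with h2 | h2
  · rw [fullCurve_of_nonneg ⟨hs.1, h1⟩, fullCurve_of_nonneg ⟨ht.1, h2⟩] at hst
    exact hm ⟨hs.1, h1⟩ ⟨ht.1, h2⟩ (congrArg Prod.snd hst)
  · obtain ⟨h3, h4⟩ := hlow t ht h2
    rw [fullCurve_of_nonneg ⟨hs.1, h1⟩, h4] at hst
    have h5 : (Y s).1 = -(Y (2 * π - t)).1 := congrArg Prod.fst hst
    linarith [hnn s ⟨hs.1, h1⟩, hpos _ h3]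
  · obtain ⟨h3, h4⟩ := hlow s hs h1
    rw [fullCurve_of_nonneg ⟨ht.1, h2⟩, h4] at hst
    have h5 : -(Y (2 * π - s)).1 = (Y t).1 := congrArg Prod.fst hst
    linarith [hnn t ⟨ht.1, h2⟩, hpos _ h3]
  · obtain ⟨h3, h4⟩ := hlow s hs h1
    obtain ⟨h5, h6⟩ := hlow t ht h2
    rw [h4, h6] at hst
    have h7 : 2 * π - s = 2 * π - t := hm (Ioo_subset_Icc_self h3) (Ioo_subset_Icc_self h5)
      (Prod.ext_iff.1 hst).2
    linarith

theorem SolvesAt.continuousAt_dens {t : ℝ} (h : SolvesAt N P t) :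
    ContinuousAt (fun t => dens N (t, P t)) t := by
  have h1 : ContinuousAt (fun s => (s, P s)) t := continuousAt_id.prodMk h.hasDerivAt.continuousAt
  exact ContinuousAt.comp (g := dens N)
    (contDiffAt_dens (m := 0) (p := (t, P t)) h.pos.ne' h.curv_pos.ne').continuousAt h1

theorem continuous_dens (h : ∀ t, SolvesAt N P t) : Continuous fun t => dens N (t, P t) :=
  continuous_iff_continuousAt.2 fun t => (h t).continuousAt_dens

theorem dens_reflect (t x q : ℝ) : dens N (2 * π - t, -x, q) = dens N (t, x, q) := by
  simp [dens, wt, curv, sub_eq_add_neg, add_comm (2 * π)]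

theorem dens_flip (t x q : ℝ) : dens N (π - t, x, -q) = dens N (t, x, q) := by
  simp only [dens, wt_neg, curv_pi_sub_neg]

theorem integral_fullCurve (h0 : (Y 0).1 = 0) (hπ : (Y π).1 = 0)
    (hY : ∀ t ∈ Icc 0 π, SolvesAt N Y t) :
    ∫ t in (0 : ℝ)..2 * π, dens N (t, fullCurve Y t) = 2 * ∫ t in (0 : ℝ)..π, dens N (t, Y t) := by
  have hc := continuous_dens (fullCurve_solvesAt h0 hπ hY)
  have h1 : ∫ t in (0 : ℝ)..π, dens N (t, fullCurve Y t) = ∫ t in (0 : ℝ)..π, dens N (t, Y t) :=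
    intervalIntegral.integral_congr fun t ht => by
      rw [uIcc_of_le pi_pos.le] at ht
      simp only [fullCurve_of_nonneg ht]
  have h2 : ∫ t in π..2 * π, dens N (t, fullCurve Y t) = ∫ t in (0 : ℝ)..π, dens N (t, Y t) := by
    have h3 := intervalIntegral.integral_comp_sub_left (fun t => dens N (t, fullCurve Y t)) (2 * π)
      (a := 0) (b := π)
    rw [sub_zero, show 2 * π - π = π by ring] at h3
    rw [← h3]
    refine intervalIntegral.integral_congr fun t ht => ?_
    rw [uIcc_of_le pi_pos.le] at ht
    simp only [fullCurve_two_pi_sub h0 hπ ht, dens_reflect]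
  rw [← intervalIntegral.integral_add_adjacent_intervals (hc.intervalIntegrable 0 π)
    (hc.intervalIntegrable π (2 * π)), h1, h2, two_mul]

theorem integral_halfCurve {a c : ℝ} {Y Z : ℝ → ℝ × ℝ} (hY : IsSol N a Y) (hZ : IsSol N c Z)
    (ha : 0 < a) (hc : c < 0) (h₁ : (Y (π / 2)).1 = (Z (π / 2)).1)
    (h₂ : (Y (π / 2)).2 = -(Z (π / 2)).2) :
    ∫ t in (0 : ℝ)..π, dens N (t, halfCurve Y Z t) =
      (∫ t in (0 : ℝ)..π / 2, dens N (t, Y t)) + ∫ t in (0 : ℝ)..π / 2, dens N (t, Z t) := by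
  have hS := fun t ht => halfCurve_solvesAt (t := t) hY hZ ha hc h₁ h₂ ht
  have hcont : ContinuousOn (fun t => dens N (t, halfCurve Y Z t)) (Icc 0 π) := fun t ht =>
    (hS t ht).continuousAt_dens.continuousWithinAt
  have hpi := pi_pos
  have h1 : ∫ t in (0 : ℝ)..π / 2, dens N (t, halfCurve Y Z t) =
      ∫ t in (0 : ℝ)..π / 2, dens N (t, Y t) :=
    intervalIntegral.integral_congr fun t ht => by
      rw [uIcc_of_le (by linarith)] at ht
      simp only [halfCurve, if_pos ht.2]
  have h2 : ∫ t in π / 2..π, dens N (t, halfCurve Y Z t) =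
      ∫ t in (0 : ℝ)..π / 2, dens N (t, Z t) := by
    have h3 := intervalIntegral.integral_comp_sub_left (fun t => dens N (t, halfCurve Y Z t)) π
      (a := 0) (b := π / 2)
    rw [sub_zero, sub_half] at h3
    rw [← h3]
    refine intervalIntegral.integral_congr fun t ht => ?_
    rw [uIcc_of_le (by linarith)] at ht
    have h4 : halfCurve Y Z (π - t) = ((Z t).1, -(Z t).2) := by
      rcases eq_or_lt_of_le ht.2 with rfl | h5
      · rw [sub_half, halfCurve, if_pos le_rfl]
        exact Prod.ext h₁ h₂
      · rw [halfCurve, if_neg (by linarith), sub_sub_cancel]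
    simp only [h4, dens_flip]
  rw [← intervalIntegral.integral_add_adjacent_intervals (b := π / 2), h1, h2]
  · exact (hcont.mono (Icc_subset_Icc_right (by linarith))).intervalIntegrable_of_Icc (by linarith)
  · exact (hcont.mono (Icc_subset_Icc_left (by linarith))).intervalIntegrable_of_Icc (by linarith)

/-- A short closed orbit of the geodesic field, parametrised by the tangent angle. -/
theorem exists_closed_orbit (hN : 1 ≤ N) : ∃ P : ℝ → ℝ × ℝ, (∀ t, SolvesAt N P t) ∧
    Function.Periodic P (2 * π) ∧ InjOn P (Ico 0 (2 * π)) ∧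
    ∫ t in (0 : ℝ)..2 * π, dens N (t, P t) < 2 * axisLen N := by
  obtain ⟨a, c, ha, hc, hag, hcg, h₁, h₂, hlen⟩ := exists_pair hN
  have hpi := pi_pos
  have hS := fun t ht => halfCurve_solvesAt (t := t) hag.isSol hcg.isSol ha hc h₁ h₂ ht
  set Y := halfCurve (sol N a) (sol N c) with hYdef
  have h0 : (Y 0).1 = 0 := by
    rw [hYdef, halfCurve, if_pos (by linarith), hag.isSol.zero]
  have hπ : (Y π).1 = 0 := by
    rw [hYdef, halfCurve, if_neg (by linarith), sub_self, hcg.isSol.zero]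
  have hpos : ∀ t ∈ Ioo 0 π, 0 < (Y t).1 := fun t ht => by
    rw [hYdef, halfCurve]
    split_ifs with h
    · exact hag.isArc.x_pos ⟨ht.1, h⟩
    · exact hcg.isArc.x_pos ⟨by linarith [ht.2], by linarith⟩
  refine ⟨fullCurve Y, fullCurve_solvesAt h0 hπ hS, fullCurve_periodic,
    injOn_fullCurve h0 hπ hS hpos, ?_⟩
  rw [integral_fullCurve h0 hπ hS, hYdef, integral_halfCurve hag.isSol hcg.isSol ha hc h₁ h₂]
  change 2 * (len N a + len N c) < _
  linarith

end

section

variable {N : ℝ}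

theorem axisLen_natCast (m : ℕ) :
    axisLen m = ∫ s in Ioi (0 : ℝ), s ^ m * exp (-s ^ 2 / 4) :=
  setIntegral_congr_fun measurableSet_Ioi fun s hs => by
    have h : 0 < s := hs
    simp only [axisDens, abs_of_pos h, rpow_natCast]
    ring_nf

theorem wt_natCast (m : ℕ) (x : ℝ) {q : ℝ} (hq : 0 < q) :
    wt m x q = q ^ m * exp (-(x ^ 2 + q ^ 2) / 4) := by
  rw [wt, ← rpow_natCast q m, rpow_def_of_pos hq, ← exp_add]
  ring_nf

/-- The signed curvature of a curve whose tangent angle is proportional to the parameter. -/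
theorem geodesic_of_hasDerivAt {r x s k : ℝ → ℝ} {ω u σ : ℝ} (hsk : s u * k u = ω)
    (hs0 : s u ≠ 0) (hs : HasDerivAt s σ u)
    (hr : ∀ v, HasDerivAt r (s v * sin (ω * v)) v) (hx : ∀ v, HasDerivAt x (s v * cos (ω * v)) v)
    (hk : k u = curv N (ω * u) (x u) (r u)) :
    (deriv x u * deriv (deriv r) u - deriv (deriv x) u * deriv r u) /
      ((deriv x u) ^ 2 + (deriv r u) ^ 2) =
      (N / r u - r u / 2) * deriv x u + (1 / 2) * x u * deriv r u := by
  have hω : HasDerivAt (fun v : ℝ => ω * v) ω u := by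
    simpa using (hasDerivAt_id u).const_mul ω
  have h1 := (hs.mul hω.sin).deriv
  have h2 := (hs.mul hω.cos).deriv
  have e1 : deriv r = fun v => s v * sin (ω * v) := funext fun v => (hr v).deriv
  have e2 : deriv x = fun v => s v * cos (ω * v) := funext fun v => (hx v).deriv
  change deriv (fun v => s v * sin (ω * v)) u = _ at h1
  change deriv (fun v => s v * cos (ω * v)) u = _ at h2
  rw [e1, e2, h1, h2]
  have h3 : (s u * cos (ω * u)) ^ 2 + (s u * sin (ω * u)) ^ 2 = s u ^ 2 := by
    linear_combination s u ^ 2 * sin_sq_add_cos_sq (ω * u)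
  rw [h3, div_eq_iff (by positivity)]
  rw [hk, curv, mc] at hsk
  linear_combination s u ^ 2 * ω * sin_sq_add_cos_sq (ω * u) - s u ^ 2 * hsk

end

end ShrinkingDoughnut

open ShrinkingDoughnut

/-- **Shrinking doughnuts via variational methods, Theorem 1.1.**
There exists a simple closed geodesic `γ(u) = (r(u), x(u))` in the half-plane
`{r > 0}` with the metric `λ² (dr² + dx²)`, `λ = r^(n-1) exp(-(x²+r²)/4)`,
whose length is less than the length of the double cover of the half-line `{x = 0}`. -/
theorem shrinking_doughnut_exists (n : ℕ) (hn : 2 ≤ n) :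
    ∃ r x : ℝ → ℝ,
      ContDiff ℝ (⊤ : ℕ∞) r ∧ ContDiff ℝ (⊤ : ℕ∞) x ∧
      Function.Periodic r 1 ∧ Function.Periodic x 1 ∧
      (∀ u : ℝ, 0 < r u) ∧
      (∀ u : ℝ, (deriv r u, deriv x u) ≠ (0, 0)) ∧
      Set.InjOn (fun u => (r u, x u)) (Set.Ico (0 : ℝ) 1) ∧
      (∀ u : ℝ,
        (deriv x u * deriv (deriv r) u - deriv (deriv x) u * deriv r u) /
            ((deriv x u) ^ 2 + (deriv r u) ^ 2) =
          ((n - 1 : ℝ) / r u - r u / 2) * deriv x u + (1 / 2) * x u * deriv r u) ∧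
      (∫ u in (0:ℝ)..1,
          r u ^ (n - 1) * Real.exp (-(x u ^ 2 + r u ^ 2) / 4) *
            Real.sqrt ((deriv r u) ^ 2 + (deriv x u) ^ 2))
        < 2 * ∫ s in Set.Ioi (0 : ℝ), s ^ (n - 1) * Real.exp (-s ^ 2 / 4) := by
  have hN : ((n - 1 : ℕ) : ℝ) = n - 1 := by
    rw [Nat.cast_sub (by omega), Nat.cast_one]
  obtain ⟨P, hP, hper, hinj, hlen⟩ := exists_closed_orbit (N := ((n - 1 : ℕ) : ℝ))
    (by exact_mod_cast (by omega : 1 ≤ n - 1))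
  set N : ℝ := ((n - 1 : ℕ) : ℝ) with hNdef
  have hω : (0 : ℝ) < 2 * π := two_pi_pos
  have hsm := contDiff_of_solvesAt hP
  let k : ℝ → ℝ := fun u => curv N (2 * π * u) (P (2 * π * u)).1 (P (2 * π * u)).2
  have hk : ∀ u, 0 < k u := fun u => (hP _).curv_pos
  have hmul : ∀ u, HasDerivAt (fun v : ℝ => 2 * π * v) (2 * π) u := fun u => by
    simpa using (hasDerivAt_id u).const_mul (2 * π)
  have hr : ∀ u, HasDerivAt (fun v => (P (2 * π * v)).2) (2 * π / k u * sin (2 * π * u)) u :=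
    fun u => ((hP (2 * π * u)).hasDerivAt_snd.comp u (hmul u)).congr_deriv (by
      simp only [k]; ring)
  have hx : ∀ u, HasDerivAt (fun v => (P (2 * π * v)).1) (2 * π / k u * cos (2 * π * u)) u :=
    fun u => ((hP (2 * π * u)).hasDerivAt_fst.comp u (hmul u)).congr_deriv (by
      simp only [k]; ring)
  have hs0 : ∀ u, 0 < 2 * π / k u := fun u => div_pos hω (hk u)
  have hs : ∀ u, DifferentiableAt ℝ (fun v => 2 * π / k v) u := fun u => by
    have h1 : DifferentiableAt ℝ (fun v => (2 * π * v, P (2 * π * v))) u := by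
      have := hsm.differentiable (by simp)
      fun_prop
    have h2 : DifferentiableAt ℝ k u := DifferentiableAt.comp
      (g := fun p : ℝ × ℝ × ℝ => curv N p.1 p.2.1 p.2.2) u
      ((contDiffAt_curv (m := 1) (hP (2 * π * u)).pos.ne').differentiableAt one_ne_zero) h1
    exact (differentiableAt_const _).fun_div h2 (hk u).ne'
  have hperiod : ∀ u, P (2 * π * (u + 1)) = P (2 * π * u) := fun u => by
    rw [mul_add, mul_one, hper]
  refine ⟨fun u => (P (2 * π * u)).2, fun u => (P (2 * π * u)).1, by fun_prop, by fun_prop,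
    fun u => by simp only [hperiod], fun u => by simp only [hperiod], fun u => (hP _).pos,
    fun u hu => ?_, fun u hu v hv huv => ?_, fun u => ?_, ?_⟩
  · rw [(hr u).deriv, (hx u).deriv] at hu
    simp only [Prod.mk.injEq, mul_eq_zero, (hs0 u).ne', false_or] at hu
    have := sin_sq_add_cos_sq (2 * π * u)
    rw [hu.1, hu.2] at this
    norm_num at this
  · have h1 : ∀ w ∈ Set.Ico (0 : ℝ) 1, 2 * π * w ∈ Set.Ico 0 (2 * π) := fun w hw =>
      ⟨mul_nonneg hω.le hw.1, by nlinarith [hw.2]⟩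
    have h2 : P (2 * π * u) = P (2 * π * v) :=
      Prod.ext (Prod.ext_iff.1 huv).2 (Prod.ext_iff.1 huv).1
    exact mul_left_cancel₀ hω.ne' (hinj (h1 u hu) (h1 v hv) h2)
  · rw [← hN]
    exact geodesic_of_hasDerivAt (k := k) (div_mul_cancel₀ _ (hk u).ne') (hs0 u).ne'
      (hs u).hasDerivAt hr hx rfl
  · rw [← axisLen_natCast]
    refine lt_of_eq_of_lt ?_ hlen
    have h1 := intervalIntegral.mul_integral_comp_mul_left (f := fun t => dens N (t, P t)) (2 * π)
      (a := 0) (b := 1)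
    rw [mul_zero, mul_one, ← intervalIntegral.integral_const_mul] at h1
    rw [← h1]
    refine intervalIntegral.integral_congr fun u _ => ?_
    simp only [(hr _).deriv, (hx _).deriv]
    have h2 : (2 * π / k u * sin (2 * π * u)) ^ 2 + (2 * π / k u * cos (2 * π * u)) ^ 2 =
        (2 * π / k u) ^ 2 := by
      linear_combination (2 * π / k u) ^ 2 * sin_sq_add_cos_sq (2 * π * u)
    rw [h2, sqrt_sq (hs0 u).le, ← wt_natCast _ _ (hP _).pos]
    simp only [dens, k]
    ring
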